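/- Let ℋ be a positive real-analytic function on an open neighborhood O of the origin of ℝ³, and let A: ℝ → ℝ∖{0} be a 2π-periodic, real-analytic, nowhere-vanishing function. Then there exist a punctured disk Ω centered at (0,0) and a function z, real analytic on Ω and continuous on Ω ∪ {(0,0)} with z(0,0) = 0, which is an elliptic solution of the prescribed mean curvature equation for ℋ on Ω and satisfies: (1) the singularity of z at the origin is non-removable; (2) there is a conformal parametrization ψ: ℝ × (0,R) → ℝ³ of the graph of z near the singularity extending real-analytically across v = 0 with ψ(u,0) = (0,0,0) and ∂_vψ(u,0) = A(u)(cos u, −sin u, 1) for all u ∈ ℝ; (3) the Hessian determinant z_xx z_yy − z_xy² is nonvanishing on a punctured neighborhood of the origin. -/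

import Mathlib

noncomputable section

open Real Set Metric Filter MeasureTheory

/-- Points of Minkowski 3-space, as nested pairs. -/
abbrev R3 : Type := ℝ × ℝ × ℝ

/-- The Lorentzian inner product `⟨a,b⟩_L = a₁b₁ + a₂b₂ − a₃b₃` of Minkowski 3-space. -/
def lor (a b : R3) : ℝ := a.1 * b.1 + a.2.1 * b.2.1 - a.2.2 * b.2.2

/-- The Lorentzian cross product
`a ×_L b = (a₃b₂ − a₂b₃, a₁b₃ − a₃b₁, a₁b₂ − a₂b₁)`. -/
def lcross (a b : R3) : R3 :=
  (a.2.2 * b.2.1 - a.2.1 * b.2.2, a.1 * b.2.2 - a.2.2 * b.1, a.1 * b.2.1 - a.2.1 * b.1)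

/-- Partial derivative with respect to the first variable. -/
def pd1 {E : Type*} [NormedAddCommGroup E] [NormedSpace ℝ E]
    (f : ℝ × ℝ → E) (p : ℝ × ℝ) : E := fderiv ℝ f p (1, 0)

/-- Partial derivative with respect to the second variable. -/
def pd2 {E : Type*} [NormedAddCommGroup E] [NormedSpace ℝ E]
    (f : ℝ × ℝ → E) (p : ℝ × ℝ) : E := fderiv ℝ f p (0, 1)

def zx (z : ℝ × ℝ → ℝ) : ℝ × ℝ → ℝ := pd1 z
def zy (z : ℝ × ℝ → ℝ) : ℝ × ℝ → ℝ := pd2 z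
def zxx (z : ℝ × ℝ → ℝ) : ℝ × ℝ → ℝ := pd1 (zx z)
def zxy (z : ℝ × ℝ → ℝ) : ℝ × ℝ → ℝ := pd2 (zx z)
def zyy (z : ℝ × ℝ → ℝ) : ℝ × ℝ → ℝ := pd2 (zy z)

/-- Hessian determinant `z_xx z_yy − z_xy²`. -/
def hessDet (z : ℝ × ℝ → ℝ) (p : ℝ × ℝ) : ℝ := zxx z p * zyy z p - (zxy z p) ^ 2

/-- The punctured disk `{(x,y) : 0 < (x−x₀)² + (y−y₀)² < ρ²}`. -/
def PDisk (x₀ y₀ ρ : ℝ) : Set (ℝ × ℝ) :=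
  {p | 0 < (p.1 - x₀) ^ 2 + (p.2 - y₀) ^ 2 ∧ (p.1 - x₀) ^ 2 + (p.2 - y₀) ^ 2 < ρ ^ 2}

/-- `z` is an elliptic solution of the prescribed mean curvature equation for `H` on `U`,
with graph contained in `O`. -/
def IsEllSol (H : R3 → ℝ) (O : Set R3) (U : Set (ℝ × ℝ)) (z : ℝ × ℝ → ℝ) : Prop :=
  ContDiffOn ℝ 2 z U ∧
  (∀ p ∈ U, ((p.1, p.2, z p) : R3) ∈ O) ∧
  (∀ p ∈ U, (zx z p) ^ 2 + (zy z p) ^ 2 < 1) ∧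
  (∀ p ∈ U,
    (1 - (zy z p) ^ 2) * zxx z p + 2 * zx z p * zy z p * zxy z p
        + (1 - (zx z p) ^ 2) * zyy z p
      = 2 * H (p.1, p.2, z p) * (1 - (zx z p) ^ 2 - (zy z p) ^ 2) ^ ((3 : ℝ) / 2))

/-- The isolated singularity of `z` at `(x₀,y₀)` is removable: some `C²` function on a full
disk centered at `(x₀,y₀)` agrees with `z` on a punctured neighborhood. -/
def RemovableSing (x₀ y₀ : ℝ) (z : ℝ × ℝ → ℝ) : Prop :=
  ∃ ε > 0, ∃ Z : ℝ × ℝ → ℝ,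
    ContDiffOn ℝ 2 Z (ball ((x₀, y₀) : ℝ × ℝ) ε) ∧
    ∀ p ∈ ball ((x₀, y₀) : ℝ × ℝ) ε, p ≠ (x₀, y₀) → Z p = z p

/-- `H` is of class `C^{k,α}` on `O`: it is `C^k` and its `k`-th derivative is locally
`α`-Hölder on `O`. -/
def IsCkalpha (k : ℕ) (α : NNReal) (H : R3 → ℝ) (O : Set R3) : Prop :=
  ContDiffOn ℝ k H O ∧
  ∀ p ∈ O, ∃ ε > 0, ∃ C : NNReal,
    HolderOnWith C α (iteratedFDeriv ℝ k H) (ball p ε ∩ O)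

/-- The open strip `ℝ × (0,R)`. -/
def Strip (R : ℝ) : Set (ℝ × ℝ) := {p | 0 < p.2 ∧ p.2 < R}

/-- The open strip `ℝ × (−R,R)`. -/
def Strip2 (R : ℝ) : Set (ℝ × ℝ) := {p | -R < p.2 ∧ p.2 < R}

/-- The half-open strip `ℝ × [0,R)`. -/
def StripCl (R : ℝ) : Set (ℝ × ℝ) := {p | 0 ≤ p.2 ∧ p.2 < R}

/-- First two components of `ψ`: the planar projection `Π = (ψ₁, ψ₂)`. -/
def Pi2 (ψ : ℝ × ℝ → R3) (p : ℝ × ℝ) : ℝ × ℝ := ((ψ p).1, (ψ p).2.1)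

def comp1 (ψ : ℝ × ℝ → R3) : ℝ × ℝ → ℝ := fun p => (ψ p).1
def comp2 (ψ : ℝ × ℝ → R3) : ℝ × ℝ → ℝ := fun p => (ψ p).2.1
def comp3 (ψ : ℝ × ℝ → R3) : ℝ × ℝ → ℝ := fun p => (ψ p).2.2

/-- `ψ : ℝ × (0,R) → ℝ³` is a conformal parametrization of the graph of `z` near the
singularity `(x₀,y₀)`: it is 2π-periodic in `u`, its planar projection induces a
diffeomorphism with positive Jacobian from `(ℝ/2πℤ) × (0,R)` onto a punctured
neighborhood `W ⊆ Ω` of `(x₀,y₀)`, its third component is `z` of the first two, and the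
conformality conditions hold. -/
def IsConfParam (z : ℝ × ℝ → ℝ) (Ω : Set (ℝ × ℝ)) (x₀ y₀ R : ℝ)
    (ψ : ℝ × ℝ → R3) : Prop :=
  0 < R ∧
  ContDiffOn ℝ 1 ψ (Strip R) ∧
  (∀ u v : ℝ, ψ (u + 2 * π, v) = ψ (u, v)) ∧
  (∃ W : Set (ℝ × ℝ), W ⊆ Ω ∧ ((x₀, y₀) : ℝ × ℝ) ∉ W ∧
      insert ((x₀, y₀) : ℝ × ℝ) W ∈ nhds ((x₀, y₀) : ℝ × ℝ) ∧
      Pi2 ψ '' Strip R = W) ∧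
  (∀ p ∈ Strip R, ∀ q ∈ Strip R, Pi2 ψ p = Pi2 ψ q →
      p.2 = q.2 ∧ ∃ n : ℤ, p.1 - q.1 = 2 * π * n) ∧
  (∀ p ∈ Strip R,
      0 < pd1 (comp1 ψ) p * pd2 (comp2 ψ) p - pd2 (comp1 ψ) p * pd1 (comp2 ψ) p) ∧
  (∀ p ∈ Strip R, comp3 ψ p = z (Pi2 ψ p)) ∧
  (∀ p ∈ Strip R,
      lor (pd1 ψ p) (pd1 ψ p) = lor (pd2 ψ p) (pd2 ψ p) ∧
      0 < lor (pd1 ψ p) (pd1 ψ p) ∧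
      lor (pd1 ψ p) (pd2 ψ p) = 0)

/-- `ψ` extends real-analytically across `v = 0`, with `ψ(u,0) = p₀` and
`∂_vψ(u,0) = A(u)(cos u, −sin u, 1)`. -/
def ExtAnal (ψ : ℝ × ℝ → R3) (R : ℝ) (p₀ : R3) (A : ℝ → ℝ) : Prop :=
  ∃ ε > 0, ∃ Ψ : ℝ × ℝ → R3,
    AnalyticOnNhd ℝ Ψ {p : ℝ × ℝ | -ε < p.2 ∧ p.2 < R} ∧
    (∀ p ∈ Strip R, Ψ p = ψ p) ∧
    (∀ u : ℝ, Ψ (u, 0) = p₀) ∧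
    (∀ u : ℝ, pd2 Ψ (u, 0) = (A u * Real.cos u, -(A u * Real.sin u), A u))

/-- The class `𝒜₂` of 2π-periodic, real-analytic, nowhere vanishing functions. -/
def MemA2 (A : ℝ → ℝ) : Prop :=
  AnalyticOnNhd ℝ A univ ∧ (∀ u : ℝ, A (u + 2 * π) = A u) ∧ ∀ u : ℝ, A u ≠ 0

/-- The class `𝒜₁`: elliptic solutions on a punctured disk of radius `ρ` centered at
`(x₀,y₀)`, extending continuously with value `z₀`, whose Hessian determinant is
nonvanishing on a punctured neighborhood of `(x₀,y₀)`. -/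
def MemA1 (H : R3 → ℝ) (O : Set R3) (x₀ y₀ z₀ ρ : ℝ) (z : ℝ × ℝ → ℝ) : Prop :=
  0 < ρ ∧ IsEllSol H O (PDisk x₀ y₀ ρ) z ∧
  Tendsto z (nhdsWithin ((x₀, y₀) : ℝ × ℝ) (PDisk x₀ y₀ ρ)) (nhds z₀) ∧
  ∃ ε : ℝ, 0 < ε ∧ ε ≤ ρ ∧ ∀ p ∈ PDisk x₀ y₀ ε, hessDet z p ≠ 0

/-- `z` corresponds to `A`: some conformal parametrization of the graph of `z` near the
singularity extends real-analytically across `v = 0` with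
`∂_vψ(u,0) = A(u)(cos u, −sin u, 1)`. -/
def Corr (z : ℝ × ℝ → ℝ) (x₀ y₀ z₀ ρ : ℝ) (A : ℝ → ℝ) : Prop :=
  ∃ R : ℝ, ∃ ψ : ℝ × ℝ → R3,
    IsConfParam z (PDisk x₀ y₀ ρ) x₀ y₀ R ψ ∧ ExtAnal ψ R ((x₀, y₀, z₀) : R3) A

/-- The induced (first fundamental form) metric of the graph of `z`,
`ds² = (1−z_x²)dx² − 2 z_x z_y dx dy + (1−z_y²)dy²`, as a bilinear form. -/
def dsq (z : ℝ × ℝ → ℝ) (p : ℝ × ℝ) (ξ η : ℝ × ℝ) : ℝ :=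
  (1 - (zx z p) ^ 2) * ξ.1 * η.1 - zx z p * zy z p * (ξ.1 * η.2 + ξ.2 * η.1)
    + (1 - (zy z p) ^ 2) * ξ.2 * η.2

/-- `(Ω, ds²)` is conformally equivalent to the planar domain `D`: there is a `C¹`
diffeomorphism `Φ : Ω → D` and a positive function `λ` with
`⟨DΦ(ξ), DΦ(η)⟩_euc = λ · ds²(ξ,η)`. -/
def ConfEquiv (z : ℝ × ℝ → ℝ) (Ω D : Set (ℝ × ℝ)) : Prop :=
  ∃ (Φ : ℝ × ℝ → ℝ × ℝ) (Φinv : ℝ × ℝ → ℝ × ℝ) (lam : ℝ × ℝ → ℝ),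
    ContDiffOn ℝ 1 Φ Ω ∧ ContDiffOn ℝ 1 Φinv D ∧
    (∀ p ∈ Ω, Φ p ∈ D ∧ Φinv (Φ p) = p) ∧
    (∀ q ∈ D, Φinv q ∈ Ω ∧ Φ (Φinv q) = q) ∧
    (∀ p ∈ Ω, 0 < lam p ∧
      ∀ ξ η : ℝ × ℝ, (fderiv ℝ Φ p ξ).1 * (fderiv ℝ Φ p η).1
          + (fderiv ℝ Φ p ξ).2 * (fderiv ℝ Φ p η).2 = lam p * dsq z p ξ η)

/-- The weight `j! k! / (j+k)!` of the monomial `s^j t^k`. -/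
def wt (p : Fin 2 →₀ ℕ) : ℝ := ((p 0 + p 1).choose (p 0) : ℝ)⁻¹

lemma wt_pos (p : Fin 2 →₀ ℕ) : 0 < wt p :=
  inv_pos.2 (by exact_mod_cast Nat.choose_pos (Nat.le_add_right _ _))

lemma wt_zero : wt 0 = 1 := by simp [wt]

lemma choose_mul_choose_le (a b c d : ℕ) :
    (a + b).choose a * (c + d).choose c ≤ (a + c + (b + d)).choose (a + c) := by
  rw [show a + c + (b + d) = (a + b) + (c + d) by ring, Nat.add_choose_eq (a + b) (c + d)]
  exact Finset.single_le_sum (f := fun ij : ℕ × ℕ => (a + b).choose ij.1 * (c + d).choose ij.2)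
    (fun _ _ => Nat.zero_le _) (Finset.HasAntidiagonal.mem_antidiagonal.2
      (rfl : (a, c).1 + (a, c).2 = a + c))

lemma wt_add_le (p q : Fin 2 →₀ ℕ) : wt (p + q) ≤ wt p * wt q := by
  unfold wt
  rw [← mul_inv]
  refine inv_anti₀ (inv_pos.1 (by rw [mul_inv]; exact mul_pos (wt_pos p) (wt_pos q))) ?_
  simp only [Finsupp.add_apply]
  exact_mod_cast choose_mul_choose_le (p 0) (p 1) (q 0) (q 1)

lemma abs_coeff_mul_le (f g : MvPowerSeries (Fin 2) ℝ) (n : Fin 2 →₀ ℕ) :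
    |MvPowerSeries.coeff n (f * g)| * wt n ≤
      ∑ pq ∈ Finset.HasAntidiagonal.antidiagonal n, (|MvPowerSeries.coeff pq.1 f| * wt pq.1) *
        (|MvPowerSeries.coeff pq.2 g| * wt pq.2) := by
  rw [MvPowerSeries.coeff_mul]
  refine (mul_le_mul_of_nonneg_right (Finset.abs_sum_le_sum_abs _ _) (wt_pos n).le).trans ?_
  rw [Finset.sum_mul]
  refine Finset.sum_le_sum fun pq hpq => ?_
  rw [← Finset.HasAntidiagonal.mem_antidiagonal.1 hpq, abs_mul]
  calc _ ≤ _ := mul_le_mul_of_nonneg_left (wt_add_le pq.1 pq.2) (by positivity)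
    _ = _ := by ring

lemma tsum_le_tsum_mul_of_antidiagonal {a b c : (Fin 2 →₀ ℕ) → ℝ} (ha : Summable a)
    (hb : Summable b) (hc : Summable c) (ha0 : ∀ p, 0 ≤ a p) (hb0 : ∀ p, 0 ≤ b p)
    (h : ∀ n, c n ≤ ∑ pq ∈ Finset.HasAntidiagonal.antidiagonal n, a pq.1 * b pq.2) :
    ∑' n, c n ≤ (∑' p, a p) * ∑' p, b p := by
  have hab := ha.mul_of_nonneg hb ha0 hb0
  rw [ha.tsum_mul_tsum_eq_tsum_sum_antidiagonal hb hab]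
  exact hc.tsum_le_tsum h (summable_sum_mul_antidiagonal_of_summable_mul hab)

/-- The power series in two variables whose weighted `ℓ¹` norm is finite. -/
def wtSubalgebra : Subalgebra ℝ (MvPowerSeries (Fin 2) ℝ) where
  carrier := {f | Summable fun p => |MvPowerSeries.coeff p f| * wt p}
  mul_mem' := by
    intro f g hf hg
    have h := summable_sum_mul_antidiagonal_of_summable_mul
      (Summable.mul_of_nonneg hf hg (fun p => mul_nonneg (abs_nonneg _) (wt_pos p).le)
        (fun p => mul_nonneg (abs_nonneg _) (wt_pos p).le))
    exact h.of_nonneg_of_le (fun p => mul_nonneg (abs_nonneg _) (wt_pos p).le)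
      (fun n => abs_coeff_mul_le f g n)
  add_mem' := by
    intro f g hf hg
    refine (hf.add hg).of_nonneg_of_le
      (fun p => mul_nonneg (abs_nonneg _) (wt_pos p).le) fun p => ?_
    rw [map_add, ← add_mul]
    exact mul_le_mul_of_nonneg_right (abs_add_le _ _) (wt_pos p).le
  algebraMap_mem' := by
    intro r
    refine summable_of_ne_finset_zero (s := {0}) fun p hp => ?_
    rw [MvPowerSeries.algebraMap_apply, MvPowerSeries.coeff_C, if_neg (by simpa using hp)]
    simp

/-- The Banach algebra of power series in two variables with finite weighted `ℓ¹` norm. -/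
def WSeries : Type := wtSubalgebra

namespace WSeries

instance : CommRing WSeries := inferInstanceAs (CommRing wtSubalgebra)
instance : Algebra ℝ WSeries := inferInstanceAs (Algebra ℝ wtSubalgebra)

/-- The coefficients of a weighted series. -/
def cf (f : WSeries) (p : Fin 2 →₀ ℕ) : ℝ := MvPowerSeries.coeff p f.1

@[ext] lemma ext {f g : WSeries} (h : ∀ p, f.cf p = g.cf p) : f = g :=
  Subtype.ext (MvPowerSeries.ext h)

@[simp] lemma cf_add (f g : WSeries) (p) : (f + g).cf p = f.cf p + g.cf p :=
  map_add (MvPowerSeries.coeff p) f.1 g.1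
@[simp] lemma cf_neg (f : WSeries) (p) : (-f).cf p = -f.cf p :=
  map_neg (MvPowerSeries.coeff p) f.1
@[simp] lemma cf_zero (p) : (0 : WSeries).cf p = 0 :=
  map_zero (MvPowerSeries.coeff (R := ℝ) p)
@[simp] lemma cf_smul (r : ℝ) (f : WSeries) (p) : (r • f).cf p = r * f.cf p :=
  map_smul (MvPowerSeries.coeff p) r f.1
lemma cf_mul (f g : WSeries) (n) :
    (f * g).cf n = ∑ pq ∈ Finset.HasAntidiagonal.antidiagonal n, f.cf pq.1 * g.cf pq.2 :=
  MvPowerSeries.coeff_mul n f.1 g.1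
lemma cf_one (p) : (1 : WSeries).cf p = if p = 0 then 1 else 0 :=
  MvPowerSeries.coeff_one p

lemma summable (f : WSeries) : Summable fun p => |f.cf p| * wt p := f.2

/-- A weighted series from its coefficients. -/
def mk (c : (Fin 2 →₀ ℕ) → ℝ) (h : Summable fun p => |c p| * wt p) : WSeries := ⟨c, h⟩

@[simp] lemma cf_mk (c h p) : (mk c h).cf p = c p := rfl

instance : Norm WSeries := ⟨fun f => ∑' p, |f.cf p| * wt p⟩

lemma norm_def (f : WSeries) : ‖f‖ = ∑' p, |f.cf p| * wt p := rfl

lemma term_nonneg (f : WSeries) (p) : 0 ≤ |f.cf p| * wt p :=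
  mul_nonneg (abs_nonneg _) (wt_pos p).le

lemma term_le_norm (f : WSeries) (p) : |f.cf p| * wt p ≤ ‖f‖ :=
  f.summable.le_tsum p fun q _ => f.term_nonneg q

/-- The weighted `ℓ¹` norm as a group norm. -/
def groupNorm : AddGroupNorm WSeries where
  toFun f := ‖f‖
  map_zero' := by simp [norm_def]
  add_le' f g := by
    rw [norm_def, norm_def, norm_def, ← f.summable.tsum_add g.summable]
    refine (f + g).summable.tsum_le_tsum (fun p => ?_) (f.summable.add g.summable)
    rw [cf_add, ← add_mul]
    exact mul_le_mul_of_nonneg_right (abs_add_le _ _) (wt_pos p).le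
  neg' f := by simp [norm_def]
  eq_zero_of_map_eq_zero' f hf := by
    ext p
    have h := f.term_le_norm p
    rw [show ‖f‖ = 0 from hf] at h
    have h2 := le_antisymm h (f.term_nonneg p)
    simpa [(wt_pos p).ne'] using h2

lemma abs_cf_mul_le (f g : WSeries) (n : Fin 2 →₀ ℕ) :
    |(f * g).cf n| * wt n ≤ ∑ pq ∈ Finset.HasAntidiagonal.antidiagonal n,
      (|f.cf pq.1| * wt pq.1) * (|g.cf pq.2| * wt pq.2) :=
  abs_coeff_mul_le f.1 g.1 n

lemma norm_mul_le_mul (f g : WSeries) : ‖f * g‖ ≤ ‖f‖ * ‖g‖ := by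
  have h := tsum_le_tsum_mul_of_antidiagonal f.summable g.summable (f * g).summable
    f.term_nonneg g.term_nonneg (abs_cf_mul_le f g)
  exact h

instance : NormedCommRing WSeries where
  toCommRing := inferInstance
  toMetricSpace := groupNorm.toNormedAddCommGroup.toMetricSpace
  toNorm := inferInstance
  dist_eq := fun f g => groupNorm.toNormedAddCommGroup.dist_eq f g
  norm_mul_le := norm_mul_le_mul

instance : NormedAlgebra ℝ WSeries where
  norm_smul_le r f := by
    rw [norm_def, norm_def, Real.norm_eq_abs, ← tsum_mul_left]
    exact le_of_eq (tsum_congr fun p => by rw [cf_smul, abs_mul, mul_assoc])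

instance : NormOneClass WSeries where
  norm_one := by
    rw [norm_def, tsum_eq_single 0 fun p hp => by simp [cf_one, hp]]
    simp [cf_one, wt_zero]

/-- The linear isometric identification with the unweighted `ℓ¹` space. -/
def toLp : WSeries ≃ₗᵢ[ℝ] lp (fun _ : Fin 2 →₀ ℕ => ℝ) 1 where
  toFun f := ⟨fun p => f.cf p * wt p, memℓp_gen (by
    simpa [abs_mul, abs_of_pos (wt_pos _)] using f.summable)⟩
  invFun c := mk (fun p => c p / wt p) (by
    have := (lp.memℓp c).summable (by simp)
    simpa [abs_div, abs_of_pos (wt_pos _), (wt_pos _).ne'] using this)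
  map_add' f g := by ext p; exact (congrArg (· * wt p) (cf_add f g p)).trans (add_mul _ _ _)
  map_smul' r f := by ext p; simp [mul_assoc]
  left_inv f := by ext p; simp [(wt_pos _).ne']
  right_inv c := by ext p; simp [(wt_pos _).ne']
  norm_map' f := by
    rw [lp.norm_eq_tsum_rpow (by simp)]
    simp [norm_def, abs_of_pos (wt_pos _)]

instance : CompleteSpace WSeries :=
  (completeSpace_congr (e := toLp.toEquiv) toLp.isometry.isUniformEmbedding).2 inferInstance

end WSeries

namespace WSeries

/-- The exponent of the first variable `s`. -/
def e0 : Fin 2 →₀ ℕ := Finsupp.single 0 1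
/-- The exponent of the second variable `t`. -/
def e1 : Fin 2 →₀ ℕ := Finsupp.single 1 1

@[simp] lemma e0_zero : e0 0 = 1 := by simp [e0]
@[simp] lemma e0_one : e0 1 = 0 := by simp [e0]
@[simp] lemma e1_zero : e1 0 = 0 := by simp [e1]
@[simp] lemma e1_one : e1 1 = 1 := by simp [e1]

lemma exists_eq_add_e0 {p : Fin 2 →₀ ℕ} (h : p 0 ≠ 0) : ∃ q, p = q + e0 :=
  ⟨p - e0, (tsub_add_cancel_of_le (Finsupp.single_le_iff.2 (Nat.one_le_iff_ne_zero.2 h))).symm⟩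

lemma exists_eq_add_e1 {p : Fin 2 →₀ ℕ} (h : p 1 ≠ 0) : ∃ q, p = q + e1 :=
  ⟨p - e1, (tsub_add_cancel_of_le (Finsupp.single_le_iff.2 (Nat.one_le_iff_ne_zero.2 h))).symm⟩

/-- Multiplication of a coefficient family by the variable `t`. -/
def shiftT (c : (Fin 2 →₀ ℕ) → ℝ) (p : Fin 2 →₀ ℕ) : ℝ := if p 1 = 0 then 0 else c (p - e1)

@[simp] lemma shiftT_add (c q) : shiftT c (q + e1) = c q := by simp [shiftT]

lemma shiftT_of_eq_zero (c) {p : Fin 2 →₀ ℕ} (h : p 1 = 0) : shiftT c p = 0 := by simp [shiftT, h]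

lemma hasSum_of_eq {a b : (Fin 2 →₀ ℕ) → ℝ} (h : ∀ p, a p = b p) {x : ℝ} (ha : HasSum a x) :
    HasSum b x := funext h ▸ ha

lemma hasSum_of_add_e1 {g : (Fin 2 →₀ ℕ) → ℝ} (hg : ∀ p, p 1 = 0 → g p = 0) {a : ℝ} :
    HasSum (fun q => g (q + e1)) a ↔ HasSum g a := by
  refine Function.Injective.hasSum_iff (g := fun q => q + e1) (add_left_injective e1) fun p hp => ?_
  by_contra h
  obtain ⟨q, rfl⟩ := exists_eq_add_e1 (fun h1 => h (hg p h1))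
  exact hp ⟨q, rfl⟩

lemma hasSum_of_add_e0 {g : (Fin 2 →₀ ℕ) → ℝ} (hg : ∀ p, p 0 = 0 → g p = 0) {a : ℝ} :
    HasSum (fun q => g (q + e0)) a ↔ HasSum g a := by
  refine Function.Injective.hasSum_iff (g := fun q => q + e0) (add_left_injective e0) fun p hp => ?_
  by_contra h
  obtain ⟨q, rfl⟩ := exists_eq_add_e0 (fun h1 => h (hg p h1))
  exact hp ⟨q, rfl⟩

lemma hasSum_norm_shiftT {c : (Fin 2 →₀ ℕ) → ℝ} {a : ℝ} :
    HasSum (fun q => |c q| * wt (q + e1)) a ↔ HasSum (fun p => |shiftT c p| * wt p) a := by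
  rw [← hasSum_of_add_e1 (g := fun p => |shiftT c p| * wt p)
    (fun p hp => by simp [shiftT_of_eq_zero c hp])]
  simp

lemma wt_eq (p : Fin 2 →₀ ℕ) :
    wt p = (p 0).factorial * (p 1).factorial / (p 0 + p 1).factorial := by
  rw [wt, Nat.choose_symm_add, Nat.add_choose, Nat.cast_div
    (Nat.factorial_mul_factorial_dvd_factorial_add _ _)
    (by positivity)]
  push_cast
  rw [inv_div]

lemma wt_add_e1 (p : Fin 2 →₀ ℕ) : wt (p + e1) = (p 1 + 1) / (p 0 + p 1 + 1) * wt p := by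
  rw [wt_eq, wt_eq]
  simp only [Finsupp.add_apply, e1_zero, e1_one, add_zero, ← add_assoc, Nat.factorial_succ]
  push_cast
  field_simp

lemma wt_add_e0 (p : Fin 2 →₀ ℕ) : wt (p + e0) = (p 0 + 1) / (p 0 + p 1 + 1) * wt p := by
  rw [wt_eq, wt_eq]
  simp only [Finsupp.add_apply, e0_zero, e0_one, add_zero, Nat.factorial_succ,
    show p 0 + 1 + p 1 = p 0 + p 1 + 1 by ring]
  push_cast
  field_simp

lemma wt_add_e1_eq (p : Fin 2 →₀ ℕ) : (p 0 + 1) / (p 1 + 1) * wt (p + e1) = wt (p + e0) := by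
  rw [wt_add_e1, wt_add_e0]
  field_simp

lemma wt_add_e1_le (p : Fin 2 →₀ ℕ) : wt (p + e1) ≤ wt p := by
  rw [wt_add_e1]
  refine mul_le_of_le_one_left (wt_pos p).le ?_
  rw [div_le_one (by positivity)]
  have : (0 : ℝ) ≤ p 0 := by positivity
  linarith

lemma abs_div_succ_le (x : ℝ) (n : ℕ) : |x / (n + 1)| ≤ |x| := by
  rw [abs_div, abs_of_pos (by positivity : (0 : ℝ) < n + 1)]
  exact div_le_self (abs_nonneg _) (by linarith [n.cast_nonneg (α := ℝ)])

/-- Integration in `t` followed by division by `t`. -/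
def avg : WSeries →L[ℝ] WSeries :=
  LinearMap.mkContinuous
    { toFun := fun f => mk (fun p => f.cf p / (p 1 + 1))
        (f.summable.of_nonneg_of_le (fun p => mul_nonneg (abs_nonneg _) (wt_pos p).le) fun p =>
          mul_le_mul_of_nonneg_right (abs_div_succ_le _ _) (wt_pos p).le)
      map_add' := fun f g => by ext p; simp [add_div]
      map_smul' := fun r f => by ext p; simp [mul_div_assoc] } 1 (fun f => by
    rw [one_mul]
    exact Summable.tsum_le_tsum (fun p =>
      mul_le_mul_of_nonneg_right (abs_div_succ_le _ _) (wt_pos p).le) (summable _) f.summable)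

@[simp] lemma cf_avg (f : WSeries) (p) : (avg f).cf p = f.cf p / (p 1 + 1) := rfl

lemma shiftT_linear (a b : (Fin 2 →₀ ℕ) → ℝ) (p) : shiftT (fun q => a q + b q) p =
    shiftT a p + shiftT b p := by
  unfold shiftT; split_ifs <;> simp

lemma shiftT_smul (r : ℝ) (a : (Fin 2 →₀ ℕ) → ℝ) (p) : shiftT (fun q => r * a q) p =
    r * shiftT a p := by
  unfold shiftT; split_ifs <;> simp

/-- A coefficient family bounded by a summable one defines, after multiplication by `t`, a
weighted series. -/
lemma summable_shiftT {c a : (Fin 2 →₀ ℕ) → ℝ} (ha : Summable a)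
    (h : ∀ q, |c q| * wt (q + e1) ≤ a q) : Summable fun p => |shiftT c p| * wt p :=
  (hasSum_norm_shiftT.1 (ha.of_nonneg_of_le
    (fun _ => mul_nonneg (abs_nonneg _) (wt_pos _).le) h).hasSum).summable

lemma tsum_shiftT_le {c a : (Fin 2 →₀ ℕ) → ℝ} (ha : Summable a)
    (h : ∀ q, |c q| * wt (q + e1) ≤ a q) : ∑' p, |shiftT c p| * wt p ≤ ∑' q, a q := by
  have h1 := ha.of_nonneg_of_le (fun q => mul_nonneg (abs_nonneg _) (wt_pos _).le) h
  rw [(hasSum_norm_shiftT.1 h1.hasSum).tsum_eq]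
  exact h1.tsum_le_tsum h ha

lemma int_bound (f : WSeries) (q : Fin 2 →₀ ℕ) :
    |f.cf q / (q 1 + 1)| * wt (q + e1) ≤ |f.cf q| * wt q :=
  mul_le_mul (abs_div_succ_le _ _) (wt_add_e1_le q) (wt_pos _).le (abs_nonneg _)

/-- Integration in `t` from `0`. -/
def int : WSeries →L[ℝ] WSeries :=
  LinearMap.mkContinuous
    { toFun := fun f => mk (shiftT fun p => f.cf p / (p 1 + 1))
        (summable_shiftT f.summable f.int_bound)
      map_add' := fun f g => by ext p; simp [add_div, shiftT_linear]
      map_smul' := fun r f => by ext p; simp [mul_div_assoc, shiftT_smul] } 1 (fun f => by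
    rw [one_mul]
    exact tsum_shiftT_le f.summable f.int_bound)

lemma cf_int (f : WSeries) : (int f).cf = shiftT fun p => f.cf p / (p 1 + 1) := rfl

lemma summable_add_e0 (f : WSeries) : Summable fun q => |f.cf (q + e0)| * wt (q + e0) :=
  f.summable.comp_injective (i := fun q => q + e0) (add_left_injective e0)

lemma dint_bound (f : WSeries) (q : Fin 2 →₀ ℕ) :
    |(q 0 + 1) / (q 1 + 1) * f.cf (q + e0)| * wt (q + e1) ≤ |f.cf (q + e0)| * wt (q + e0) := by
  rw [abs_mul, abs_of_pos (by positivity : (0 : ℝ) < (q 0 + 1) / (q 1 + 1)), ← wt_add_e1_eq q]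
  exact le_of_eq (by ring)

/-- The derivative in `s` of the integral in `t` from `0`. -/
def dint : WSeries →L[ℝ] WSeries :=
  LinearMap.mkContinuous
    { toFun := fun f => mk (shiftT fun q => (q 0 + 1) / (q 1 + 1) * f.cf (q + e0))
        (summable_shiftT f.summable_add_e0 f.dint_bound)
      map_add' := fun f g => by ext p; simp [mul_add, shiftT_linear]
      map_smul' := fun r f => by
        ext p
        simp only [cf_mk, cf_smul, RingHom.id_apply, ← shiftT_smul]
        congr 1; ext q; ring } 1 (fun f => by
    rw [one_mul]
    refine (tsum_shiftT_le f.summable_add_e0 f.dint_bound).trans ?_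
    exact tsum_comp_le_tsum_of_inj f.summable f.term_nonneg
      (i := fun q => q + e0) (add_left_injective e0))

lemma cf_dint (f : WSeries) :
    (dint f).cf = shiftT fun q => (q 0 + 1) / (q 1 + 1) * f.cf (q + e0) := rfl

lemma dint_int (f : WSeries) : dint (int f) = int (dint f) := by
  ext p
  rw [cf_dint (int f), cf_int (dint f)]
  refine congrArg (fun c => shiftT c p) (funext fun q => ?_)
  rw [cf_dint, cf_int]
  by_cases h : q 1 = 0
  · rw [shiftT_of_eq_zero _ h, shiftT_of_eq_zero _ (by simpa using h)]
    simp
  · obtain ⟨r, rfl⟩ := exists_eq_add_e1 h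
    rw [add_right_comm, shiftT_add, shiftT_add]
    simp
    ring

/-- Evaluation of a weighted series. -/
def ev (s t : ℝ) (f : WSeries) : ℝ := ∑' p, f.cf p * (s ^ p 0 * t ^ p 1)

lemma monomial_le_wt {s t : ℝ} (h : |s| + |t| ≤ 1) (p : Fin 2 →₀ ℕ) :
    |s ^ p 0 * t ^ p 1| ≤ wt p := by
  rw [abs_mul, abs_pow, abs_pow, wt, ← one_div, le_div_iff₀ (inv_pos.1 (wt_pos p))]
  calc |s| ^ p 0 * |t| ^ p 1 * ((p 0 + p 1).choose (p 0) : ℝ)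
      ≤ (|s| + |t|) ^ (p 0 + p 1) := by
        rw [add_pow]
        have := Finset.single_le_sum (s := Finset.range (p 0 + p 1 + 1))
          (f := fun m => |s| ^ m * |t| ^ (p 0 + p 1 - m) * ((p 0 + p 1).choose m : ℝ))
          (fun _ _ => by positivity) (Finset.mem_range.2 (by omega : p 0 < p 0 + p 1 + 1))
        simpa using this
    _ ≤ 1 := pow_le_one₀ (by positivity) h

lemma abs_term_le {s t : ℝ} (h : |s| + |t| ≤ 1) (f : WSeries) (p : Fin 2 →₀ ℕ) :
    |f.cf p * (s ^ p 0 * t ^ p 1)| ≤ |f.cf p| * wt p := by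
  rw [abs_mul]
  exact mul_le_mul_of_nonneg_left (monomial_le_wt h p) (abs_nonneg _)

lemma summable_abs_ev {s t : ℝ} (h : |s| + |t| ≤ 1) (f : WSeries) :
    Summable fun p => |f.cf p * (s ^ p 0 * t ^ p 1)| :=
  f.summable.of_nonneg_of_le (fun _ => abs_nonneg _) (abs_term_le h f)

lemma summable_ev {s t : ℝ} (h : |s| + |t| ≤ 1) (f : WSeries) :
    Summable fun p => f.cf p * (s ^ p 0 * t ^ p 1) :=
  (summable_abs_ev h f).of_abs

lemma hasSum_ev {s t : ℝ} (h : |s| + |t| ≤ 1) (f : WSeries) :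
    HasSum (fun p => f.cf p * (s ^ p 0 * t ^ p 1)) (ev s t f) :=
  (summable_ev h f).hasSum

lemma abs_ev_le {s t : ℝ} (h : |s| + |t| ≤ 1) (f : WSeries) : |ev s t f| ≤ ‖f‖ :=
  tsum_of_norm_bounded (f := fun p => f.cf p * (s ^ p 0 * t ^ p 1)) f.summable.hasSum
    (abs_term_le h f)

lemma ev_add {s t : ℝ} (h : |s| + |t| ≤ 1) (f g : WSeries) :
    ev s t (f + g) = ev s t f + ev s t g := by
  rw [ev, ev, ev, ← (summable_ev h f).tsum_add (summable_ev h g)]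
  simp [add_mul]

lemma ev_smul (s t r : ℝ) (f : WSeries) : ev s t (r • f) = r * ev s t f := by
  rw [ev, ev, ← tsum_mul_left]
  simp [mul_assoc]

lemma tsum_mul_eq_tsum_antidiagonal {a b : (Fin 2 →₀ ℕ) → ℝ} (ha : Summable fun p => |a p|)
    (hb : Summable fun p => |b p|) : (∑' p, a p) * ∑' p, b p =
      ∑' n, ∑ pq ∈ Finset.HasAntidiagonal.antidiagonal n, a pq.1 * b pq.2 :=
  ha.of_abs.tsum_mul_tsum_eq_tsum_sum_antidiagonal hb.of_abs (summable_mul_of_summable_norm ha hb)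

lemma ev_mul {s t : ℝ} (h : |s| + |t| ≤ 1) (f g : WSeries) :
    ev s t (f * g) = ev s t f * ev s t g := by
  rw [ev, ev, ev, tsum_mul_eq_tsum_antidiagonal (summable_abs_ev h f) (summable_abs_ev h g)]
  refine tsum_congr fun n => ?_
  rw [cf_mul, Finset.sum_mul]
  refine Finset.sum_congr rfl fun pq hpq => ?_
  rw [← Finset.HasAntidiagonal.mem_antidiagonal.1 hpq]
  simp only [Finsupp.add_apply, pow_add]
  ring

lemma ev_one (s t : ℝ) : ev s t 1 = 1 := by
  rw [ev, tsum_eq_single 0 fun p hp => by simp [cf_one, hp]]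
  simp [cf_one]

/-- Evaluation as a continuous linear functional. -/
def evL (s t : ℝ) (h : |s| + |t| ≤ 1) : WSeries →L[ℝ] ℝ :=
  LinearMap.mkContinuous
    { toFun := ev s t, map_add' := ev_add h, map_smul' := ev_smul s t } 1
    (fun f => by rw [one_mul]; exact abs_ev_le h f)

lemma ev_int (s t : ℝ) (h : |s| + |t| ≤ 1) (f : WSeries) :
    ev s t (int f) = t * ev s t (avg f) := by
  refine (hasSum_ev h (int f)).unique ?_
  rw [← hasSum_of_add_e1 fun p hp => by rw [cf_int, shiftT_of_eq_zero _ hp, zero_mul]]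
  refine hasSum_of_eq (fun q => ?_) ((hasSum_ev h (avg f)).mul_left t)
  rw [cf_int, shiftT_add, cf_avg]
  simp only [Finsupp.add_apply, e1_zero, e1_one, pow_add, pow_zero, pow_one]
  ring

lemma hasSum_ev_int {s t : ℝ} (h : |s| + |t| ≤ 1) (f : WSeries) :
    HasSum (fun p => f.cf p / (p 1 + 1) * (s ^ p 0 * t ^ (p 1 + 1))) (ev s t (int f)) := by
  have := hasSum_ev h (int f)
  rw [← hasSum_of_add_e1 fun p hp => by rw [cf_int, shiftT_of_eq_zero _ hp, zero_mul]] at this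
  simpa [cf_int] using this

lemma hasSum_ev_dint {s t : ℝ} (h : |s| + |t| ≤ 1) (f : WSeries) :
    HasSum (fun p => f.cf p / (p 1 + 1) * (p 0 * s ^ (p 0 - 1) * t ^ (p 1 + 1)))
      (ev s t (dint f)) := by
  have := hasSum_ev h (dint f)
  rw [← hasSum_of_add_e1 fun p hp => by rw [cf_dint, shiftT_of_eq_zero _ hp, zero_mul]] at this
  rw [← hasSum_of_add_e0 fun p hp => by simp [hp]]
  refine hasSum_of_eq (fun q => ?_) this
  rw [cf_dint, shiftT_add]
  simp
  ring

lemma isPreconnected_abs_lt (r : ℝ) : IsPreconnected {x : ℝ | |x| < r} := by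
  have : {x : ℝ | |x| < r} = Ioo (-r) r := by ext x; simp [abs_lt]
  rw [this]; exact isPreconnected_Ioo

lemma isOpen_abs_lt (r : ℝ) : IsOpen {x : ℝ | |x| < r} :=
  isOpen_lt continuous_abs continuous_const

/-- The `t`-derivative of the integral in `t`. -/
lemma hasDerivAt_ev_int {s t : ℝ} (h : |s| + |t| < 1) (f : WSeries) :
    HasDerivAt (fun y => ev s y (int f)) (ev s t f) t := by
  have key := hasDerivAt_tsum_of_isPreconnected (u := fun p => |f.cf p| * wt p)
    (t := {x | |x| < 1 - |s|}) (y := t) (y₀ := t)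
    (g := fun p y => f.cf p / (p 1 + 1) * (s ^ p 0 * y ^ (p 1 + 1)))
    (g' := fun p y => f.cf p * (s ^ p 0 * y ^ p 1)) f.summable (isOpen_abs_lt _)
    (isPreconnected_abs_lt _) (fun p y _ => ?_)
    (fun p y hy => abs_term_le (by have hy' : |y| < _ := hy; linarith) f p)
    (lt_sub_iff_add_lt'.2 h) (hasSum_ev_int h.le f).summable
    (lt_sub_iff_add_lt'.2 h)
  · refine key.congr_of_eventuallyEq ?_
    filter_upwards [(isOpen_abs_lt (1 - |s|)).mem_nhds
      (show |t| < 1 - |s| by linarith)] with y hy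
    exact (hasSum_ev_int (by have hy' : |y| < _ := hy; linarith) f).tsum_eq.symm
  · have := ((hasDerivAt_pow (p 1 + 1) y).const_mul (s ^ p 0)).const_mul (f.cf p / (p 1 + 1))
    refine this.congr_deriv ?_
    rw [Nat.add_sub_cancel]
    push_cast
    field_simp

/-- The `s`-derivative of the integral in `t`. -/
lemma hasDerivAt_ev_dint {s t : ℝ} (h : |s| + |t| < 1) (f : WSeries) :
    HasDerivAt (fun x => ev x t (int f)) (ev s t (dint f)) s := by
  have key := hasDerivAt_tsum_of_isPreconnected (u := fun p => |f.cf p| * wt p)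
    (t := {x | |x| < 1 - |t|}) (y := s) (y₀ := s)
    (g := fun p x => f.cf p / (p 1 + 1) * (x ^ p 0 * t ^ (p 1 + 1)))
    (g' := fun p x => f.cf p / (p 1 + 1) * (p 0 * x ^ (p 0 - 1) * t ^ (p 1 + 1)))
    f.summable (isOpen_abs_lt _) (isPreconnected_abs_lt _) (fun p y _ => ?_) (fun p x hx => ?_)
    (lt_sub_iff_add_lt.2 h) (hasSum_ev_int h.le f).summable
    (lt_sub_iff_add_lt.2 h)
  · rw [(hasSum_ev_dint h.le f).tsum_eq] at key
    refine key.congr_of_eventuallyEq ?_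
    filter_upwards [(isOpen_abs_lt (1 - |t|)).mem_nhds
      (show |s| < 1 - |t| by linarith)] with x hx
    exact (hasSum_ev_int (by have hx' : |x| < _ := hx; linarith) f).tsum_eq.symm
  · exact ((hasDerivAt_pow (p 0) y).mul_const (t ^ (p 1 + 1))).const_mul (f.cf p / (p 1 + 1))
  · have hx' : |x| + |t| ≤ 1 := by have hx' : |x| < _ := hx; linarith
    by_cases h0 : p 0 = 0
    · simp only [h0, Nat.cast_zero, zero_mul, mul_zero, norm_zero]
      exact f.term_nonneg p
    · obtain ⟨q, rfl⟩ := exists_eq_add_e0 h0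
      have h1 := f.dint_bound q
      have h2 := mul_le_mul_of_nonneg_left (monomial_le_wt hx' (q + e1))
        (abs_nonneg ((q 0 + 1) / (q 1 + 1) * f.cf (q + e0)))
      rw [← abs_mul] at h2
      refine le_trans (le_of_eq ?_) (h2.trans h1)
      rw [Real.norm_eq_abs]
      congr 1
      simp
      ring

end WSeries

namespace WSeries

/-- The weighted backward shift in the exponent of `s`. -/
def back0 : WSeries →L[ℝ] WSeries :=
  LinearMap.mkContinuous
    { toFun := fun f => mk (fun p => (p 0 + 1) / (p 0 + p 1 + 1) * f.cf (p + e0))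
        (f.summable_add_e0.congr fun p => by
          rw [abs_mul, abs_of_pos (by positivity : (0 : ℝ) < (p 0 + 1) / (p 0 + p 1 + 1)),
            wt_add_e0]; ring)
      map_add' := fun f g => by ext p; simp [mul_add]
      map_smul' := fun r f => by ext p; simp [mul_left_comm] } 1
    (fun f => by
      rw [one_mul, norm_def, norm_def]
      refine le_trans (le_of_eq (tsum_congr fun p => ?_)) (tsum_comp_le_tsum_of_inj
        f.summable f.term_nonneg
        (i := fun q => q + e0) (add_left_injective e0))
      simp only [LinearMap.coe_mk, AddHom.coe_mk, cf_mk]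
      rw [abs_mul, abs_of_pos (by positivity : (0 : ℝ) < (p 0 + 1) / (p 0 + p 1 + 1)),
            Function.comp_apply, wt_add_e0]; ring)

lemma cf_back0 (f : WSeries) (p) :
    (back0 f).cf p = (p 0 + 1) / (p 0 + p 1 + 1) * f.cf (p + e0) := rfl

lemma norm_back0_le : ‖back0‖ ≤ 1 := LinearMap.mkContinuous_norm_le _ zero_le_one _

lemma summable_add_e1 (f : WSeries) : Summable fun q => |f.cf (q + e1)| * wt (q + e1) :=
  f.summable.comp_injective (i := fun q => q + e1) (add_left_injective e1)

/-- The weighted backward shift in the exponent of `t`. -/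
def back1 : WSeries →L[ℝ] WSeries :=
  LinearMap.mkContinuous
    { toFun := fun f => mk (fun p => (p 1 + 1) / (p 0 + p 1 + 1) * f.cf (p + e1))
        (f.summable_add_e1.congr fun p => by
          rw [abs_mul, abs_of_pos (by positivity : (0 : ℝ) < (p 1 + 1) / (p 0 + p 1 + 1)),
            wt_add_e1]; ring)
      map_add' := fun f g => by ext p; simp [mul_add]
      map_smul' := fun r f => by ext p; simp [mul_left_comm] } 1
    (fun f => by
      rw [one_mul, norm_def, norm_def]
      refine le_trans (le_of_eq (tsum_congr fun p => ?_)) (tsum_comp_le_tsum_of_inj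
        f.summable f.term_nonneg
        (i := fun q => q + e1) (add_left_injective e1))
      simp only [LinearMap.coe_mk, AddHom.coe_mk, cf_mk]
      rw [abs_mul, abs_of_pos (by positivity : (0 : ℝ) < (p 1 + 1) / (p 0 + p 1 + 1)),
            Function.comp_apply, wt_add_e1]; ring)

lemma cf_back1 (f : WSeries) (p) :
    (back1 f).cf p = (p 1 + 1) / (p 0 + p 1 + 1) * f.cf (p + e1) := rfl

lemma norm_back1_le : ‖back1‖ ≤ 1 := LinearMap.mkContinuous_norm_le _ zero_le_one _

/-- The constant coefficient as a continuous linear functional. -/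
def cfZero : WSeries →L[ℝ] ℝ :=
  LinearMap.mkContinuous
    { toFun := fun f => f.cf 0, map_add' := fun f g => cf_add f g 0,
      map_smul' := fun r f => cf_smul r f 0 } 1
    (fun f => by simpa [wt_zero] using f.term_le_norm 0)

lemma ev_eq_cfZero_add {s t : ℝ} (h : |s| + |t| ≤ 1) (f : WSeries) :
    ev s t f = f.cf 0 + (s * ev s t (back0 f) + t * ev s t (back1 f)) := by
  have h0 := (hasSum_ev h (back0 f)).mul_left s
  have h1 := (hasSum_ev h (back1 f)).mul_left t
  have k0 := (hasSum_of_add_e0 (g := fun p => p 0 / (p 0 + p 1 : ℝ) * f.cf p * (s ^ p 0 * t ^ p 1))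
    (fun p hp => by simp [hp])).1 (hasSum_of_eq (fun q => by
      simp only [cf_back0, Finsupp.add_apply, e0_zero, e0_one, add_zero, Nat.cast_add, Nat.cast_one,
        pow_succ]
      rw [show (q 0 + 1 + q 1 : ℝ) = q 0 + q 1 + 1 by ring]; ring) h0)
  have k1 := (hasSum_of_add_e1 (g := fun p => p 1 / (p 0 + p 1 : ℝ) * f.cf p * (s ^ p 0 * t ^ p 1))
    (fun p hp => by simp [hp])).1 (hasSum_of_eq (fun q => by
      simp only [cf_back1, Finsupp.add_apply, e1_zero, e1_one, add_zero, Nat.cast_add, Nat.cast_one,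
        pow_succ]
      rw [← add_assoc]; ring) h1)
  have k2 : HasSum (fun p : Fin 2 →₀ ℕ => if p = 0 then f.cf 0 else 0) (f.cf 0) :=
    hasSum_ite_eq 0 (f.cf 0)
  refine (hasSum_ev h f).unique (hasSum_of_eq (fun p => ?_) (k2.add (k0.add k1)))
  by_cases hp : p = 0
  · simp [hp]
  · have hp' : (p 0 + p 1 : ℝ) ≠ 0 := by
      intro h
      have h3 : p 0 + p 1 = 0 := by exact_mod_cast h
      apply hp
      ext i
      fin_cases i <;> simp <;> omega
    rw [if_neg hp]
    field_simp
    ring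

lemma analyticAt_ev (f : WSeries) {q : ℝ × ℝ} (h : |q.1| + |q.2| < 1) :
    AnalyticAt ℝ (fun x : ℝ × ℝ => ev x.1 x.2 f) q := by
  have hn : ∀ x : ℝ × ℝ, |x.1| + |x.2| < 1 → ‖x.1 • back0 + x.2 • back1‖ < 1 := fun x hx =>
    (norm_add_le _ _).trans_lt (by
      rw [norm_smul, norm_smul, Real.norm_eq_abs, Real.norm_eq_abs]
      nlinarith [abs_nonneg x.1, abs_nonneg x.2, norm_back0_le, norm_back1_le])
  have key : ∀ x : ℝ × ℝ, |x.1| + |x.2| < 1 →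
      ev x.1 x.2 f =
        cfZero ((Ring.inverse (1 - (x.1 • back0 + x.2 • back1)) : WSeries →L[ℝ] WSeries) f) := by
    intro x hx
    have hu := isUnit_one_sub_of_norm_lt_one (hn x hx)
    set g := (Ring.inverse (1 - (x.1 • back0 + x.2 • back1)) : WSeries →L[ℝ] WSeries) f with hg
    have hf : f = g - (x.1 • back0 g + x.2 • back1 g) := by
      have := congrArg (fun L : WSeries →L[ℝ] WSeries => L f) (Ring.mul_inverse_cancel _ hu)
      simpa [← hg] using this.symm
    have h2 := ev_eq_cfZero_add hx.le g
    have h3 : ev x.1 x.2 f =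
        ev x.1 x.2 g - (x.1 * ev x.1 x.2 (back0 g) + x.2 * ev x.1 x.2 (back1 g)) := by
      have e : ∀ k, ev x.1 x.2 k = evL x.1 x.2 hx.le k := fun _ => rfl
      rw [hf]
      simp only [e, map_sub, map_add, map_smul, smul_eq_mul]
    rw [h3, h2]
    show _ = g.cf 0
    ring
  have hev : ∀ᶠ x in nhds q, ev x.1 x.2 f =
      cfZero ((Ring.inverse (1 - (x.1 • back0 + x.2 • back1)) : WSeries →L[ℝ] WSeries) f) := by
    have : ∀ᶠ x : ℝ × ℝ in nhds q, |x.1| + |x.2| < 1 :=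
      (by fun_prop : Continuous fun x : ℝ × ℝ => |x.1| + |x.2|).continuousAt.eventually_lt
        continuousAt_const h
    exact this.mono key
  refine AnalyticAt.congr ?_ (hev.mono fun x hx => hx.symm)
  have hu := isUnit_one_sub_of_norm_lt_one (hn q h)
  have ha : AnalyticAt ℝ (Ring.inverse : (WSeries →L[ℝ] WSeries) → _)
      (1 - (q.1 • back0 + q.2 • back1)) :=
    analyticAt_inverse (𝕜 := ℝ) hu.unit
  have hb : AnalyticAt ℝ (fun x : ℝ × ℝ => 1 - (x.1 • back0 + x.2 • back1)) q := by
    exact analyticAt_const.sub ((analyticAt_fst.smul analyticAt_const).add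
      (analyticAt_snd.smul analyticAt_const))
  have hc := ha.comp_of_eq hb rfl
  exact (cfZero.analyticAt _).comp (((ContinuousLinearMap.apply ℝ WSeries f).analyticAt _).comp hc)

end WSeries

section Lift

variable {A : Type*} [NormedCommRing A] [NormedAlgebra ℝ A]

/-- The standard basis of `R3`. -/
def stdR3 : Fin 3 → R3 := ![(1, 0, 0), (0, 1, 0), (0, 0, 1)]

lemma sum_smul_stdR3 (c : Fin 3 → ℝ) : ∑ j, c j • stdR3 j = (c 0, c 1, c 2) := by
  simp [Fin.sum_univ_three, stdR3]

/-- The extension of a scalar power series in three variables to a commutative algebra. -/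
def liftSeries (p : FormalMultilinearSeries ℝ R3 ℝ) :
    FormalMultilinearSeries ℝ (Fin 3 → A) A := fun n =>
  ∑ w : Fin n → Fin 3, p n (fun i => stdR3 (w i)) •
    (ContinuousMultilinearMap.mkPiAlgebra ℝ (Fin n) A).compContinuousLinearMap
      fun i => ContinuousLinearMap.proj (R := ℝ) (φ := fun _ : Fin 3 => A) (w i)

lemma liftSeries_apply (p : FormalMultilinearSeries ℝ R3 ℝ) (n : ℕ) (x : Fin 3 → A) :
    liftSeries p n (fun _ => x) =
      ∑ w : Fin n → Fin 3, p n (fun i => stdR3 (w i)) • ∏ i, x (w i) := by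
  simp [liftSeries]

lemma norm_stdR3_le (j : Fin 3) : ‖stdR3 j‖ ≤ 1 := by
  fin_cases j <;> simp [stdR3, Prod.norm_def]

lemma norm_liftSeries_le [NormOneClass A] (p : FormalMultilinearSeries ℝ R3 ℝ) (n : ℕ) :
    ‖(liftSeries p n : (Fin 3 → A) [×n]→L[ℝ] A)‖ ≤ 3 ^ n * ‖p n‖ := by
  refine (norm_sum_le _ _).trans ?_
  refine (Finset.sum_le_sum (g := fun _ => ‖p n‖) fun w _ => ?_).trans (by simp)
  rw [norm_smul, ← mul_one ‖p n‖]
  refine mul_le_mul ?_ ?_ (norm_nonneg _) (norm_nonneg _)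
  · refine ((p n).le_opNorm _).trans (mul_le_of_le_one_right (norm_nonneg _) ?_)
    exact Finset.prod_le_one (fun _ _ => norm_nonneg _) fun i _ => norm_stdR3_le _
  · refine (ContinuousMultilinearMap.norm_compContinuousLinearMap_le _ _).trans ?_
    refine mul_le_one₀ ContinuousMultilinearMap.norm_mkPiAlgebra.le
      (Finset.prod_nonneg fun _ _ => norm_nonneg _) ?_
    refine Finset.prod_le_one (fun _ _ => norm_nonneg _) fun i _ => ?_
    refine ContinuousLinearMap.opNorm_le_bound _ zero_le_one fun x => ?_
    rw [one_mul]
    exact norm_le_pi_norm x (w i)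

lemma liftSeries_radius_pos [NormOneClass A] {p : FormalMultilinearSeries ℝ R3 ℝ}
    (hp : 0 < p.radius) :
    0 < (liftSeries p : FormalMultilinearSeries ℝ (Fin 3 → A) A).radius := by
  obtain ⟨C, r, hC, hr, h⟩ := p.le_mul_pow_of_radius_pos hp
  have h3 : (0 : ℝ) < (3 * r)⁻¹ := by positivity
  refine lt_of_lt_of_le ?_ (FormalMultilinearSeries.le_radius_of_bound
    (liftSeries p : FormalMultilinearSeries ℝ (Fin 3 → A) A) C
    (r := ⟨(3 * r)⁻¹, h3.le⟩) fun n => ?_)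
  · exact ENNReal.coe_pos.2 h3
  · show _ * ((3 * r)⁻¹) ^ n ≤ C
    rw [inv_pow, ← div_eq_mul_inv, div_le_iff₀ (by positivity), mul_pow]
    refine (norm_liftSeries_le p n).trans ?_
    nlinarith [h n, pow_pos (by norm_num : (0 : ℝ) < 3) n]

/-- Functional calculus of a real-analytic function of three variables in a commutative Banach
algebra, compatible with all contractive characters. -/
lemma exists_lift [NormOneClass A] [CompleteSpace A] {H : R3 → ℝ} (hH : AnalyticAt ℝ H 0) :
    ∃ K : (Fin 3 → A) → A, AnalyticAt ℝ K 0 ∧ ∃ r > 0, ∀ x, ‖x‖ < r → ∀ φ : A →L[ℝ] ℝ,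
      (∀ a, ‖φ a‖ ≤ ‖a‖) → (∀ a b, φ (a * b) = φ a * φ b) → φ 1 = 1 →
      φ (K x) = H (φ (x 0), φ (x 1), φ (x 2)) := by
  obtain ⟨p, ⟨r, hp⟩⟩ := hH
  set P : FormalMultilinearSeries ℝ (Fin 3 → A) A := liftSeries p
  have hP : 0 < P.radius := liftSeries_radius_pos (hp.r_pos.trans_le hp.r_le)
  have hPs := P.hasFPowerSeriesOnBall hP
  refine ⟨P.sum, hPs.analyticAt, ?_⟩
  obtain ⟨δ, hδ, hδ'⟩ := ENNReal.lt_iff_exists_nnreal_btwn.1 (lt_min hP hp.r_pos)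
  refine ⟨δ, by exact_mod_cast hδ, fun x hx φ hφ hm h1 => ?_⟩
  have hxe : (‖x‖₊ : ENNReal) < min P.radius r := lt_trans (by exact_mod_cast hx) hδ'
  have hx1 : x ∈ Metric.eball (0 : Fin 3 → A) P.radius := by
    simpa [enorm] using hxe.trans_le (min_le_left _ _)
  have hy : ‖((φ (x 0), φ (x 1), φ (x 2)) : R3)‖ ≤ ‖x‖ := by
    simp only [Prod.norm_def, max_le_iff]
    exact ⟨(hφ _).trans (norm_le_pi_norm x 0), (hφ _).trans (norm_le_pi_norm x 1),
      (hφ _).trans (norm_le_pi_norm x 2)⟩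
  have hy1 : ((φ (x 0), φ (x 1), φ (x 2)) : R3) ∈ Metric.eball (0 : R3) r := by
    have h2 : (‖((φ (x 0), φ (x 1), φ (x 2)) : R3)‖₊ : ENNReal) ≤ ‖x‖₊ := by exact_mod_cast hy
    simpa [enorm] using (h2.trans_lt hxe).trans_le (min_le_right _ _)
  have s1 := (hPs.hasSum hx1).mapL φ
  have s2 := hp.hasSum hy1
  simp only [zero_add] at s1 s2
  refine s1.unique ?_
  suffices e : (fun n => φ (P n fun _ => x)) =
      fun n => p n fun _ => ((φ (x 0), φ (x 1), φ (x 2)) : R3) by rw [e]; exact s2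
  funext n
  rw [show P n (fun _ => x) = _ from liftSeries_apply p n x, map_sum,
    ← sum_smul_stdR3 (fun j => φ (x j))]
  have := (p n).toMultilinearMap.map_sum (fun (_ : Fin n) (j : Fin 3) => φ (x j) • stdR3 j)
  refine Eq.trans ?_ this.symm
  refine (Finset.sum_congr rfl fun w _ => ?_)
  rw [map_smul, smul_eq_mul, mul_comm, MultilinearMap.map_smul_univ, smul_eq_mul]
  congr 1
  let φ' : A →* ℝ := { toFun := φ, map_mul' := hm, map_one' := h1 }
  exact map_prod φ' _ _

end Lift

namespace WSeries

lemma single_zero_injective : Function.Injective fun n : ℕ => (Finsupp.single 0 n : Fin 2 →₀ ℕ) :=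
  Finsupp.single_injective 0

lemma eq_single_zero {p : Fin 2 →₀ ℕ} (h : p 1 = 0) : p = Finsupp.single 0 (p 0) := by
  ext i; fin_cases i <;> simp [h]

lemma hasSum_comp_single_zero {g : (Fin 2 →₀ ℕ) → ℝ} (hg : ∀ p, p 1 ≠ 0 → g p = 0) {x : ℝ} :
    HasSum (fun n : ℕ => g (Finsupp.single 0 n)) x ↔ HasSum g x := by
  refine single_zero_injective.hasSum_iff fun p hp => hg p fun h => hp ?_
  exact ⟨p 0, (eq_single_zero h).symm⟩

/-- The power series in `s` alone with given coefficients. -/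
def ofS (b : ℕ → ℝ) (hb : Summable fun n => |b n|) : WSeries :=
  mk (fun p => if p 1 = 0 then b (p 0) else 0) (by
    obtain ⟨x, hx⟩ := hb
    have := (hasSum_comp_single_zero
      (g := fun p => |if p 1 = 0 then b (p 0) else 0| * wt p) (fun p hp => by simp [hp]) (x := x)).1
      (by simpa [wt] using hx)
    exact this.summable)

lemma ev_ofS {s t : ℝ} (h : |s| + |t| ≤ 1) (b : ℕ → ℝ) (hb : Summable fun n => |b n|) {x : ℝ}
    (hx : HasSum (fun n => b n * s ^ n) x) : ev s t (ofS b hb) = x := by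
  refine (hasSum_ev h _).unique ((hasSum_comp_single_zero fun p hp => by simp [ofS, hp]).1 ?_)
  simpa [ofS] using hx

lemma dint_ofS (b : ℕ → ℝ) (hb : Summable fun n => |b n|)
    (hb1 : Summable fun n : ℕ => |(n + 1) * b (n + 1)|) :
    dint (ofS b hb) = int (ofS (fun n => (n + 1) * b (n + 1)) hb1) := by
  ext p
  rw [cf_dint, cf_int]
  refine congrArg (fun c => shiftT c p) (funext fun q => ?_)
  simp only [ofS, cf_mk, Finsupp.add_apply, e0_zero, e0_one, add_zero]
  split_ifs with h
  · simp [h]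
  · simp

lemma exists_series {f : ℝ → ℝ} {u₀ : ℝ} (hf : AnalyticAt ℝ f u₀) :
    ∃ ρ₀ > 0, ∀ ρ, 0 < ρ → ρ ≤ ρ₀ → ∃ α α₁ : WSeries, dint α = int α₁ ∧
      ∀ s t, |s| + |t| ≤ 1 → ev s t α = f (u₀ + ρ * s) := by
  obtain ⟨p, r, hp⟩ := hf
  obtain ⟨C, a, hC, ha, hb⟩ := p.le_mul_pow_of_radius_pos (hp.r_pos.trans_le hp.r_le)
  obtain ⟨δ, hδ, hδ'⟩ := ENNReal.lt_iff_exists_nnreal_btwn.1 hp.r_pos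
  have hδ0 : (0 : ℝ) < δ := by exact_mod_cast hδ
  refine ⟨min (1 / (2 * a)) δ, by positivity, fun ρ hρ hle => ?_⟩
  have hρa : ρ * a ≤ 1 / 2 := by
    have := (hle.trans (min_le_left _ _)); rw [le_div_iff₀ (by positivity)] at this; linarith
  have hbn : ∀ n, |p.coeff n * ρ ^ n| ≤ C * (1 / 2) ^ n := fun n => by
    have h1 : |p.coeff n| ≤ C * a ^ n := by
      have := hb n; rwa [p.norm_apply_eq_norm_coef] at this
    rw [abs_mul, abs_of_pos (pow_pos hρ n)]
    calc _ ≤ C * a ^ n * ρ ^ n := mul_le_mul_of_nonneg_right h1 (by positivity)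
      _ = C * (ρ * a) ^ n := by rw [mul_pow]; ring
      _ ≤ _ := by gcongr
  have hs1 : Summable fun n => |p.coeff n * ρ ^ n| :=
    ((summable_geometric_of_lt_one (by norm_num) (by norm_num)).mul_left C).of_nonneg_of_le
      (fun _ => abs_nonneg _) hbn
  have hs2 : Summable fun n : ℕ => |((n : ℝ) + 1) * (p.coeff (n + 1) * ρ ^ (n + 1))| := by
    have h1 : Summable fun n : ℕ => (n : ℝ) ^ 1 * (1 / 2 : ℝ) ^ n :=
      summable_pow_mul_geometric_of_norm_lt_one 1 (by norm_num)
    have h2 := ((summable_nat_add_iff 1).2 h1).mul_left C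
    refine h2.of_nonneg_of_le (fun _ => abs_nonneg _) fun n => ?_
    rw [abs_mul, abs_of_pos (by positivity : (0 : ℝ) < n + 1)]
    calc _ ≤ ((n : ℝ) + 1) * (C * (1 / 2) ^ (n + 1)) :=
          mul_le_mul_of_nonneg_left (hbn _) (by positivity)
      _ = _ := by push_cast; ring
  refine ⟨ofS _ hs1, _, dint_ofS _ hs1 hs2, fun s t h => ev_ofS h _ _ ?_⟩
  have hs : |s| ≤ 1 := by linarith [abs_nonneg t]
  have hy : ρ * s ∈ Metric.eball (0 : ℝ) r := by
    have h1 : ‖ρ * s‖ ≤ δ := by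
      rw [norm_mul, Real.norm_eq_abs, Real.norm_eq_abs, abs_of_pos hρ]
      nlinarith [hle.trans (min_le_right _ _), abs_nonneg s]
    have h2 : (‖ρ * s‖₊ : ENNReal) ≤ δ := by exact_mod_cast h1
    simpa [enorm] using h2.trans_lt hδ'
  have := hp.hasSum hy
  suffices e : (fun n => p.coeff n * ρ ^ n * s ^ n) = fun n => p n fun _ => ρ * s by
    rw [e]; exact this
  funext n
  rw [p.apply_eq_pow_smul_coeff, smul_eq_mul, mul_pow]
  ring

/-- The Lorentzian cross product over a commutative ring. -/
def lcr {A : Type*} [CommRing A] (a b : Fin 3 → A) : Fin 3 → A :=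
  ![a 2 * b 1 - a 1 * b 2, a 0 * b 2 - a 2 * b 0, a 0 * b 1 - a 1 * b 0]

/-- The `t`-derivative of the unknown in terms of its second `t`-derivative. -/
def hOf (ρ : ℝ) (a : Fin 3 → WSeries) (x : ℝ × (Fin 3 → WSeries)) : Fin 3 → WSeries :=
  fun i => (ρ * x.1) • a i + int (x.2 i)

/-- The residual of the Cauchy–Kovalevskaya equation. -/
def residual (K : (Fin 3 → WSeries) → WSeries) (ρ : ℝ) (a a₁ : Fin 3 → WSeries)
    (x : ℝ × (Fin 3 → WSeries)) : Fin 3 → WSeries := fun i =>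
  x.2 i + x.1 ^ 2 • dint ((ρ * x.1) • a₁ i + dint (x.2 i)) -
    (2 * x.1) • (K (fun j => int (hOf ρ a x j)) *
      lcr (fun j => dint (hOf ρ a x j)) (hOf ρ a x) i)

lemma analyticAt_apply (i : Fin 3) (x : ℝ × (Fin 3 → WSeries)) :
    AnalyticAt ℝ (fun y : ℝ × (Fin 3 → WSeries) => y.2 i) x :=
  ((ContinuousLinearMap.proj (R := ℝ) (φ := fun _ : Fin 3 => WSeries) i).comp
    (ContinuousLinearMap.snd ℝ ℝ (Fin 3 → WSeries))).analyticAt x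

lemma analyticAt_hOf (ρ : ℝ) (a : Fin 3 → WSeries) (i : Fin 3) (x : ℝ × (Fin 3 → WSeries)) :
    AnalyticAt ℝ (fun y => hOf ρ a y i) x :=
  ((analyticAt_const.mul analyticAt_fst).smul analyticAt_const).add
    ((int.analyticAt _).comp (analyticAt_apply i x))

lemma hOf_zero (ρ : ℝ) (a : Fin 3 → WSeries) : hOf ρ a 0 = 0 := by
  ext; simp [hOf]

lemma analyticAt_residual {K : (Fin 3 → WSeries) → WSeries} (hK : AnalyticAt ℝ K 0) (ρ : ℝ)
    (a a₁ : Fin 3 → WSeries) : AnalyticAt ℝ (residual K ρ a a₁) 0 := by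
  have hh := fun i => analyticAt_hOf ρ a i 0
  have hd : ∀ i, AnalyticAt ℝ (fun y => dint (hOf ρ a y i)) 0 := fun i =>
    (dint.analyticAt _).comp (hh i)
  have hI : AnalyticAt ℝ (fun y => fun i => int (hOf ρ a y i)) 0 :=
    AnalyticAt.pi fun i => (int.analyticAt _).comp (hh i)
  have hKI : AnalyticAt ℝ (fun y => K (fun i => int (hOf ρ a y i))) 0 :=
    hK.comp_of_eq hI (by rw [hOf_zero]; ext; simp)
  refine AnalyticAt.pi fun i => ?_
  refine ((analyticAt_apply i 0).add ((analyticAt_fst.pow 2).smul ((dint.analyticAt _).comp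
    (((analyticAt_const.mul analyticAt_fst).smul analyticAt_const).add
      ((dint.analyticAt _).comp (analyticAt_apply i 0)))))).sub
    ((analyticAt_const.mul analyticAt_fst).smul (hKI.mul ?_))
  fin_cases i
  · exact ((hd 2).mul (hh 1)).sub ((hd 1).mul (hh 2))
  · exact ((hd 0).mul (hh 2)).sub ((hd 2).mul (hh 0))
  · exact ((hd 0).mul (hh 1)).sub ((hd 1).mul (hh 0))

lemma exists_residual_eq_zero {K : (Fin 3 → WSeries) → WSeries} (hK : AnalyticAt ℝ K 0) (ρ : ℝ)
    (a a₁ : Fin 3 → WSeries) {N : Set (ℝ × (Fin 3 → WSeries))} (hN : N ∈ nhds 0) :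
    ∃ ε > 0, ∃ g, (ε, g) ∈ N ∧ residual K ρ a a₁ (ε, g) = 0 := by
  have hs := (analyticAt_residual hK ρ a a₁).hasStrictFDerivAt
  set D := fderiv ℝ (residual K ρ a a₁) 0
  have hD : ∀ w, D (0, w) = w := by
    intro w
    have h1 : HasFDerivAt (fun g => residual K ρ a a₁ (0, g))
        (D.comp (ContinuousLinearMap.inr ℝ ℝ (Fin 3 → WSeries))) 0 :=
      hs.hasFDerivAt.comp (0 : Fin 3 → WSeries)
        (ContinuousLinearMap.inr ℝ ℝ (Fin 3 → WSeries)).hasFDerivAt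
    have h2 : (fun g => residual K ρ a a₁ (0, g)) = id := by
      funext g; ext1 i; simp [residual]
    rw [h2] at h1
    exact congrArg (fun L => L w) (h1.unique (hasFDerivAt_id _))
  have hΦ := (hasStrictFDerivAt_fst (𝕜 := ℝ) (p := (0 : ℝ × (Fin 3 → WSeries)))).prodMk hs
  have hm := hΦ.map_nhds_eq_of_surj (by
    rw [LinearMap.range_eq_top]
    rintro ⟨ε, w⟩
    refine ⟨(ε, w - D (ε, 0)), ?_⟩
    have : D (ε, w - D (ε, 0)) = D (ε, 0) + D (0, w - D (ε, 0)) := by rw [← map_add]; simp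
    simp [this, hD])
  have h0 : residual K ρ a a₁ 0 = 0 := by ext1 i; simp [residual]
  simp only [h0] at hm
  have h3 := hm ▸ image_mem_map hN
  have h4 : ∀ᶠ ε : ℝ in nhdsWithin 0 (Ioi 0), ((ε, 0) : ℝ × (Fin 3 → WSeries)) ∈
      (fun x : ℝ × (Fin 3 → WSeries) => (x.1, residual K ρ a a₁ x)) '' N := by
    refine (Continuous.tendsto' ?_ 0 _ rfl).mono_left nhdsWithin_le_nhds |>.eventually h3
    fun_prop
  obtain ⟨ε, ⟨⟨ε', g⟩, hx, hx2⟩, hε⟩ := (h4.and self_mem_nhdsWithin).exists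
  simp only [Prod.mk.injEq] at hx2
  obtain ⟨rfl, hx2⟩ := hx2
  exact ⟨ε', hε, g, hx, hx2⟩

end WSeries

/-- An open box centered at `(u₀, 0)`. -/
def Box (u₀ r : ℝ) : Set (ℝ × ℝ) := {q | |q.1 - u₀| < r ∧ |q.2| < r}

lemma isOpen_box (u₀ r : ℝ) : IsOpen (Box u₀ r) :=
  (isOpen_lt (by fun_prop : Continuous fun q : ℝ × ℝ => |q.1 - u₀|) continuous_const).inter
    (isOpen_lt (by fun_prop : Continuous fun q : ℝ × ℝ => |q.2|) continuous_const)

/-- A triple of reals as a point of `R3`. -/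
def toR3 (x : Fin 3 → ℝ) : R3 := (x 0, x 1, x 2)

/-- The product of the second coordinate with a function. -/
def vmul (f : ℝ × ℝ → ℝ) (q : ℝ × ℝ) : ℝ := q.2 * f q

/-- `v F` is a solution with values in `B` of the conformal prescribed mean curvature system on
`D`, with `F = a` along `v = 0`. -/
structure IsSol (H : R3 → ℝ) (B : Set R3) (a : Fin 3 → ℝ → ℝ) (F : Fin 3 → ℝ × ℝ → ℝ)
    (D : Set (ℝ × ℝ)) : Prop where
  analytic : ∀ i, AnalyticOnNhd ℝ (F i) D
  init : ∀ i u, (u, (0 : ℝ)) ∈ D → F i (u, 0) = a i u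
  mem : ∀ q ∈ D, toR3 (fun i => vmul (F i) q) ∈ B
  pde : ∀ q ∈ D, ∀ i, pd1 (pd1 (vmul (F i))) q + pd2 (pd2 (vmul (F i))) q =
    2 * H (toR3 fun j => vmul (F j) q) *
      WSeries.lcr (fun j => pd1 (vmul (F j)) q) (fun j => pd2 (vmul (F j)) q) i

lemma pd1_eq_of_hasDerivAt {f : ℝ × ℝ → ℝ} {q : ℝ × ℝ} {c : ℝ} (hf : DifferentiableAt ℝ f q)
    (h : HasDerivAt (fun x => f (x, q.2)) c q.1) : pd1 f q = c :=
  (hf.hasFDerivAt.comp_hasDerivAt (x := q.1) (f := fun x => (x, q.2))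
    ((hasDerivAt_id q.1).prodMk (hasDerivAt_const q.1 q.2))).unique h

lemma pd2_eq_of_hasDerivAt {f : ℝ × ℝ → ℝ} {q : ℝ × ℝ} {c : ℝ} (hf : DifferentiableAt ℝ f q)
    (h : HasDerivAt (fun y => f (q.1, y)) c q.2) : pd2 f q = c :=
  (hf.hasFDerivAt.comp_hasDerivAt (x := q.2) (f := fun y => (q.1, y))
    ((hasDerivAt_const q.2 q.1).prodMk (hasDerivAt_id q.2))).unique h

lemma hasDerivAt_pd1 {f : ℝ × ℝ → ℝ} {q : ℝ × ℝ} (hf : DifferentiableAt ℝ f q) :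
    HasDerivAt (fun x => f (x, q.2)) (pd1 f q) q.1 :=
  hf.hasFDerivAt.comp_hasDerivAt (x := q.1) (f := fun x => (x, q.2))
    ((hasDerivAt_id q.1).prodMk (hasDerivAt_const q.1 q.2))

lemma hasDerivAt_pd2 {f : ℝ × ℝ → ℝ} {q : ℝ × ℝ} (hf : DifferentiableAt ℝ f q) :
    HasDerivAt (fun y => f (q.1, y)) (pd2 f q) q.2 :=
  hf.hasFDerivAt.comp_hasDerivAt (x := q.2) (f := fun y => (q.1, y))
    ((hasDerivAt_const q.2 q.1).prodMk (hasDerivAt_id q.2))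

section CongrOn
variable {E : Type*} [NormedAddCommGroup E] [NormedSpace ℝ E] {f g : ℝ × ℝ → E} {D : Set (ℝ × ℝ)}

lemma pd1_congr (hD : IsOpen D) (h : ∀ q ∈ D, f q = g q) {q} (hq : q ∈ D) : pd1 f q = pd1 g q := by
  rw [pd1, pd1, (Filter.eventuallyEq_of_mem (hD.mem_nhds hq) h).fderiv_eq]

lemma pd2_congr (hD : IsOpen D) (h : ∀ q ∈ D, f q = g q) {q} (hq : q ∈ D) : pd2 f q = pd2 g q := by
  rw [pd2, pd2, (Filter.eventuallyEq_of_mem (hD.mem_nhds hq) h).fderiv_eq]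

end CongrOn

namespace WSeries

/-- Evaluation at rescaled arguments. -/
def rev (u₀ ρ δ : ℝ) (f : WSeries) (q : ℝ × ℝ) : ℝ := ev ((q.1 - u₀) / ρ) (q.2 / δ) f

variable {u₀ ρ δ : ℝ}

lemma box_lt (hρ : 0 < ρ) (hδ : 0 < δ) {q : ℝ × ℝ} (hq : q ∈ Box u₀ (min ρ δ / 2)) :
    |(q.1 - u₀) / ρ| + |q.2 / δ| < 1 := by
  have h1 : |(q.1 - u₀) / ρ| < 1 / 2 := by
    rw [abs_div, abs_of_pos hρ, div_lt_iff₀ hρ]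
    linarith [hq.1, min_le_left ρ δ]
  have h2 : |q.2 / δ| < 1 / 2 := by
    rw [abs_div, abs_of_pos hδ, div_lt_iff₀ hδ]
    linarith [hq.2, min_le_right ρ δ]
  linarith

lemma analyticAt_rev (hρ : 0 < ρ) (hδ : 0 < δ) (f : WSeries) {q : ℝ × ℝ}
    (hq : q ∈ Box u₀ (min ρ δ / 2)) : AnalyticAt ℝ (rev u₀ ρ δ f) q := by
  refine (analyticAt_ev f (q := ((q.1 - u₀) / ρ, q.2 / δ)) (box_lt hρ hδ hq)).comp_of_eq
    (f := fun q : ℝ × ℝ => ((q.1 - u₀) / ρ, q.2 / δ)) ?_ rfl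
  simp only [div_eq_mul_inv]
  exact ((analyticAt_fst.sub analyticAt_const).mul analyticAt_const).prod
    (analyticAt_snd.mul analyticAt_const)

lemma pd2_rev_int (hρ : 0 < ρ) (hδ : 0 < δ) (f : WSeries) {q : ℝ × ℝ}
    (hq : q ∈ Box u₀ (min ρ δ / 2)) : pd2 (rev u₀ ρ δ (int f)) q = δ⁻¹ * rev u₀ ρ δ f q := by
  refine pd2_eq_of_hasDerivAt (analyticAt_rev hρ hδ _ hq).differentiableAt ?_
  have h1 := hasDerivAt_ev_int (box_lt hρ hδ hq) f
  have h2 := h1.comp q.2 ((hasDerivAt_id q.2).div_const δ)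
  refine h2.congr_deriv ?_
  rw [one_div, mul_comm]; rfl

lemma pd1_rev_int (hρ : 0 < ρ) (hδ : 0 < δ) (f : WSeries) {q : ℝ × ℝ}
    (hq : q ∈ Box u₀ (min ρ δ / 2)) :
    pd1 (rev u₀ ρ δ (int f)) q = ρ⁻¹ * rev u₀ ρ δ (dint f) q := by
  refine pd1_eq_of_hasDerivAt (analyticAt_rev hρ hδ _ hq).differentiableAt ?_
  have h1 := hasDerivAt_ev_dint (box_lt hρ hδ hq) f
  have h2 := h1.comp q.1 (((hasDerivAt_id q.1).sub_const u₀).div_const ρ)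
  refine h2.congr_deriv ?_
  rw [one_div, mul_comm]; rfl

lemma rev_add (hρ : 0 < ρ) (hδ : 0 < δ) (f g : WSeries) {q : ℝ × ℝ}
    (hq : q ∈ Box u₀ (min ρ δ / 2)) :
    rev u₀ ρ δ (f + g) q = rev u₀ ρ δ f q + rev u₀ ρ δ g q := ev_add (box_lt hρ hδ hq).le f g

lemma rev_smul (c : ℝ) (f : WSeries) (q : ℝ × ℝ) :
    rev u₀ ρ δ (c • f) q = c * rev u₀ ρ δ f q := ev_smul _ _ c f

lemma ev_avg_zero (s : ℝ) (f : WSeries) : ev s 0 (avg f) = ev s 0 f := by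
  refine tsum_congr fun p => ?_
  by_cases h : p 1 = 0 <;> simp [h]

lemma rev_lcr (hρ : 0 < ρ) (hδ : 0 < δ) (f g : Fin 3 → WSeries) {q : ℝ × ℝ}
    (hq : q ∈ Box u₀ (min ρ δ / 2)) (i : Fin 3) :
    rev u₀ ρ δ (lcr f g i) q =
      lcr (fun j => rev u₀ ρ δ (f j) q) (fun j => rev u₀ ρ δ (g j) q) i := by
  have hb := (box_lt hρ hδ hq).le
  have hs : ∀ a b : WSeries, ev ((q.1 - u₀) / ρ) (q.2 / δ) (a - b) = _ := fun a b =>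
    (evL _ _ hb).map_sub a b
  fin_cases i <;> exact (hs _ _).trans (congrArg₂ (· - ·) (ev_mul hb _ _) (ev_mul hb _ _))

lemma lcr_mul {A : Type*} [CommRing A] (x y : A) (a b : Fin 3 → A) (i : Fin 3) :
    lcr (fun j => x * a j) (fun j => y * b j) i = x * y * lcr a b i := by
  fin_cases i <;> simp [lcr] <;> ring

/-- Local Cauchy–Kovalevskaya theorem for the conformal prescribed mean curvature system. -/
theorem exists_isSol {H : R3 → ℝ} (hH : AnalyticAt ℝ H 0) {B : Set R3} (hB : B ∈ nhds 0)
    {a : Fin 3 → ℝ → ℝ} {u₀ : ℝ} (ha : ∀ i, AnalyticAt ℝ (a i) u₀) :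
    ∃ r > 0, ∃ F, IsSol H B a F (Box u₀ r) := by
  choose ρ₀ hρ₀ hser using fun i => exists_series (ha i)
  obtain ⟨ρ, hρ, hρle⟩ : ∃ ρ > 0, ∀ i, ρ ≤ ρ₀ i := by
    refine ⟨min (ρ₀ 0) (min (ρ₀ 1) (ρ₀ 2)), by simp [hρ₀], fun i => ?_⟩
    fin_cases i <;> simp
  choose α α₁ hα hαev using fun i => hser i ρ hρ (hρle i)
  obtain ⟨K, hK, r₀, hr₀, hKev⟩ := exists_lift (A := WSeries) hH
  obtain ⟨r₁, hr₁, hB'⟩ := Metric.mem_nhds_iff.1 hB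
  have hcont : ContinuousAt (fun x => fun i => int (hOf ρ α x i)) 0 :=
    continuousAt_pi.2 fun i => int.continuous.continuousAt.comp
      (analyticAt_hOf ρ α i 0).continuousAt
  have hN : {x | ‖fun i => int (hOf ρ α x i)‖ < min r₀ r₁} ∈ nhds 0 := by
    refine hcont.norm.eventually_lt continuousAt_const ?_
    rw [hOf_zero]
    have : (fun i : Fin 3 => int ((0 : Fin 3 → WSeries) i)) = 0 := by ext1 i; simp
    rw [this, norm_zero]; exact lt_min hr₀ hr₁
  obtain ⟨ε, hε, g, hg, hres⟩ := exists_residual_eq_zero hK ρ α α₁ hN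
  have hg' : ‖fun i => int (hOf ρ α (ε, g) i)‖ < min r₀ r₁ := hg
  set h := hOf ρ α (ε, g) with hh
  set δ := ρ * ε with hδdef
  have hδ : 0 < δ := mul_pos hρ hε
  have hhi : ∀ i, h i = δ • α i + int (g i) := fun i => rfl
  set D := Box u₀ (min ρ δ / 2) with hD
  have hDo : IsOpen D := isOpen_box _ _
  let F : Fin 3 → ℝ × ℝ → ℝ := fun i q => δ⁻¹ * rev u₀ ρ δ (avg (h i)) q
  have hψ : ∀ i, ∀ q ∈ D, vmul (F i) q = rev u₀ ρ δ (int (h i)) q := fun i q hq => by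
    have := ev_int _ _ (box_lt hρ hδ hq).le (h i)
    rw [rev, this, vmul]
    simp only [F, rev]; field_simp
  have hψ2 : ∀ i, ∀ q ∈ D, pd2 (vmul (F i)) q = δ⁻¹ * rev u₀ ρ δ (h i) q := fun i q hq => by
    rw [pd2_congr hDo (hψ i) hq, pd2_rev_int hρ hδ _ hq]
  have hψ1 : ∀ i, ∀ q ∈ D, pd1 (vmul (F i)) q = ρ⁻¹ * rev u₀ ρ δ (dint (h i)) q := fun i q hq => by
    rw [pd1_congr hDo (hψ i) hq, pd1_rev_int hρ hδ _ hq]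
  have hα' : ∀ i, ∀ q ∈ D, rev u₀ ρ δ (α i) q = a i q.1 := fun i q hq => by
    rw [rev, hαev i _ _ (box_lt hρ hδ hq).le]
    congr 1; field_simp; ring
  have hψ22 : ∀ i, ∀ q ∈ D, pd2 (pd2 (vmul (F i))) q = δ⁻¹ * (δ⁻¹ * rev u₀ ρ δ (g i) q) := by
    intro i q hq
    have e : ∀ q ∈ D, pd2 (vmul (F i)) q = δ⁻¹ * (δ * a i q.1 + rev u₀ ρ δ (int (g i)) q) :=
      fun q hq => by rw [hψ2 i q hq, hhi, rev_add hρ hδ _ _ hq, rev_smul, hα' i q hq]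
    have hd : DifferentiableAt ℝ (pd2 (vmul (F i))) q :=
      (((analyticAt_rev hρ hδ (h i) hq).differentiableAt.const_mul δ⁻¹).congr_of_eventuallyEq
        (Filter.eventuallyEq_of_mem (hDo.mem_nhds hq) (hψ2 i)))
    refine pd2_eq_of_hasDerivAt hd ?_
    have h1 := hasDerivAt_pd2 (analyticAt_rev hρ hδ (int (g i)) hq).differentiableAt
    rw [pd2_rev_int hρ hδ _ hq] at h1
    refine ((h1.const_add (δ * a i q.1)).const_mul δ⁻¹).congr_of_eventuallyEq ?_
    have hc : ∀ᶠ y in nhds q.2, (q.1, y) ∈ D :=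
      (by fun_prop : Continuous fun y : ℝ => (q.1, y)).continuousAt.eventually_mem
        (hDo.mem_nhds hq)
    exact hc.mono fun y hy => e (q.1, y) hy
  have hψ11 : ∀ i, ∀ q ∈ D, pd1 (pd1 (vmul (F i))) q =
      ρ⁻¹ * (ρ⁻¹ * rev u₀ ρ δ (dint (δ • α₁ i + dint (g i))) q) := by
    intro i q hq
    have e1 : dint (h i) = int (δ • α₁ i + dint (g i)) := by
      rw [hhi, map_add, map_smul, hα, dint_int, map_add, map_smul]
    have e : ∀ q ∈ D, pd1 (vmul (F i)) q =
        (fun q => ρ⁻¹ * rev u₀ ρ δ (int (δ • α₁ i + dint (g i))) q) q :=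
      fun q hq => by rw [hψ1 i q hq, e1]
    rw [pd1_congr hDo e hq, ← pd1_rev_int hρ hδ _ hq]
    have h1 := hasDerivAt_pd1
      (analyticAt_rev hρ hδ (int (δ • α₁ i + dint (g i))) hq).differentiableAt
    exact pd1_eq_of_hasDerivAt
      ((analyticAt_rev hρ hδ _ hq).differentiableAt.const_mul ρ⁻¹) (h1.const_mul ρ⁻¹)
  refine ⟨min ρ δ / 2, by have := lt_min hρ hδ; positivity, F, ?_, ?_, ?_, ?_⟩
  · exact fun i q hq => analyticAt_const.mul (analyticAt_rev hρ hδ _ hq)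
  · intro i u hu
    have h1 := hα' i (u, 0) hu
    have h2 : ev ((u - u₀) / ρ) 0 (int (g i)) = 0 := by
      rw [ev_int _ _ (by simpa using (box_lt hρ hδ hu).le), zero_mul]
    simp only [F, rev, zero_div] at h1 ⊢
    rw [ev_avg_zero, hhi, ev_add (by simpa using (box_lt hρ hδ hu).le), ev_smul, h1, h2]
    field_simp; ring
  · intro q hq
    refine hB' ?_
    have hb := (box_lt hρ hδ hq).le
    have : ∀ i, |vmul (F i) q| < r₁ := fun i => by
      rw [hψ i q hq]
      exact ((abs_ev_le hb _).trans (norm_le_pi_norm (fun i => int (h i)) i)).trans_lt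
        (hg'.trans_le (min_le_right _ _))
    simp only [toR3, mem_ball_zero_iff, Prod.norm_def, max_lt_iff, Real.norm_eq_abs]
    exact ⟨this 0, this 1, this 2⟩
  · intro q hq i
    have hb := (box_lt hρ hδ hq).le
    have hKq := hKev (fun i => int (h i)) (hg'.trans_le (min_le_left _ _)) (evL _ _ hb)
      (fun f => abs_ev_le hb f) (ev_mul hb) (ev_one _ _)
    have hHq : H (toR3 fun j => vmul (F j) q) = rev u₀ ρ δ (K fun i => int (h i)) q := by
      simp only [hψ _ q hq]
      exact hKq.symm
    have hri : g i + ε ^ 2 • dint (δ • α₁ i + dint (g i)) =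
        (2 * ε) • (K (fun j => int (h j)) * lcr (fun j => dint (h j)) h i) :=
      sub_eq_zero.1 (congrFun hres i)
    have hrq := congrArg (fun f => rev u₀ ρ δ f q) hri
    have hmul : ∀ f g, rev u₀ ρ δ (f * g) q = rev u₀ ρ δ f q * rev u₀ ρ δ g q := ev_mul hb
    simp only [rev_add hρ hδ _ _ hq, rev_smul, hmul, rev_lcr hρ hδ _ _ hq] at hrq
    rw [hψ11 i q hq, hψ22 i q hq, hHq]
    simp only [hψ1 _ q hq, hψ2 _ q hq, lcr_mul]
    have hg2 : rev u₀ ρ δ (g i) q = 2 * ε * (rev u₀ ρ δ (K fun j => int (h j)) q *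
        lcr (fun j => rev u₀ ρ δ (dint (h j)) q) (fun j => rev u₀ ρ δ (h j) q) i) -
        ε ^ 2 * rev u₀ ρ δ (dint (δ • α₁ i + dint (g i))) q := by rw [← hrq]; ring
    rw [hg2]
    generalize lcr (fun j => rev u₀ ρ δ (dint (h j)) q) (fun j => rev u₀ ρ δ (h j) q) i = L
    generalize rev u₀ ρ δ (dint (δ • α₁ i + dint (g i))) q = M
    generalize rev u₀ ρ δ (K fun j => int (h j)) q = k
    rw [hδdef]
    field_simp
    ring

end WSeries

section Partial
variable {f g : ℝ × ℝ → ℝ} {q : ℝ × ℝ}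

lemma AnalyticAt.pd1 (hf : AnalyticAt ℝ f q) : AnalyticAt ℝ (pd1 f) q :=
  ((ContinuousLinearMap.apply ℝ ℝ ((1, 0) : ℝ × ℝ)).analyticAt _).comp hf.fderiv

lemma AnalyticAt.pd2 (hf : AnalyticAt ℝ f q) : AnalyticAt ℝ (pd2 f) q :=
  ((ContinuousLinearMap.apply ℝ ℝ ((0, 1) : ℝ × ℝ)).analyticAt _).comp hf.fderiv

lemma pd1_add (hf : DifferentiableAt ℝ f q) (hg : DifferentiableAt ℝ g q) :
    pd1 (fun x => f x + g x) q = pd1 f q + pd1 g q := by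
  simp [pd1, fderiv_fun_add hf hg]

lemma pd2_add (hf : DifferentiableAt ℝ f q) (hg : DifferentiableAt ℝ g q) :
    pd2 (fun x => f x + g x) q = pd2 f q + pd2 g q := by
  simp [pd2, fderiv_fun_add hf hg]

lemma pd1_sub (hf : DifferentiableAt ℝ f q) (hg : DifferentiableAt ℝ g q) :
    pd1 (fun x => f x - g x) q = pd1 f q - pd1 g q := by
  simp [pd1, fderiv_fun_sub hf hg]

lemma pd2_sub (hf : DifferentiableAt ℝ f q) (hg : DifferentiableAt ℝ g q) :
    pd2 (fun x => f x - g x) q = pd2 f q - pd2 g q := by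
  simp [pd2, fderiv_fun_sub hf hg]

lemma pd1_mul (hf : DifferentiableAt ℝ f q) (hg : DifferentiableAt ℝ g q) :
    pd1 (fun x => f x * g x) q = pd1 f q * g q + f q * pd1 g q := by
  simp [pd1, fderiv_fun_mul hf hg]; ring

lemma pd2_mul (hf : DifferentiableAt ℝ f q) (hg : DifferentiableAt ℝ g q) :
    pd2 (fun x => f x * g x) q = pd2 f q * g q + f q * pd2 g q := by
  simp [pd2, fderiv_fun_mul hf hg]; ring

lemma pd1_const (c : ℝ) (q : ℝ × ℝ) : pd1 (fun _ : ℝ × ℝ => c) q = 0 := by simp [pd1]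

lemma pd2_const (c : ℝ) (q : ℝ × ℝ) : pd2 (fun _ : ℝ × ℝ => c) q = 0 := by simp [pd2]

lemma pd1_pd2_comm (hf : AnalyticAt ℝ f q) : pd1 (pd2 f) q = pd2 (pd1 f) q := by
  have h := hf.fderiv.differentiableAt
  have hs : IsSymmSndFDerivAt ℝ f q :=
    hf.contDiffAt.isSymmSndFDerivAt (n := 2) (by simp)
  have e1 : pd1 (pd2 f) q = fderiv ℝ (fderiv ℝ f) q (1, 0) (0, 1) := by
    show fderiv ℝ (fun p => fderiv ℝ f p (0, 1)) q (1, 0) = _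
    rw [fderiv_clm_apply h (differentiableAt_const _)]; simp
  have e2 : pd2 (pd1 f) q = fderiv ℝ (fderiv ℝ f) q (0, 1) (1, 0) := by
    show fderiv ℝ (fun p => fderiv ℝ f p (1, 0)) q (0, 1) = _
    rw [fderiv_clm_apply h (differentiableAt_const _)]; simp
  rw [e1, e2, hs]

end Partial

/-- Agreement to order `k` along the axis `v = 0`. -/
def AxisEq (D : Set (ℝ × ℝ)) : ℕ → (ℝ × ℝ → ℝ) → (ℝ × ℝ → ℝ) → Prop
  | 0, _, _ => True
  | k + 1, f, g => (∀ u, (u, (0 : ℝ)) ∈ D → f (u, 0) = g (u, 0)) ∧ AxisEq D k (pd2 f) (pd2 g)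

namespace AxisEq
variable {D : Set (ℝ × ℝ)} {f g f' g' : ℝ × ℝ → ℝ} {k : ℕ}

lemma refl (D : Set (ℝ × ℝ)) (k : ℕ) (f : ℝ × ℝ → ℝ) : AxisEq D k f f := by
  induction k generalizing f with
  | zero => trivial
  | succ k ih => exact ⟨fun _ _ => rfl, ih _⟩

lemma congr (hD : IsOpen D) (hf : ∀ q ∈ D, f q = f' q) (hg : ∀ q ∈ D, g q = g' q)
    (h : AxisEq D k f g) : AxisEq D k f' g' := by
  induction k generalizing f g f' g' with
  | zero => trivial
  | succ k ih =>
    exact ⟨fun u hu => by rw [← hf _ hu, ← hg _ hu, h.1 u hu],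
      ih (fun q hq => pd2_congr hD hf hq) (fun q hq => pd2_congr hD hg hq) h.2⟩

lemma pred (h : AxisEq D (k + 1) f g) : AxisEq D k f g := by
  induction k generalizing f g with
  | zero => trivial
  | succ k ih => exact ⟨h.1, ih h.2⟩

lemma add (hD : IsOpen D) (hf : AnalyticOnNhd ℝ f D) (hg : AnalyticOnNhd ℝ g D)
    (hf' : AnalyticOnNhd ℝ f' D) (hg' : AnalyticOnNhd ℝ g' D)
    (h : AxisEq D k f g) (h' : AxisEq D k f' g') :
    AxisEq D k (fun q => f q + f' q) (fun q => g q + g' q) := by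
  induction k generalizing f g f' g' with
  | zero => trivial
  | succ k ih =>
    refine ⟨fun u hu => by simp only [h.1 u hu, h'.1 u hu], congr hD
      (fun q hq => (pd2_add (hf q hq).differentiableAt (hf' q hq).differentiableAt).symm)
      (fun q hq => (pd2_add (hg q hq).differentiableAt (hg' q hq).differentiableAt).symm) ?_⟩
    exact ih (fun q hq => (hf q hq).pd2) (fun q hq => (hg q hq).pd2)
      (fun q hq => (hf' q hq).pd2) (fun q hq => (hg' q hq).pd2) h.2 h'.2

lemma mul (hD : IsOpen D) (hf : AnalyticOnNhd ℝ f D) (hg : AnalyticOnNhd ℝ g D)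
    (hf' : AnalyticOnNhd ℝ f' D) (hg' : AnalyticOnNhd ℝ g' D)
    (h : AxisEq D k f g) (h' : AxisEq D k f' g') :
    AxisEq D k (fun q => f q * f' q) (fun q => g q * g' q) := by
  induction k generalizing f g f' g' with
  | zero => trivial
  | succ k ih =>
    refine ⟨fun u hu => by simp only [h.1 u hu, h'.1 u hu], congr hD
      (fun q hq => (pd2_mul (hf q hq).differentiableAt (hf' q hq).differentiableAt).symm)
      (fun q hq => (pd2_mul (hg q hq).differentiableAt (hg' q hq).differentiableAt).symm) ?_⟩
    have pf : AnalyticOnNhd ℝ (pd2 f) D := fun q hq => (hf q hq).pd2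
    have pg : AnalyticOnNhd ℝ (pd2 g) D := fun q hq => (hg q hq).pd2
    have pf' : AnalyticOnNhd ℝ (pd2 f') D := fun q hq => (hf' q hq).pd2
    have pg' : AnalyticOnNhd ℝ (pd2 g') D := fun q hq => (hg' q hq).pd2
    exact add hD (pf.mul hf') (pg.mul hg') (hf.mul pf') (hg.mul pg')
      (ih pf pg hf' hg' h.2 h'.pred) (ih hf hg pf' pg' h.pred h'.2)

lemma const_mul (hD : IsOpen D) (c : ℝ) (hf : AnalyticOnNhd ℝ f D) (hg : AnalyticOnNhd ℝ g D)
    (h : AxisEq D k f g) : AxisEq D k (fun q => c * f q) (fun q => c * g q) :=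
  mul hD analyticOnNhd_const analyticOnNhd_const hf hg (refl D k _) h

lemma sub (hD : IsOpen D) (hf : AnalyticOnNhd ℝ f D) (hg : AnalyticOnNhd ℝ g D)
    (hf' : AnalyticOnNhd ℝ f' D) (hg' : AnalyticOnNhd ℝ g' D)
    (h : AxisEq D k f g) (h' : AxisEq D k f' g') :
    AxisEq D k (fun q => f q - f' q) (fun q => g q - g' q) :=
  congr hD (fun q _ => by ring) (fun q _ => by ring)
    (add hD hf hg (analyticOnNhd_const.mul hf') (analyticOnNhd_const.mul hg') h
      (const_mul hD (-1) hf' hg' h'))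

lemma pd1 (hD : IsOpen D) (hf : AnalyticOnNhd ℝ f D) (hg : AnalyticOnNhd ℝ g D)
    (h : AxisEq D k f g) : AxisEq D k (pd1 f) (pd1 g) := by
  induction k generalizing f g with
  | zero => trivial
  | succ k ih =>
    refine ⟨fun u hu => ?_, congr hD (fun q hq => pd1_pd2_comm (hf q hq))
      (fun q hq => pd1_pd2_comm (hg q hq))
      (ih (fun q hq => (hf q hq).pd2) (fun q hq => (hg q hq).pd2) h.2)⟩
    have h1 := hasDerivAt_pd1 (hg _ hu).differentiableAt
    refine pd1_eq_of_hasDerivAt (hf _ hu).differentiableAt (h1.congr_of_eventuallyEq ?_)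
    have : ∀ᶠ x in nhds u, (x, (0 : ℝ)) ∈ D :=
      (by fun_prop : Continuous fun x : ℝ => (x, (0 : ℝ))).continuousAt.eventually_mem
        (hD.mem_nhds hu)
    exact this.mono fun x hx => h.1 x hx

lemma comp (hD : IsOpen D) {B : Set R3} {H : R3 → ℝ} (hH : AnalyticOnNhd ℝ H B)
    {φ ψ : Fin 3 → ℝ × ℝ → ℝ} (hφ : ∀ i, AnalyticOnNhd ℝ (φ i) D)
    (hψ : ∀ i, AnalyticOnNhd ℝ (ψ i) D) (hφB : ∀ q ∈ D, toR3 (fun j => φ j q) ∈ B)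
    (hψB : ∀ q ∈ D, toR3 (fun j => ψ j q) ∈ B) (h : ∀ i, AxisEq D k (φ i) (ψ i)) :
    AxisEq D k (fun q => H (toR3 fun j => φ j q)) (fun q => H (toR3 fun j => ψ j q)) := by
  induction k generalizing H with
  | zero => trivial
  | succ k ih =>
    refine ⟨fun u hu => by simp only [toR3, (h _).1 u hu], ?_⟩
    have hH' : ∀ j, AnalyticOnNhd ℝ (fun x => fderiv ℝ H x (stdR3 j)) B := fun j x hx =>
      ((ContinuousLinearMap.apply ℝ ℝ (stdR3 j)).analyticAt _).comp (hH x hx).fderiv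
    have hA : ∀ {χ : Fin 3 → ℝ × ℝ → ℝ}, (∀ i, AnalyticOnNhd ℝ (χ i) D) →
        (∀ q ∈ D, toR3 (fun j => χ j q) ∈ B) → ∀ {L : R3 → ℝ}, AnalyticOnNhd ℝ L B →
        AnalyticOnNhd ℝ (fun q => L (toR3 fun j => χ j q)) D := fun hχ hχB L hL q hq =>
      (hL _ (hχB q hq)).comp_of_eq ((hχ 0 q hq).prod ((hχ 1 q hq).prod (hχ 2 q hq))) rfl
    have key : ∀ {χ : Fin 3 → ℝ × ℝ → ℝ}, (∀ i, AnalyticOnNhd ℝ (χ i) D) →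
        (∀ q ∈ D, toR3 (fun j => χ j q) ∈ B) → ∀ q ∈ D,
        pd2 (χ 0) q * fderiv ℝ H (toR3 fun j => χ j q) (stdR3 0) +
          pd2 (χ 1) q * fderiv ℝ H (toR3 fun j => χ j q) (stdR3 1) +
          pd2 (χ 2) q * fderiv ℝ H (toR3 fun j => χ j q) (stdR3 2) =
        pd2 (fun q => H (toR3 fun j => χ j q)) q := by
      intro χ hχ hχB q hq
      have h1 := fun i => hasDerivAt_pd2 (hχ i q hq).differentiableAt
      have h2 : HasDerivAt (fun y => toR3 fun j => χ j (q.1, y))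
          (toR3 fun j => pd2 (χ j) q) q.2 := (h1 0).prodMk ((h1 1).prodMk (h1 2))
      have h3 := (hH _ (hχB q hq)).differentiableAt.hasFDerivAt.comp_hasDerivAt
        (x := q.2) (f := fun y => toR3 fun j => χ j (q.1, y)) h2
      rw [pd2_eq_of_hasDerivAt (hA hχ hχB hH q hq).differentiableAt h3,
        show (toR3 fun j => pd2 (χ j) q) = _ from (sum_smul_stdR3 fun j => pd2 (χ j) q).symm,
        map_sum, Fin.sum_univ_three]
      simp only [map_smul, smul_eq_mul]
    refine congr hD (key hφ hφB) (key hψ hψB) ?_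
    have hp : ∀ {χ : Fin 3 → ℝ × ℝ → ℝ}, (∀ i, AnalyticOnNhd ℝ (χ i) D) →
      ∀ i, AnalyticOnNhd ℝ (_root_.pd2 (χ i)) D := fun hχ i q hq => (hχ i q hq).pd2
    have hm := fun i => mul hD (hp hφ i) (hp hψ i) (hA hφ hφB (hH' i)) (hA hψ hψB (hH' i))
      (h i).2 (ih (hH' i) fun i => (h i).pred)
    have ha := fun i => (hp hφ i).mul (hA hφ hφB (hH' i))
    have hb := fun i => (hp hψ i).mul (hA hψ hψB (hH' i))
    exact add hD ((ha 0).add (ha 1)) ((hb 0).add (hb 1)) (ha 2) (hb 2)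
      (add hD (ha 0) (hb 0) (ha 1) (hb 1) (hm 0) (hm 1)) (hm 2)

lemma iteratedDeriv_eq (hD : IsOpen D) (hf : AnalyticOnNhd ℝ f D) (hg : AnalyticOnNhd ℝ g D)
    (h : AxisEq D (k + 1) f g) {u : ℝ} (hu : (u, (0 : ℝ)) ∈ D) :
    iteratedDeriv k (fun y => f (u, y)) 0 = iteratedDeriv k (fun y => g (u, y)) 0 := by
  induction k generalizing f g with
  | zero => simpa using h.1 u hu
  | succ k ih =>
    have hev : ∀ᶠ y in nhds (0 : ℝ), (u, y) ∈ D :=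
      (by fun_prop : Continuous fun y : ℝ => (u, y)).continuousAt.eventually_mem (hD.mem_nhds hu)
    have e : ∀ {f : ℝ × ℝ → ℝ}, AnalyticOnNhd ℝ f D →
        deriv (fun y => f (u, y)) =ᶠ[nhds 0] fun y => pd2 f (u, y) := fun hf =>
      hev.mono fun y hy => (hasDerivAt_pd2 (hf _ hy).differentiableAt).deriv
    rw [iteratedDeriv_succ', iteratedDeriv_succ', (e hf).iteratedDeriv_eq, (e hg).iteratedDeriv_eq]
    exact ih (fun q hq => (hf q hq).pd2) (fun q hq => (hg q hq).pd2) h.2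

/-- Analytic functions agreeing to infinite order along the axis agree. -/
lemma eqOn (hD : IsOpen D) (hv : ∀ q ∈ D, ∀ y, |y| ≤ |q.2| → (q.1, y) ∈ D)
    (hf : AnalyticOnNhd ℝ f D) (hg : AnalyticOnNhd ℝ g D)
    (h : ∀ k, AxisEq D k f g) : ∀ q ∈ D, f q = g q := by
  intro q hq
  have ha : ∀ {f : ℝ × ℝ → ℝ}, AnalyticOnNhd ℝ f D →
      AnalyticOnNhd ℝ (fun y => f (q.1, y)) (Icc (-|q.2|) |q.2|) := fun hf y hy =>
    (hf _ (hv q hq y (abs_le.2 hy))).comp_of_eq (analyticAt_const.prod analyticAt_id) rfl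
  have h0 : (0 : ℝ) ∈ Icc (-|q.2|) |q.2| := by simp
  have hax := hv q hq 0 (by simp)
  have p1 := (ha hf 0 h0).hasFPowerSeriesAt
  have p2 := (ha hg 0 h0).hasFPowerSeriesAt
  have hev : (fun y => f (q.1, y)) =ᶠ[nhds 0] fun y => g (q.1, y) := by
    simp only [fun k => iteratedDeriv_eq hD hf hg (h (k + 1)) hax] at p1
    have p3 := p1.sub p2
    rw [sub_self] at p3
    exact p3.eventually_eq_zero.mono fun y hy => sub_eq_zero.1 hy
  exact (ha hf).eqOn_of_preconnected_of_eventuallyEq (ha hg) isPreconnected_Icc h0 hev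
    (abs_le.1 le_rfl)

end AxisEq

lemma AnalyticOnNhd.vmul {f : ℝ × ℝ → ℝ} {D : Set (ℝ × ℝ)} (hf : AnalyticOnNhd ℝ f D) :
    AnalyticOnNhd ℝ (vmul f) D := fun q hq => analyticAt_snd.mul (hf q hq)

lemma AnalyticOnNhd.pd1 {f : ℝ × ℝ → ℝ} {D : Set (ℝ × ℝ)} (hf : AnalyticOnNhd ℝ f D) :
    AnalyticOnNhd ℝ (pd1 f) D := fun q hq => (hf q hq).pd1

lemma AnalyticOnNhd.pd2 {f : ℝ × ℝ → ℝ} {D : Set (ℝ × ℝ)} (hf : AnalyticOnNhd ℝ f D) :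
    AnalyticOnNhd ℝ (pd2 f) D := fun q hq => (hf q hq).pd2

lemma pd1_snd (q : ℝ × ℝ) : pd1 (fun q : ℝ × ℝ => q.2) q = 0 := by
  simp [pd1, fderiv_snd]

lemma pd2_snd (q : ℝ × ℝ) : pd2 (fun q : ℝ × ℝ => q.2) q = 1 := by
  simp [pd2, fderiv_snd]

lemma pd1_vmul {f : ℝ × ℝ → ℝ} {q : ℝ × ℝ} (hf : DifferentiableAt ℝ f q) :
    pd1 (vmul f) q = q.2 * pd1 f q := by
  refine (pd1_mul differentiableAt_snd hf).trans ?_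
  rw [pd1_snd]; ring

lemma pd2_vmul {f : ℝ × ℝ → ℝ} {q : ℝ × ℝ} (hf : DifferentiableAt ℝ f q) :
    pd2 (vmul f) q = f q + q.2 * pd2 f q := by
  refine (pd2_mul differentiableAt_snd hf).trans ?_
  rw [pd2_snd]; ring

namespace IsSol
variable {H : R3 → ℝ} {B : Set R3} {a : Fin 3 → ℝ → ℝ} {F G : Fin 3 → ℝ × ℝ → ℝ}
  {D D' : Set (ℝ × ℝ)}

lemma mono (h : IsSol H B a F D) (hD : D' ⊆ D) : IsSol H B a F D' :=
  ⟨fun i q hq => h.analytic i q (hD hq), fun i u hu => h.init i u (hD hu),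
    fun q hq => h.mem q (hD hq), fun q hq => h.pde q (hD hq)⟩

lemma of_eqOn (hD : IsOpen D) (h : IsSol H B a F D) (e : ∀ q ∈ D, ∀ i, F i q = G i q) :
    IsSol H B a G D := by
  have ev : ∀ i, ∀ q ∈ D, vmul (F i) q = vmul (G i) q := fun i q hq => by
    simp only [vmul, e q hq i]
  have e1 := fun i q hq => pd1_congr hD (ev i) (q := q) hq
  have e2 := fun i q hq => pd2_congr hD (ev i) (q := q) hq
  refine ⟨fun i q hq => (h.analytic i q hq).congr
    (Filter.eventuallyEq_of_mem (hD.mem_nhds hq) fun q hq => e q hq i),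
    fun i u hu => (e _ hu i).symm.trans (h.init i u hu), fun q hq => ?_, fun q hq i => ?_⟩
  · have := h.mem q hq
    simpa only [ev _ q hq] using this
  · have := h.pde q hq i
    rw [pd1_congr hD (e1 i) hq, pd2_congr hD (e2 i) hq] at this
    simpa only [ev _ q hq, e1 _ q hq, e2 _ q hq] using this

lemma of_local (h : ∀ q ∈ D, ∃ D', q ∈ D' ∧ IsSol H B a F D') : IsSol H B a F D := by
  refine ⟨fun i q hq => ?_, fun i u hu => ?_, fun q hq => ?_, fun q hq => ?_⟩
  · obtain ⟨D', hq', h'⟩ := h q hq; exact h'.analytic i q hq'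
  · obtain ⟨D', hq', h'⟩ := h _ hu; exact h'.init i u hq'
  · obtain ⟨D', hq', h'⟩ := h q hq; exact h'.mem q hq'
  · obtain ⟨D', hq', h'⟩ := h q hq; exact h'.pde q hq'

lemma translate (h : IsSol H B a F D) (c : ℝ) (ha : ∀ i u, a i (u - c) = a i u)
    (hD : ∀ q ∈ D', (q.1 - c, q.2) ∈ D) :
    IsSol H B a (fun i q => F i (q - (c, 0))) D' := by
  have hs : ∀ q : ℝ × ℝ, q - (c, 0) = (q.1 - c, q.2) := fun q => by ext <;> simp
  have t1 : ∀ f : ℝ × ℝ → ℝ, pd1 (fun q => f (q - (c, 0))) = fun q => pd1 f (q - (c, 0)) :=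
    fun f => funext fun q => by simp only [pd1, fderiv_comp_sub]
  have t2 : ∀ f : ℝ × ℝ → ℝ, pd2 (fun q => f (q - (c, 0))) = fun q => pd2 f (q - (c, 0)) :=
    fun f => funext fun q => by simp only [pd2, fderiv_comp_sub]
  have tv : ∀ i, vmul (fun q => F i (q - (c, 0))) = fun q => vmul (F i) (q - (c, 0)) :=
    fun i => funext fun q => by simp [vmul]
  refine ⟨fun i q hq => ?_, fun i u hu => ?_, fun q hq => ?_, fun q hq i => ?_⟩
  · exact (h.analytic i _ (hD q hq)).comp_of_eq (f := fun q : ℝ × ℝ => q - (c, 0))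
      (analyticAt_id.sub analyticAt_const) (hs q)
  · show F i ((u, 0) - (c, 0)) = _
    rw [hs, h.init i _ (hD _ hu), ha]
  · have := h.mem _ (hD q hq)
    simp only [tv]; simpa only [← hs] using this
  · have := h.pde _ (hD q hq) i
    simp only [tv, t1, t2]; simpa only [← hs] using this

lemma pd2_vmul_axis (h : IsSol H B a F D) (i : Fin 3) {u : ℝ} (hu : (u, (0 : ℝ)) ∈ D) :
    _root_.pd2 (vmul (F i)) (u, 0) = a i u := by
  rw [pd2_vmul (h.analytic i _ hu).differentiableAt, h.init i u hu]; simp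

lemma pd1_vmul_axis (h : IsSol H B a F D) (i : Fin 3) {u : ℝ} (hu : (u, (0 : ℝ)) ∈ D) :
    _root_.pd1 (vmul (F i)) (u, 0) = 0 := by
  rw [pd1_vmul (h.analytic i _ hu).differentiableAt]; simp

/-- Uniqueness in the Cauchy problem for the conformal prescribed mean curvature system. -/
lemma unique (hH : AnalyticOnNhd ℝ H B) (hD : IsOpen D)
    (hv : ∀ q ∈ D, ∀ y, |y| ≤ |q.2| → (q.1, y) ∈ D)
    (hF : IsSol H B a F D) (hG : IsSol H B a G D) : ∀ q ∈ D, ∀ i, F i q = G i q := by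
  have fa := fun i => (hF.analytic i).vmul
  have ga := fun i => (hG.analytic i).vmul
  have hLF := fun i q hq => eq_sub_of_add_eq' (hF.pde q hq i)
  have hLG := fun i q hq => eq_sub_of_add_eq' (hG.pde q hq i)
  have key : ∀ k, ∀ i, AxisEq D k (vmul (F i)) (vmul (G i)) ∧
      AxisEq D k (_root_.pd2 (vmul (F i))) (_root_.pd2 (vmul (G i))) := by
    intro k
    induction k with
    | zero => exact fun i => ⟨trivial, trivial⟩
    | succ k ih =>
      refine fun i => ⟨⟨fun u hu => by simp [vmul], (ih i).2⟩, fun u hu => ?_, ?_⟩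
      · rw [hF.pd2_vmul_axis i hu, hG.pd2_vmul_axis i hu]
      · refine AxisEq.congr hD (fun q hq => (hLF i q hq).symm) (fun q hq => (hLG i q hq).symm) ?_
        have hAn : ∀ {F : Fin 3 → ℝ × ℝ → ℝ}, IsSol H B a F D →
            AnalyticOnNhd ℝ (fun q => 2 * H (toR3 fun j => vmul (F j) q)) D := by
          intro F hF q hq
          have f := fun i => (hF.analytic i).vmul
          exact analyticAt_const.mul ((hH _ (hF.mem q hq)).comp_of_eq
            ((f 0 q hq).prod ((f 1 q hq).prod (f 2 q hq))) rfl)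
        have hHe : AxisEq D k (fun q => 2 * H (toR3 fun j => vmul (F j) q))
            (fun q => 2 * H (toR3 fun j => vmul (G j) q)) :=
          AxisEq.comp hD (H := fun x => 2 * H x) (fun x hx => analyticAt_const.mul (hH x hx))
            fa ga hF.mem hG.mem
            fun i => (ih i).1
        have d1 : ∀ i, AxisEq D k (_root_.pd1 (vmul (F i))) (_root_.pd1 (vmul (G i))) := fun i =>
          AxisEq.pd1 hD (fa i) (ga i) (ih i).1
        have m : ∀ i j, AxisEq D k
            (fun q => _root_.pd1 (vmul (F i)) q * _root_.pd2 (vmul (F j)) q)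
            (fun q => _root_.pd1 (vmul (G i)) q * _root_.pd2 (vmul (G j)) q) := fun i j =>
          AxisEq.mul hD (fa i).pd1 (ga i).pd1 (fa j).pd2 (ga j).pd2 (d1 i) (ih j).2
        have ma : ∀ {F : Fin 3 → ℝ × ℝ → ℝ}, IsSol H B a F D → ∀ i j, AnalyticOnNhd ℝ
            (fun q => _root_.pd1 (vmul (F i)) q * _root_.pd2 (vmul (F j)) q) D := fun hF i j =>
          (hF.analytic i).vmul.pd1.mul (hF.analytic j).vmul.pd2
        have sa := fun {F : Fin 3 → ℝ × ℝ → ℝ} (hF : IsSol H B a F D) i j k l =>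
          (ma hF i j).sub (ma hF k l)
        have s : ∀ i j k' l, _ := fun i j k' l => AxisEq.sub hD (ma hF i j) (ma hG i j)
          (ma hF k' l) (ma hG k' l) (m i j) (m k' l)
        have L : ∀ n i j k' l, _ := fun n i j k' l =>
          AxisEq.sub hD ((hAn hF).mul (sa hF i j k' l)) ((hAn hG).mul (sa hG i j k' l))
          (fa n).pd1.pd1 (ga n).pd1.pd1 (AxisEq.mul hD (hAn hF) (hAn hG) (sa hF i j k' l)
            (sa hG i j k' l) hHe (s i j k' l)) (AxisEq.pd1 hD (fa n).pd1 (ga n).pd1 (d1 n))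
        fin_cases i
        · exact L 0 2 1 1 2
        · exact L 1 0 2 2 0
        · exact L 2 0 1 1 0
  intro q hq i
  by_cases h0 : q.2 = 0
  · have hq0 : (q.1, (0 : ℝ)) ∈ D := h0 ▸ hq
    have : q = (q.1, 0) := Prod.ext rfl h0
    rw [this, hF.init i _ hq0, hG.init i _ hq0]
  · exact mul_left_cancel₀ h0 (AxisEq.eqOn hD hv (fa i) (ga i) (fun k => (key k i).1) q hq)

end IsSol

lemma isOpen_strip2 (δ : ℝ) : IsOpen (Strip2 δ) :=
  (isOpen_lt continuous_const continuous_snd).inter (isOpen_lt continuous_snd continuous_const)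

lemma mem_strip2 {δ : ℝ} {q : ℝ × ℝ} : q ∈ Strip2 δ ↔ |q.2| < δ := abs_lt.symm

/-- Global existence along the axis for periodic data. -/
theorem exists_isSol_strip {H : R3 → ℝ} {B : Set R3} (hB : B ∈ nhds 0) (hH : AnalyticOnNhd ℝ H B)
    {a : Fin 3 → ℝ → ℝ} (ha : ∀ i u, AnalyticAt ℝ (a i) u)
    (hper : ∀ i u, a i (u + 2 * π) = a i u) :
    ∃ δ > 0, ∃ F, IsSol H B a F (Strip2 δ) ∧ ∀ i u v, F i (u + 2 * π, v) = F i (u, v) := by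
  have h1 : ∃ δ > 0, ∀ u ∈ Icc 0 (2 * π), ∃ F, IsSol H B a F (Box u δ) := by
    refine isCompact_Icc.induction_on (p := fun s : Set ℝ => ∃ δ > 0, ∀ u ∈ s,
      ∃ F, IsSol H B a F (Box u δ)) ⟨1, one_pos, by simp⟩ ?_ ?_ ?_
    · rintro s t hst ⟨δ, hδ, h⟩
      exact ⟨δ, hδ, fun u hu => h u (hst hu)⟩
    · rintro s t ⟨δ, hδ, h⟩ ⟨δ', hδ', h'⟩
      refine ⟨min δ δ', lt_min hδ hδ', ?_⟩
      rintro u (hu | hu)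
      · obtain ⟨F, hF⟩ := h u hu
        exact ⟨F, hF.mono fun q hq =>
          ⟨hq.1.trans_le (min_le_left _ _), hq.2.trans_le (min_le_left _ _)⟩⟩
      · obtain ⟨F, hF⟩ := h' u hu
        exact ⟨F, hF.mono fun q hq =>
          ⟨hq.1.trans_le (min_le_right _ _), hq.2.trans_le (min_le_right _ _)⟩⟩
    · intro u _
      obtain ⟨r, hr, F, hF⟩ := WSeries.exists_isSol (hH 0 (mem_of_mem_nhds hB)) hB
        (fun i => ha i u)
      refine ⟨ball u (r / 2), mem_nhdsWithin_of_mem_nhds (ball_mem_nhds _ (by positivity)), r / 2,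
        by positivity, fun u' hu' => ⟨F, hF.mono fun q hq => ?_⟩⟩
      rw [mem_ball, Real.dist_eq] at hu'
      exact ⟨by linarith [hq.1, abs_sub_le q.1 u' u], by linarith [hq.2]⟩
  obtain ⟨δ, hδ, h1⟩ := h1
  have h2 : ∀ u, ∃ F, IsSol H B a F (Box u δ) := by
    intro u
    obtain ⟨F, hF⟩ := h1 (toIcoMod two_pi_pos 0 u)
      (Ico_subset_Icc_self (by simpa using toIcoMod_mem_Ico two_pi_pos 0 u))
    have hu := self_sub_toIcoMod two_pi_pos 0 u
    refine ⟨_, hF.translate (u - toIcoMod two_pi_pos 0 u) ?_ ?_⟩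
    · intro i x
      rw [hu]
      exact (show Function.Periodic (a i) (2 * π) from hper i).sub_zsmul_eq _
    · intro q hq
      exact ⟨by convert hq.1 using 2; ring, hq.2⟩
  choose S hS using h2
  have hbox : ∀ u u', ∀ q ∈ Box u δ ∩ Box u' δ, ∀ y, |y| ≤ |q.2| →
      (q.1, y) ∈ Box u δ ∩ Box u' δ := fun u u' q hq y hy =>
    ⟨⟨hq.1.1, hy.trans_lt hq.1.2⟩, ⟨hq.2.1, hy.trans_lt hq.2.2⟩⟩
  have hF : IsSol H B a (fun i q => S q.1 i q) (Strip2 δ) := by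
    refine IsSol.of_local fun q hq => ⟨Box q.1 δ, ⟨by simpa using hδ, mem_strip2.1 hq⟩, ?_⟩
    refine (hS q.1).of_eqOn (isOpen_box _ _) fun x hx i => ?_
    exact IsSol.unique hH ((isOpen_box _ _).inter (isOpen_box _ _)) (hbox _ _)
      ((hS q.1).mono inter_subset_left) ((hS x.1).mono inter_subset_right) x
      ⟨hx, by simpa using hδ, hx.2⟩ i
  refine ⟨δ, hδ, fun i q => if |q.2| < δ then S q.1 i q else 0, hF.of_eqOn (isOpen_strip2 δ)
    fun q hq i => (if_pos (mem_strip2.1 hq)).symm, fun i u v => ?_⟩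
  by_cases hv : |v| < δ
  · have ht := hF.translate (D' := Strip2 δ) (-(2 * π)) (fun i u => by rw [sub_neg_eq_add, hper])
      (fun q hq => hq)
    have := IsSol.unique hH (isOpen_strip2 δ) (fun q hq y hy =>
      mem_strip2.2 (hy.trans_lt (mem_strip2.1 hq))) ht hF (u, v) (mem_strip2.2 hv) i
    simpa [hv] using this
  · simp [hv]

/-- The pointwise Lorentzian product of two triples of functions. -/
def lf (f g : Fin 3 → ℝ × ℝ → ℝ) (q : ℝ × ℝ) : ℝ := f 0 q * g 0 q + f 1 q * g 1 q - f 2 q * g 2 q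

section LorentzField
variable {f g : Fin 3 → ℝ × ℝ → ℝ} {q : ℝ × ℝ}

lemma pd1_lf (hf : ∀ i, DifferentiableAt ℝ (f i) q) (hg : ∀ i, DifferentiableAt ℝ (g i) q) :
    pd1 (lf f g) q = lf (fun i => pd1 (f i)) g q + lf f (fun i => pd1 (g i)) q := by
  have h := fun i => (hf i).fun_mul (hg i)
  refine (pd1_sub ((h 0).fun_add (h 1)) (h 2)).trans ?_
  rw [pd1_add (h 0) (h 1), pd1_mul (hf 0) (hg 0), pd1_mul (hf 1) (hg 1), pd1_mul (hf 2) (hg 2)]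
  simp only [lf]; ring

lemma pd2_lf (hf : ∀ i, DifferentiableAt ℝ (f i) q) (hg : ∀ i, DifferentiableAt ℝ (g i) q) :
    pd2 (lf f g) q = lf (fun i => pd2 (f i)) g q + lf f (fun i => pd2 (g i)) q := by
  have h := fun i => (hf i).fun_mul (hg i)
  refine (pd2_sub ((h 0).fun_add (h 1)) (h 2)).trans ?_
  rw [pd2_add (h 0) (h 1), pd2_mul (hf 0) (hg 0), pd2_mul (hf 1) (hg 1), pd2_mul (hf 2) (hg 2)]
  simp only [lf]; ring

lemma AnalyticOnNhd.lf {D : Set (ℝ × ℝ)} (hf : ∀ i, AnalyticOnNhd ℝ (f i) D)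
    (hg : ∀ i, AnalyticOnNhd ℝ (g i) D) : AnalyticOnNhd ℝ (lf f g) D :=
  (((hf 0).mul (hg 0)).add ((hf 1).mul (hg 1))).sub ((hf 2).mul (hg 2))

end LorentzField

/-- A solution of the Cauchy–Riemann equations vanishing on the axis vanishes. -/
lemma eq_zero_of_cauchyRiemann {D : Set (ℝ × ℝ)} (hD : IsOpen D)
    (hv : ∀ q ∈ D, ∀ y, |y| ≤ |q.2| → (q.1, y) ∈ D) {P Q : ℝ × ℝ → ℝ}
    (hP : AnalyticOnNhd ℝ P D) (hQ : AnalyticOnNhd ℝ Q D)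
    (h1 : ∀ q ∈ D, pd2 P q = pd1 Q q) (h2 : ∀ q ∈ D, pd2 Q q = -1 * pd1 P q)
    (hP0 : ∀ u, (u, (0 : ℝ)) ∈ D → P (u, 0) = 0) (hQ0 : ∀ u, (u, (0 : ℝ)) ∈ D → Q (u, 0) = 0) :
    ∀ q ∈ D, P q = 0 ∧ Q q = 0 := by
  have hz : AnalyticOnNhd ℝ (fun _ : ℝ × ℝ => (0 : ℝ)) D := analyticOnNhd_const
  have key : ∀ k, AxisEq D k P (fun _ => 0) ∧ AxisEq D k Q (fun _ => 0) := by
    intro k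
    induction k with
    | zero => exact ⟨trivial, trivial⟩
    | succ k ih =>
      refine ⟨⟨hP0, ?_⟩, hQ0, ?_⟩
      · exact AxisEq.congr hD (fun q hq => (h1 q hq).symm) (fun q _ => by rw [pd1_const, pd2_const])
          (AxisEq.pd1 hD hQ hz ih.2)
      · exact AxisEq.congr hD (fun q hq => (h2 q hq).symm)
          (fun q _ => by rw [pd1_const, pd2_const, mul_zero])
          (AxisEq.const_mul hD (-1) hP.pd1 hz.pd1 (AxisEq.pd1 hD hP hz ih.1))
  exact fun q hq => ⟨AxisEq.eqOn hD hv hP hz (fun k => (key k).1) q hq,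
    AxisEq.eqOn hD hv hQ hz (fun k => (key k).2) q hq⟩

lemma IsSol.conformal {H : R3 → ℝ} {B : Set R3} {a : Fin 3 → ℝ → ℝ} {F : Fin 3 → ℝ × ℝ → ℝ}
    {D : Set (ℝ × ℝ)} (hD : IsOpen D) (hv : ∀ q ∈ D, ∀ y, |y| ≤ |q.2| → (q.1, y) ∈ D)
    (hF : IsSol H B a F D) (ha : ∀ u, a 0 u * a 0 u + a 1 u * a 1 u - a 2 u * a 2 u = 0) :
    ∀ q ∈ D, lf (fun i => pd1 (vmul (F i))) (fun i => pd1 (vmul (F i))) q =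
        lf (fun i => pd2 (vmul (F i))) (fun i => pd2 (vmul (F i))) q ∧
      lf (fun i => pd1 (vmul (F i))) (fun i => pd2 (vmul (F i))) q = 0 := by
  set X : Fin 3 → ℝ × ℝ → ℝ := fun i => pd1 (vmul (F i)) with hX
  set Y : Fin 3 → ℝ × ℝ → ℝ := fun i => pd2 (vmul (F i)) with hY
  have xa : ∀ i, AnalyticOnNhd ℝ (X i) D := fun i => (hF.analytic i).vmul.pd1
  have ya : ∀ i, AnalyticOnNhd ℝ (Y i) D := fun i => (hF.analytic i).vmul.pd2
  have xd := fun q hq i => (xa i q hq).differentiableAt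
  have yd := fun q hq i => (ya i q hq).differentiableAt
  have comm : ∀ q ∈ D, ∀ i, pd1 (Y i) q = pd2 (X i) q := fun q hq i =>
    pd1_pd2_comm ((hF.analytic i).vmul q hq)
  have pde : ∀ q ∈ D, ∀ i, pd1 (X i) q + pd2 (Y i) q = 2 * H (toR3 fun j => vmul (F j) q) *
      WSeries.lcr (fun j => X j q) (fun j => Y j q) i := hF.pde
  have hxx := AnalyticOnNhd.lf xa xa
  have hyy := AnalyticOnNhd.lf ya ya
  have hxy := AnalyticOnNhd.lf xa ya
  have h0 := eq_zero_of_cauchyRiemann hD hv (P := fun q => lf X X q - lf Y Y q)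
    (Q := fun q => 2 * lf X Y q) (hxx.sub hyy) (analyticOnNhd_const.mul hxy) ?_ ?_ ?_ ?_
  · exact fun q hq => ⟨sub_eq_zero.1 (h0 q hq).1, by simpa using (h0 q hq).2⟩
  · intro q hq
    rw [pd2_sub (hxx q hq).differentiableAt (hyy q hq).differentiableAt,
      pd1_mul (differentiableAt_const _) (hxy q hq).differentiableAt, pd1_const,
      pd2_lf (xd q hq) (xd q hq), pd2_lf (yd q hq) (yd q hq), pd1_lf (xd q hq) (yd q hq)]
    have p0 := pde q hq 0
    have p1 := pde q hq 1
    have p2 := pde q hq 2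
    simp only [WSeries.lcr, Matrix.cons_val] at p0 p1 p2
    simp only [lf, comm q hq]
    linear_combination (-2) * Y 0 q * p0 - 2 * Y 1 q * p1 + 2 * Y 2 q * p2
  · intro q hq
    rw [pd1_sub (hxx q hq).differentiableAt (hyy q hq).differentiableAt,
      pd2_mul (differentiableAt_const _) (hxy q hq).differentiableAt, pd2_const,
      pd1_lf (xd q hq) (xd q hq), pd1_lf (yd q hq) (yd q hq), pd2_lf (xd q hq) (yd q hq)]
    have p0 := pde q hq 0
    have p1 := pde q hq 1
    have p2 := pde q hq 2
    simp only [WSeries.lcr, Matrix.cons_val] at p0 p1 p2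
    simp only [lf, comm q hq]
    linear_combination 2 * X 0 q * p0 + 2 * X 1 q * p1 - 2 * X 2 q * p2
  · intro u hu
    have hx := fun i => hF.pd1_vmul_axis i hu
    have hy := fun i => hF.pd2_vmul_axis i hu
    simp only [lf, hX, hY, hx, hy]
    linear_combination -(ha u)
  · intro u hu
    have hx := fun i => hF.pd1_vmul_axis i hu
    simp only [lf, hX, hx]; ring

/-- A locally valid periodic property along the axis holds on a uniform strip. -/
lemma exists_strip_of_eventually {P : ℝ × ℝ → Prop} (hper : ∀ u v, P (u + 2 * π, v) ↔ P (u, v))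
    (h : ∀ u, ∀ᶠ q in nhds (u, (0 : ℝ)), P q) : ∃ R > 0, ∀ q : ℝ × ℝ, |q.2| < R → P q := by
  have h1 := isCompact_Icc.eventually_forall_of_forall_eventually (x₀ := (0 : ℝ))
    (K := Icc 0 (2 * π)) (P := fun v u => P (u, v)) fun u _ =>
      (continuous_swap.tendsto ((0 : ℝ), u)).eventually (h u)
  obtain ⟨R, hR, h2⟩ := Metric.eventually_nhds_iff.1 h1
  refine ⟨R, hR, fun q hq => ?_⟩
  have h3 := h2 (y := q.2) (by simpa using hq) (toIcoMod two_pi_pos 0 q.1)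
    (Ico_subset_Icc_self (by simpa using toIcoMod_mem_Ico two_pi_pos 0 q.1))
  have hp : Function.Periodic (fun u => P (u, q.2)) (2 * π) := fun u => propext (hper u q.2)
  rw [toIcoMod] at h3
  exact (hp.sub_zsmul_eq (toIcoDiv two_pi_pos 0 q.1)).mp h3

lemma exists_strip_pos {f : ℝ × ℝ → ℝ} (hper : ∀ u v, f (u + 2 * π, v) = f (u, v))
    (hf : ∀ u, ContinuousAt f (u, 0)) (h : ∀ u, 0 < f (u, 0)) :
    ∃ R > 0, ∀ q : ℝ × ℝ, |q.2| < R → 0 < f q :=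
  exists_strip_of_eventually (fun u v => by rw [hper]) fun u => (hf u).eventually_const_lt (h u)

/-- The inverse function theorem for analytic maps of the plane. -/
lemma exists_local_inverse {f g : ℝ × ℝ → ℝ} {q : ℝ × ℝ} (hf : AnalyticAt ℝ f q)
    (hg : AnalyticAt ℝ g q) (hdet : pd1 f q * pd2 g q - pd2 f q * pd1 g q ≠ 0) :
    ∃ e : OpenPartialHomeomorph (ℝ × ℝ) (ℝ × ℝ), q ∈ e.source ∧ (∀ x, e x = (f x, g x)) ∧
      AnalyticAt ℝ e.symm (f q, g q) := by
  have hG : AnalyticAt ℝ (fun x => (f x, g x)) q := hf.prod hg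
  set d := pd1 f q * pd2 g q - pd2 f q * pd1 g q with hd
  have hlin : ∀ (φ : ℝ × ℝ → ℝ) (x : ℝ × ℝ), fderiv ℝ φ q x = x.1 * pd1 φ q + x.2 * pd2 φ q := by
    intro φ x
    have : x = x.1 • ((1 : ℝ), (0 : ℝ)) + x.2 • ((0 : ℝ), (1 : ℝ)) := by ext <;> simp
    conv_lhs => rw [this]
    rw [map_add, map_smul, map_smul]; rfl
  set L : ℝ × ℝ →L[ℝ] ℝ × ℝ := (fderiv ℝ f q).prod (fderiv ℝ g q) with hL
  set M : ℝ × ℝ →L[ℝ] ℝ × ℝ :=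
    ((d⁻¹ * pd2 g q) • ContinuousLinearMap.fst ℝ ℝ ℝ -
      (d⁻¹ * pd2 f q) • ContinuousLinearMap.snd ℝ ℝ ℝ).prod
    ((d⁻¹ * pd1 f q) • ContinuousLinearMap.snd ℝ ℝ ℝ -
      (d⁻¹ * pd1 g q) • ContinuousLinearMap.fst ℝ ℝ ℝ) with hM
  have h1 : Function.LeftInverse M L := by
    intro x
    ext
    · simp [hL, hM, hlin]; field_simp; rw [hd]; ring
    · simp [hL, hM, hlin]; field_simp; rw [hd]; ring
  have h2 : Function.RightInverse M L := by
    intro x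
    ext
    · simp [hL, hM, hlin]; field_simp; rw [hd]; ring
    · simp [hL, hM, hlin]; field_simp; rw [hd]; ring
  set E := ContinuousLinearEquiv.equivOfInverse L M h1 h2 with hE
  have hs : HasStrictFDerivAt (fun x => (f x, g x)) (E : ℝ × ℝ →L[ℝ] ℝ × ℝ) q := by
    have : (E : ℝ × ℝ →L[ℝ] ℝ × ℝ) = L := by ext <;> rfl
    rw [this]
    exact hf.hasStrictFDerivAt.prodMk hg.hasStrictFDerivAt
  set e := hs.toOpenPartialHomeomorph with he
  have hq : q ∈ e.source := hs.mem_toOpenPartialHomeomorph_source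
  refine ⟨e, hq, fun x => rfl, ?_⟩
  exact e.analyticAt_symm' hq hG hs.hasFDerivAt.fderiv

lemma mem_pdisk {ρ : ℝ} {p : ℝ × ℝ} :
    p ∈ PDisk 0 0 ρ ↔ 0 < p.1 ^ 2 + p.2 ^ 2 ∧ p.1 ^ 2 + p.2 ^ 2 < ρ ^ 2 := by simp [PDisk]

lemma isPreconnected_pdisk {ρ : ℝ} (hρ : 0 < ρ) : IsPreconnected (PDisk 0 0 ρ) := by
  have h : PDisk 0 0 ρ = (fun x : ℝ × ℝ => (x.1 * cos x.2, x.1 * sin x.2)) ''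
      (Ioo 0 ρ ×ˢ univ) := by
    ext p
    rw [mem_pdisk]
    constructor
    · rintro ⟨h1, h2⟩
      set w : ℂ := ⟨p.1, p.2⟩ with hw
      have hn : ‖w‖ ^ 2 = p.1 ^ 2 + p.2 ^ 2 := by
        rw [Complex.sq_norm, Complex.normSq_apply, hw]; ring
      have hpos : 0 < ‖w‖ := by
        refine (norm_nonneg w).lt_of_ne fun h => ?_
        rw [← hn, ← h] at h1; norm_num at h1
      refine ⟨(‖w‖, Complex.arg w), ⟨⟨hpos, ?_⟩, mem_univ _⟩, ?_⟩
      · exact lt_of_pow_lt_pow_left₀ 2 hρ.le (hn ▸ h2)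
      · ext
        · exact Complex.norm_mul_cos_arg w
        · exact Complex.norm_mul_sin_arg w
    · rintro ⟨⟨r, t⟩, ⟨⟨hr0, hr⟩, -⟩, rfl⟩
      have : (r * cos t) ^ 2 + (r * sin t) ^ 2 = r ^ 2 := by
        linear_combination r ^ 2 * sin_sq_add_cos_sq t
      simp only at hr0 hr ⊢
      rw [this]
      exact ⟨by positivity, by gcongr⟩
  rw [h]
  exact (isPreconnected_Ioo.prod isPreconnected_univ).image _ (by fun_prop)

lemma pd1_periodic {f : ℝ × ℝ → ℝ} {c : ℝ} (hf : ∀ u v, f (u + c, v) = f (u, v)) (u v : ℝ) :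
    pd1 f (u + c, v) = pd1 f (u, v) := by
  have h : (fun q : ℝ × ℝ => f (q + (c, 0))) = f := funext fun q => by
    rw [← hf q.1 q.2]; congr 1; ext <;> simp
  conv_rhs => rw [← h]
  rw [pd1, pd1, fderiv_comp_add_right]; simp

lemma pd2_periodic {f : ℝ × ℝ → ℝ} {c : ℝ} (hf : ∀ u v, f (u + c, v) = f (u, v)) (u v : ℝ) :
    pd2 f (u + c, v) = pd2 f (u, v) := by
  have h : (fun q : ℝ × ℝ => f (q + (c, 0))) = f := funext fun q => by
    rw [← hf q.1 q.2]; congr 1; ext <;> simp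
  conv_rhs => rw [← h]
  rw [pd2, pd2, fderiv_comp_add_right]; simp

/-- A periodic analytic planar field on a strip with values `A(u) (cos u, -sin u)` on the axis. -/
structure PolarField (A : ℝ → ℝ) (f g : ℝ × ℝ → ℝ) (δ : ℝ) : Prop where
  pos : 0 < δ
  memA : MemA2 A
  left_analytic : AnalyticOnNhd ℝ f (Strip2 δ)
  right_analytic : AnalyticOnNhd ℝ g (Strip2 δ)
  left_periodic : ∀ u v, f (u + 2 * π, v) = f (u, v)
  right_periodic : ∀ u v, g (u + 2 * π, v) = g (u, v)
  left_axis : ∀ u, f (u, 0) = A u * cos u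
  right_axis : ∀ u, g (u, 0) = -(A u * sin u)

/-- The Jacobian of `v (f, g)` divided by `v`. -/
def reducedJac (f g : ℝ × ℝ → ℝ) (q : ℝ × ℝ) : ℝ :=
  pd1 f q * pd2 (vmul g) q - pd2 (vmul f) q * pd1 g q

lemma MemA2.mul_pos {A : ℝ → ℝ} (hA : MemA2 A) (x y : ℝ) : 0 < A x * A y := by
  have hc : Continuous A := continuous_iff_continuousAt.2 fun x =>
    (hA.1 x (mem_univ x)).continuousAt
  by_contra! h
  have : (0 : ℝ) ∈ range A := by
    rcases mul_nonpos_iff.1 h with ⟨h1, h2⟩ | ⟨h1, h2⟩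
    · exact mem_range_of_exists_le_of_exists_ge hc ⟨y, h2⟩ ⟨x, h1⟩
    · exact mem_range_of_exists_le_of_exists_ge hc ⟨x, h1⟩ ⟨y, h2⟩
  obtain ⟨t, ht⟩ := this
  exact hA.2.2 t ht

namespace PolarField
variable {A : ℝ → ℝ} {f g : ℝ × ℝ → ℝ} {δ : ℝ}

lemma axis_mem (h : PolarField A f g δ) (u : ℝ) : (u, (0 : ℝ)) ∈ Strip2 δ :=
  mem_strip2.2 (by simpa using h.pos)

lemma hasDerivAt (h : PolarField A f g δ) (u : ℝ) : HasDerivAt A (deriv A u) u :=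
  (h.memA.1 u (mem_univ u)).differentiableAt.hasDerivAt

lemma pd1_left_axis (h : PolarField A f g δ) (u : ℝ) :
    pd1 f (u, 0) = deriv A u * cos u - A u * sin u := by
  refine pd1_eq_of_hasDerivAt (h.left_analytic _ (h.axis_mem u)).differentiableAt ?_
  simp only [h.left_axis]
  exact ((h.hasDerivAt u).mul (hasDerivAt_cos u)).congr_deriv (by ring)

lemma pd1_right_axis (h : PolarField A f g δ) (u : ℝ) :
    pd1 g (u, 0) = -(deriv A u * sin u + A u * cos u) := by
  refine pd1_eq_of_hasDerivAt (h.right_analytic _ (h.axis_mem u)).differentiableAt ?_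
  simp only [h.right_axis]
  exact ((h.hasDerivAt u).mul (hasDerivAt_sin u)).neg

lemma reducedJac_axis (h : PolarField A f g δ) (u : ℝ) : reducedJac f g (u, 0) = A u ^ 2 := by
  rw [reducedJac, pd2_vmul (h.left_analytic _ (h.axis_mem u)).differentiableAt,
    pd2_vmul (h.right_analytic _ (h.axis_mem u)).differentiableAt, h.pd1_left_axis,
    h.pd1_right_axis, h.left_axis, h.right_axis]
  linear_combination A u ^ 2 * sin_sq_add_cos_sq u

lemma jac_eq {f g : ℝ × ℝ → ℝ} {q : ℝ × ℝ} (hf : DifferentiableAt ℝ f q)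
    (hg : DifferentiableAt ℝ g q) :
    pd1 (vmul f) q * pd2 (vmul g) q - pd2 (vmul f) q * pd1 (vmul g) q =
      q.2 * reducedJac f g q := by
  rw [reducedJac, pd1_vmul hf, pd1_vmul hg]; ring

lemma exists_reducedJac_pos (h : PolarField A f g δ) :
    ∃ R > 0, ∀ q : ℝ × ℝ, |q.2| < R → 0 < reducedJac f g q := by
  have vp : ∀ {f : ℝ × ℝ → ℝ}, (∀ u v, f (u + 2 * π, v) = f (u, v)) →
    ∀ u v, vmul f (u + 2 * π, v) = vmul f (u, v) := fun hf u v => by simp only [vmul, hf]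
  refine exists_strip_pos (fun u v => ?_) (fun u => ?_) fun u => ?_
  · simp only [reducedJac, pd1_periodic h.left_periodic, pd1_periodic h.right_periodic,
      pd2_periodic (vp h.left_periodic), pd2_periodic (vp h.right_periodic)]
  · have hm := h.axis_mem u
    exact (((h.left_analytic.pd1.mul h.right_analytic.vmul.pd2).sub
      (h.left_analytic.vmul.pd2.mul h.right_analytic.pd1)) _ hm).continuousAt
  · rw [h.reducedJac_axis]
    have := h.memA.2.2 u
    positivity

lemma exists_sq_add_sq_pos (h : PolarField A f g δ) :
    ∃ R > 0, ∀ q : ℝ × ℝ, |q.2| < R → 0 < f q ^ 2 + g q ^ 2 := by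
  refine exists_strip_pos (fun u v => by rw [h.left_periodic, h.right_periodic]) (fun u => ?_)
    fun u => ?_
  · have hm := h.axis_mem u
    exact (((h.left_analytic _ hm).pow 2).add ((h.right_analytic _ hm).pow 2)).continuousAt
  · rw [h.left_axis, h.right_axis]
    have := h.memA.2.2 u
    have e : (A u * cos u) ^ 2 + (-(A u * sin u)) ^ 2 = A u ^ 2 := by
      linear_combination A u ^ 2 * sin_sq_add_cos_sq u
    rw [e]; positivity

/-- Near each point of the axis, `v (f, g)` is injective on `v > 0`. -/
lemma eventually_injective (h : PolarField A f g δ) (u : ℝ) :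
    ∃ S ∈ nhds (u, (0 : ℝ)), ∀ p ∈ S, ∀ q ∈ S, 0 < p.2 → 0 < q.2 → vmul f p = vmul f q →
      vmul g p = vmul g q → p = q := by
  have hm := h.axis_mem u
  have hf := h.left_analytic _ hm
  have hg := h.right_analytic _ hm
  have hA := h.memA.2.2 u
  set c := A u * cos u with hc
  set s := -(A u * sin u) with hs
  have hcs : c ^ 2 + s ^ 2 = A u ^ 2 := by linear_combination A u ^ 2 * sin_sq_add_cos_sq u
  set N : ℝ × ℝ → ℝ := fun q => c * g q - s * f q with hN
  set D : ℝ × ℝ → ℝ := fun q => c * f q + s * g q with hD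
  have hNa : AnalyticAt ℝ N (u, 0) := (analyticAt_const.mul hg).sub (analyticAt_const.mul hf)
  have hDa : AnalyticAt ℝ D (u, 0) := (analyticAt_const.mul hf).add (analyticAt_const.mul hg)
  have hN0 : N (u, 0) = 0 := by simp only [hN, h.left_axis, h.right_axis]; ring
  have hD0 : D (u, 0) = A u ^ 2 := by rw [← hcs]; simp only [hD, h.left_axis, h.right_axis]; ring
  have hDne : D (u, 0) ≠ 0 := by rw [hD0]; positivity
  have hN1 : pd1 N (u, 0) = -A u ^ 2 := by
    have h1 := ((hasDerivAt_pd1 hg.differentiableAt).const_mul c).sub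
      ((hasDerivAt_pd1 hf.differentiableAt).const_mul s)
    rw [pd1_eq_of_hasDerivAt hNa.differentiableAt h1, h.pd1_left_axis, h.pd1_right_axis]
    linear_combination (-A u ^ 2) * sin_sq_add_cos_sq u
  have hQa : AnalyticAt ℝ (fun q => N q / D q) (u, 0) := hNa.fun_div hDa hDne
  have hR1 : pd1 (fun q => N q / D q) (u, 0) = -1 := by
    rw [pd1_eq_of_hasDerivAt hQa.differentiableAt
      ((hasDerivAt_pd1 hNa.differentiableAt).fun_div (hasDerivAt_pd1 hDa.differentiableAt) hDne),
      hN1, hN0, hD0]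
    field_simp; ring
  have hvD : AnalyticAt ℝ (vmul D) (u, 0) := analyticAt_snd.mul hDa
  obtain ⟨e, he, heq, -⟩ := exists_local_inverse hQa hvD (by
    rw [hR1, pd1_vmul hDa.differentiableAt, pd2_vmul hDa.differentiableAt, hD0]
    simpa using hA)
  refine ⟨e.source ∩ {q | D q ≠ 0}, Filter.inter_mem (e.open_source.mem_nhds he)
    (hDa.continuousAt.eventually_ne hDne), ?_⟩
  rintro p ⟨hp, hpD⟩ q ⟨hq, hqD⟩ hp0 hq0 h1 h2
  refine e.injOn hp hq ?_
  simp only [vmul] at h1 h2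
  have e1 : p.2 * N p = q.2 * N q := by simp only [hN]; linear_combination c * h2 - s * h1
  have e2 : p.2 * D p = q.2 * D q := by simp only [hD]; linear_combination c * h1 + s * h2
  rw [heq, heq]
  ext
  · show N p / D p = N q / D q
    rw [← mul_div_mul_left _ _ hp0.ne', e1, e2, mul_div_mul_left _ _ hq0.ne']
  · exact e2

lemma exists_injective (h : PolarField A f g δ) :
    ∃ R > 0, ∀ p ∈ Strip R, ∀ q ∈ Strip R, vmul f p = vmul f q → vmul g p = vmul g q →
      p.2 = q.2 ∧ ∃ n : ℤ, p.1 - q.1 = 2 * π * n := by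
  have h1 := (isCompact_Icc.prod isCompact_Icc).eventually_forall_of_forall_eventually
    (x₀ := ((0 : ℝ), (0 : ℝ))) (K := Icc 0 (2 * π) ×ˢ Icc (-π) π)
    (P := fun v u : ℝ × ℝ => 0 < v.1 → 0 < v.2 → vmul f (u.1, v.1) = vmul f (u.1 + u.2, v.2) →
      vmul g (u.1, v.1) = vmul g (u.1 + u.2, v.2) → v.1 = v.2 ∧ u.2 = 0) ?_
  · obtain ⟨R, hR, h2⟩ := Metric.eventually_nhds_iff.1 h1
    refine ⟨R, hR, fun p hp q hq e1 e2 => ?_⟩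
    have hfp : Function.Periodic (fun u => f (u, p.2)) (2 * π) := fun u => h.left_periodic u _
    have hgp : Function.Periodic (fun u => g (u, p.2)) (2 * π) := fun u => h.right_periodic u _
    have hfq : Function.Periodic (fun u => f (u, q.2)) (2 * π) := fun u => h.left_periodic u _
    have hgq : Function.Periodic (fun u => g (u, q.2)) (2 * π) := fun u => h.right_periodic u _
    set m := toIcoDiv two_pi_pos 0 p.1 with hmdef
    set a := toIcoMod two_pi_pos 0 p.1 with ha
    have ha' : a = p.1 - m • (2 * π) := rfl
    set n := toIcoDiv two_pi_pos (-π) (q.1 - a) with hndef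
    set w := toIcoMod two_pi_pos (-π) (q.1 - a) with hw
    have hw' : a + w = q.1 - n • (2 * π) := by
      have : w = q.1 - a - n • (2 * π) := rfl
      rw [this]; ring
    have hwm := toIcoMod_mem_Ico two_pi_pos (-π) (q.1 - a)
    have h3 := h2 (y := (p.2, q.2)) (by
      rw [Prod.dist_eq, Real.dist_eq, Real.dist_eq, sub_zero, sub_zero, abs_of_pos hp.1,
        abs_of_pos hq.1]
      exact max_lt hp.2 hq.2) (a, w)
      ⟨Ico_subset_Icc_self (by simpa using toIcoMod_mem_Ico two_pi_pos 0 p.1),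
        hwm.1, by have := hwm.2; simp only [hw]; linarith⟩ hp.1 hq.1
      (by
        have x1 := hfp.sub_zsmul_eq m (x := p.1)
        have x2 := hfq.sub_zsmul_eq n (x := q.1)
        simp only [vmul, hw']
        rw [x2, ha', x1]; exact e1)
      (by
        have x1 := hgp.sub_zsmul_eq m (x := p.1)
        have x2 := hgq.sub_zsmul_eq n (x := q.1)
        simp only [vmul, hw']
        rw [x2, ha', x1]; exact e2)
    refine ⟨h3.1, m - n, ?_⟩
    have h4 : w = 0 := h3.2
    rw [h4, ha', zsmul_eq_mul, zsmul_eq_mul] at hw'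
    push_cast
    linarith
  · rintro ⟨u, w⟩ ⟨-, hw⟩
    have t1 : Tendsto (fun z : (ℝ × ℝ) × ℝ × ℝ => (z.2.1, z.1.1))
        (nhds (((0 : ℝ), (0 : ℝ)), (u, w))) (nhds (u, 0)) :=
      (by fun_prop : Continuous fun z : (ℝ × ℝ) × ℝ × ℝ => (z.2.1, z.1.1)).tendsto _
    have t2 : Tendsto (fun z : (ℝ × ℝ) × ℝ × ℝ => (z.2.1 + z.2.2, z.1.2))
        (nhds (((0 : ℝ), (0 : ℝ)), (u, w))) (nhds (u + w, 0)) :=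
      (by fun_prop : Continuous fun z : (ℝ × ℝ) × ℝ × ℝ => (z.2.1 + z.2.2, z.1.2)).tendsto _
    by_cases hw0 : w = 0
    · subst hw0
      obtain ⟨S, hS, hinj⟩ := h.eventually_injective u
      rw [add_zero] at t2
      filter_upwards [t1 hS, t2 hS] with z hz1 hz2 p1 p2 e1 e2
      have := hinj _ hz1 _ hz2 p1 p2 e1 e2
      have h5 := congrArg Prod.fst this
      exact ⟨congrArg Prod.snd this, by simpa using h5⟩
    · have f1 := ((h.left_analytic _ (h.axis_mem u)).continuousAt.tendsto.comp t1)
      have g1 := ((h.right_analytic _ (h.axis_mem u)).continuousAt.tendsto.comp t1)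
      have f2 := ((h.left_analytic _ (h.axis_mem (u + w))).continuousAt.tendsto.comp t2)
      have g2 := ((h.right_analytic _ (h.axis_mem (u + w))).continuousAt.tendsto.comp t2)
      have hAA := h.memA.mul_pos u (u + w)
      rw [h.left_axis] at f1 f2
      rw [h.right_axis] at g1 g2
      by_cases hsin : sin w = 0
      · have hcos : cos w < 0 := by
          have hlt : π ≤ |w| := by
            by_contra! hlt
            rw [abs_lt] at hlt
            exact hw0 ((sin_eq_zero_iff_of_lt_of_lt hlt.1 hlt.2).1 hsin)
          rw [← cos_abs]
          exact cos_neg_of_pi_div_two_lt_of_lt (by linarith [pi_pos])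
            (by linarith [abs_le.2 ⟨hw.1, hw.2⟩, pi_pos])
        have hdot : A u * cos u * (A (u + w) * cos (u + w)) +
            -(A u * sin u) * -(A (u + w) * sin (u + w)) < 0 := by
          have : cos w = cos u * cos (u + w) + sin u * sin (u + w) := by
            rw [← cos_sub, ← cos_neg]; ring_nf
          have h6 := mul_neg_of_pos_of_neg hAA hcos
          rw [this] at h6
          linarith
        filter_upwards [((f1.mul f2).add (g1.mul g2)).eventually_lt_const hdot]
          with z hz p1 p2 e1 e2
        exfalso
        simp only [vmul, Function.comp] at hz e1 e2
        have := mul_neg_of_pos_of_neg (mul_pos p1 p2) hz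
        have h7 : z.1.1 * z.1.2 * (f (z.2.1, z.1.1) * f (z.2.1 + z.2.2, z.1.2) +
            g (z.2.1, z.1.1) * g (z.2.1 + z.2.2, z.1.2)) =
            (z.1.2 * f (z.2.1 + z.2.2, z.1.2)) ^ 2 + (z.1.2 * g (z.2.1 + z.2.2, z.1.2)) ^ 2 := by
          linear_combination z.1.2 * f (z.2.1 + z.2.2, z.1.2) * e1 +
            z.1.2 * g (z.2.1 + z.2.2, z.1.2) * e2
        rw [h7] at this
        exact absurd this (not_lt.2 (by positivity))
      · have hcross : A u * cos u * -(A (u + w) * sin (u + w)) -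
            -(A u * sin u) * (A (u + w) * cos (u + w)) ≠ 0 := by
          have : sin w = sin (u + w) * cos u - cos (u + w) * sin u := by
            rw [← sin_sub]; ring_nf
          have h6 := mul_ne_zero hAA.ne' hsin
          rw [this] at h6
          intro h7
          apply h6
          linarith
        filter_upwards [((f1.mul g2).sub (g1.mul f2)).eventually_ne hcross]
          with z hz p1 p2 e1 e2
        exfalso
        simp only [vmul, Function.comp] at hz e1 e2
        refine hz (mul_left_cancel₀ (mul_pos p1 p2).ne' ?_)
        linear_combination z.1.2 * g (z.2.1 + z.2.2, z.1.2) * e1 -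
          z.1.2 * f (z.2.1 + z.2.2, z.1.2) * e2

end PolarField

namespace PolarField
variable {A : ℝ → ℝ} {f g : ℝ × ℝ → ℝ} {δ : ℝ}

/-- The planar map `v (f, g)`. -/
def _root_.planeMap (f g : ℝ × ℝ → ℝ) (q : ℝ × ℝ) : ℝ × ℝ := (vmul f q, vmul g q)

lemma strip_subset {R : ℝ} (hRδ : R ≤ δ) : Strip R ⊆ Strip2 δ := fun q hq =>
  ⟨by linarith [hq.1, hq.2], hq.2.trans_le hRδ⟩

lemma isOpen_strip (R : ℝ) : IsOpen (Strip R) :=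
  (isOpen_lt continuous_const continuous_snd).inter (isOpen_lt continuous_snd continuous_const)

/-- The local analytic inverse of the planar map. -/
lemma exists_planeMap_inverse (h : PolarField A f g δ) {R : ℝ} (hRδ : R ≤ δ) {q : ℝ × ℝ}
    (hq : q ∈ Strip R) (hJ : 0 < reducedJac f g q) :
    ∃ e : OpenPartialHomeomorph (ℝ × ℝ) (ℝ × ℝ), q ∈ e.source ∧ (∀ x, e x = planeMap f g x) ∧
      AnalyticAt ℝ e.symm (planeMap f g q) := by
  have hm := strip_subset hRδ hq
  refine exists_local_inverse (h.left_analytic.vmul _ hm) (h.right_analytic.vmul _ hm) ?_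
  rw [jac_eq (h.left_analytic _ hm).differentiableAt (h.right_analytic _ hm).differentiableAt]
  exact (mul_pos hq.1 hJ).ne'

lemma isOpen_image_strip (h : PolarField A f g δ) {R : ℝ} (hRδ : R ≤ δ)
    (hJ : ∀ q ∈ Strip R, 0 < reducedJac f g q) : IsOpen (planeMap f g '' Strip R) := by
  rw [isOpen_iff_mem_nhds]
  rintro _ ⟨q, hq, rfl⟩
  obtain ⟨e, he, heq, -⟩ := h.exists_planeMap_inverse hRδ hq (hJ q hq)
  have h1 : IsOpen (e '' (Strip R ∩ e.source)) :=
    e.isOpen_image_of_subset_source ((isOpen_strip R).inter e.open_source) inter_subset_right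
  refine Filter.mem_of_superset (h1.mem_nhds ⟨q, ⟨hq, he⟩, heq q⟩) ?_
  rintro _ ⟨x, hx, rfl⟩
  exact ⟨x, hx.1, (heq x).symm⟩

lemma exists_mem_period (h : PolarField A f g δ) (q : ℝ × ℝ) :
    ∃ u ∈ Icc 0 (2 * π), f (u, q.2) = f q ∧ g (u, q.2) = g q := by
  have hf : Function.Periodic (fun u => f (u, q.2)) (2 * π) := fun u => h.left_periodic u _
  have hg : Function.Periodic (fun u => g (u, q.2)) (2 * π) := fun u => h.right_periodic u _
  exact ⟨toIcoMod two_pi_pos 0 q.1,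
    Ico_subset_Icc_self (by simpa using toIcoMod_mem_Ico two_pi_pos 0 q.1),
    hf.sub_zsmul_eq _, hg.sub_zsmul_eq _⟩

lemma exists_pdisk_subset (h : PolarField A f g δ) {R : ℝ} (hR : 0 < R) (hRδ : R ≤ δ)
    (hJ : ∀ q ∈ Strip R, 0 < reducedJac f g q) (hsq : ∀ q ∈ Strip R, 0 < f q ^ 2 + g q ^ 2) :
    ∃ ρ > 0, PDisk 0 0 ρ ⊆ planeMap f g '' Strip R := by
  set r := R / 2 with hr
  have hr0 : 0 < r := by positivity
  have hrR : r < R := by rw [hr]; linarith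
  have hsub : Strip r ⊆ Strip R := fun q hq => ⟨hq.1, hq.2.trans hrR⟩
  have hUo := h.isOpen_image_strip (hrR.le.trans hRδ) fun q hq => hJ q (hsub hq)
  set U := planeMap f g '' Strip r
  set K := planeMap f g '' (Icc 0 (2 * π) ×ˢ Icc 0 r) with hK
  have hmem : ∀ q : ℝ × ℝ, q.2 ∈ Icc 0 r → q ∈ Strip2 δ := fun q hq =>
    ⟨by linarith [hq.1, hq.2], by linarith [hq.1, hq.2]⟩
  have hKc : IsCompact K := (isCompact_Icc.prod isCompact_Icc).image_of_continuousOn fun q hq =>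
    ((h.left_analytic.vmul _ (hmem q hq.2)).continuousAt.prodMk
      (h.right_analytic.vmul _ (hmem q hq.2)).continuousAt).continuousWithinAt
  obtain ⟨u₀, -, hmin⟩ := (isCompact_Icc (a := (0 : ℝ)) (b := 2 * π)).exists_isMinOn
    (f := fun u => f (u, r) ^ 2 + g (u, r) ^ 2) ⟨0, by simp [pi_pos.le]⟩ fun u _ => by
      have hm := hmem (u, r) ⟨hr0.le, le_rfl⟩
      have h1 : ContinuousAt (fun q => f q ^ 2 + g q ^ 2) (u, r) :=
        ((h.left_analytic _ hm).continuousAt.pow 2).add ((h.right_analytic _ hm).continuousAt.pow 2)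
      exact (ContinuousAt.comp (f := fun u => (u, r)) (x := u) h1
        (by fun_prop)).continuousWithinAt
  have hm0 := hsq (u₀, r) ⟨hr0, hrR⟩
  set m := f (u₀, r) ^ 2 + g (u₀, r) ^ 2
  refine ⟨√(r ^ 2 * m), by positivity, ?_⟩
  have hρ : √(r ^ 2 * m) ^ 2 = r ^ 2 * m := sq_sqrt (by positivity)
  have hmp : ∀ p, p ∈ PDisk 0 0 √(r ^ 2 * m) ↔
      0 < p.1 ^ 2 + p.2 ^ 2 ∧ p.1 ^ 2 + p.2 ^ 2 < r ^ 2 * m := fun p => by rw [mem_pdisk, hρ]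
  have hnorm : ∀ q, (planeMap f g q).1 ^ 2 + (planeMap f g q).2 ^ 2 =
      q.2 ^ 2 * (f q ^ 2 + g q ^ 2) := fun q => by simp only [planeMap, vmul]; ring
  refine Subset.trans (IsPreconnected.subset_left_of_subset_union hUo hKc.isClosed.isOpen_compl
    ?_ ?_ ?_ (isPreconnected_pdisk (by positivity))) (image_mono hsub)
  · rw [disjoint_compl_right_iff_subset]
    rintro _ ⟨q, hq, rfl⟩
    obtain ⟨u, hu, e1, e2⟩ := h.exists_mem_period q
    exact ⟨(u, q.2), ⟨hu, hq.1.le, hq.2.le⟩, by simp only [planeMap, vmul, e1, e2]⟩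
  · intro p hp
    by_cases hpK : p ∈ K
    · left
      obtain ⟨q, ⟨hq1, hq2⟩, rfl⟩ := hpK
      rw [hmp, hnorm] at hp
      refine ⟨q, ⟨lt_of_le_of_ne hq2.1 fun h0 => ?_, lt_of_le_of_ne hq2.2 fun h0 => ?_⟩, rfl⟩
      · rw [← h0] at hp; simp at hp
      · have h1 : m ≤ f (q.1, r) ^ 2 + g (q.1, r) ^ 2 := hmin hq1
        rw [← h0] at h1
        have h2 := hp.2
        rw [h0] at h2
        exact absurd h2 (not_lt.2 (by gcongr))
    · exact Or.inr hpK
  · have hm := h.axis_mem 0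
    have h1 : ContinuousAt (fun q : ℝ × ℝ => q.2 ^ 2 * (f q ^ 2 + g q ^ 2)) (0, 0) :=
      (continuous_snd.continuousAt.pow 2).mul
        (((h.left_analytic _ hm).continuousAt.pow 2).add
          ((h.right_analytic _ hm).continuousAt.pow 2))
    have h2 : ContinuousAt (fun v : ℝ => v ^ 2 * (f (0, v) ^ 2 + g (0, v) ^ 2)) 0 :=
      ContinuousAt.comp (f := fun v : ℝ => ((0 : ℝ), v)) (x := 0) h1 (by fun_prop)
    have h3 : ∀ᶠ v in nhdsWithin (0 : ℝ) (Ioi 0),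
        v ^ 2 * (f (0, v) ^ 2 + g (0, v) ^ 2) < r ^ 2 * m :=
      (h2.tendsto.eventually_lt_const (by simp only [ne_eq, OfNat.ofNat_ne_zero,
        not_false_eq_true, zero_pow, zero_mul]; positivity)).filter_mono nhdsWithin_le_nhds
    obtain ⟨v, hv, hv0, hvr⟩ := (h3.and (Ioo_mem_nhdsGT hr0)).exists
    have h4 := hsq (0, v) ⟨hv0, hvr.trans hrR⟩
    refine ⟨planeMap f g (0, v), (hmp _).2 ?_, (0, v), ⟨hv0, hvr⟩, rfl⟩
    rw [hnorm]
    exact ⟨mul_pos (pow_pos hv0 2) h4, hv⟩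

end PolarField

section ChainRule
variable {X Y Z z : ℝ × ℝ → ℝ} {q : ℝ × ℝ}

lemma fderiv_apply_eq {E : Type*} [NormedAddCommGroup E] [NormedSpace ℝ E]
    (f : ℝ × ℝ → E) (p w : ℝ × ℝ) :
    fderiv ℝ f p w = w.1 • pd1 f p + w.2 • pd2 f p := by
  rw [pd1, pd2, ← map_smul, ← map_smul, ← map_add]; simp

lemma pd1_comp (hz : DifferentiableAt ℝ z (X q, Y q)) (hX : DifferentiableAt ℝ X q)
    (hY : DifferentiableAt ℝ Y q) :
    pd1 (fun x => z (X x, Y x)) q = pd1 z (X q, Y q) * pd1 X q + pd2 z (X q, Y q) * pd1 Y q := by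
  have h := hz.hasFDerivAt.comp q (hX.hasFDerivAt.prodMk hY.hasFDerivAt)
  have h2 : pd1 (fun x => z (X x, Y x)) q =
      fderiv ℝ z (X q, Y q) (pd1 X q, pd1 Y q) := by
    rw [pd1]; exact congrArg (fun L => L (1, 0)) h.fderiv
  rw [h2, fderiv_apply_eq]; simp only [smul_eq_mul]; ring

lemma pd2_comp (hz : DifferentiableAt ℝ z (X q, Y q)) (hX : DifferentiableAt ℝ X q)
    (hY : DifferentiableAt ℝ Y q) :
    pd2 (fun x => z (X x, Y x)) q = pd1 z (X q, Y q) * pd2 X q + pd2 z (X q, Y q) * pd2 Y q := by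
  have h := hz.hasFDerivAt.comp q (hX.hasFDerivAt.prodMk hY.hasFDerivAt)
  have h2 : pd2 (fun x => z (X x, Y x)) q =
      fderiv ℝ z (X q, Y q) (pd2 X q, pd2 Y q) := by
    rw [pd2]; exact congrArg (fun L => L (0, 1)) h.fderiv
  rw [h2, fderiv_apply_eq]; simp only [smul_eq_mul]; ring

lemma pd1_eventuallyEq {f g : ℝ × ℝ → ℝ} (h : f =ᶠ[nhds q] g) : pd1 f q = pd1 g q := by
  rw [pd1, pd1, h.fderiv_eq]

lemma pd2_eventuallyEq {f g : ℝ × ℝ → ℝ} (h : f =ᶠ[nhds q] g) : pd2 f q = pd2 g q := by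
  rw [pd2, pd2, h.fderiv_eq]

/-- The first and second derivatives of `Z = z ∘ (X, Y)` in terms of those of `z`. -/
structure GraphJet (X Y Z z : ℝ × ℝ → ℝ) (q : ℝ × ℝ) : Prop where
  fst : pd1 Z q = zx z (X q, Y q) * pd1 X q + zy z (X q, Y q) * pd1 Y q
  snd : pd2 Z q = zx z (X q, Y q) * pd2 X q + zy z (X q, Y q) * pd2 Y q
  fst_fst : pd1 (pd1 Z) q =
    zxx z (X q, Y q) * pd1 X q ^ 2 + 2 * zxy z (X q, Y q) * (pd1 X q * pd1 Y q) +
      zyy z (X q, Y q) * pd1 Y q ^ 2 + zx z (X q, Y q) * pd1 (pd1 X) q +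
      zy z (X q, Y q) * pd1 (pd1 Y) q
  fst_snd : pd2 (pd1 Z) q =
    zxx z (X q, Y q) * (pd1 X q * pd2 X q) +
      zxy z (X q, Y q) * (pd1 X q * pd2 Y q + pd2 X q * pd1 Y q) +
      zyy z (X q, Y q) * (pd1 Y q * pd2 Y q) + zx z (X q, Y q) * pd2 (pd1 X) q +
      zy z (X q, Y q) * pd2 (pd1 Y) q
  snd_snd : pd2 (pd2 Z) q =
    zxx z (X q, Y q) * pd2 X q ^ 2 + 2 * zxy z (X q, Y q) * (pd2 X q * pd2 Y q) +
      zyy z (X q, Y q) * pd2 Y q ^ 2 + zx z (X q, Y q) * pd2 (pd2 X) q +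
      zy z (X q, Y q) * pd2 (pd2 Y) q

lemma graphJet_of_eventually (hX : AnalyticAt ℝ X q) (hY : AnalyticAt ℝ Y q)
    (hz : AnalyticAt ℝ z (X q, Y q)) (hZ : ∀ᶠ x in nhds q, Z x = z (X x, Y x)) :
    GraphJet X Y Z z q := by
  have hXY : ContinuousAt (fun x => (X x, Y x)) q := hX.continuousAt.prodMk hY.continuousAt
  have hXe := hX.eventually_analyticAt
  have hYe := hY.eventually_analyticAt
  have hze := hXY.eventually hz.eventually_analyticAt
  have e1 : pd1 Z =ᶠ[nhds q]
      fun x => zx z (X x, Y x) * pd1 X x + zy z (X x, Y x) * pd1 Y x := by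
    filter_upwards [hXe, hYe, hze, hZ.eventually_nhds] with x h1 h2 h3 h4
    exact (pd1_eventuallyEq h4).trans
      (pd1_comp h3.differentiableAt h1.differentiableAt h2.differentiableAt)
  have e2 : pd2 Z =ᶠ[nhds q]
      fun x => zx z (X x, Y x) * pd2 X x + zy z (X x, Y x) * pd2 Y x := by
    filter_upwards [hXe, hYe, hze, hZ.eventually_nhds] with x h1 h2 h3 h4
    exact (pd2_eventuallyEq h4).trans
      (pd2_comp h3.differentiableAt h1.differentiableAt h2.differentiableAt)
  have dX := hX.differentiableAt
  have dY := hY.differentiableAt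
  have dz1 : DifferentiableAt ℝ (zx z) (X q, Y q) := hz.pd1.differentiableAt
  have dz2 : DifferentiableAt ℝ (zy z) (X q, Y q) := hz.pd2.differentiableAt
  have c1 : DifferentiableAt ℝ (fun x => zx z (X x, Y x)) q :=
    DifferentiableAt.comp (f := fun x => (X x, Y x)) q dz1 (dX.prodMk dY)
  have c2 : DifferentiableAt ℝ (fun x => zy z (X x, Y x)) q :=
    DifferentiableAt.comp (f := fun x => (X x, Y x)) q dz2 (dX.prodMk dY)
  have d1X := hX.pd1.differentiableAt
  have d1Y := hY.pd1.differentiableAt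
  have d2X := hX.pd2.differentiableAt
  have d2Y := hY.pd2.differentiableAt
  have hcomm : pd1 (zy z) (X q, Y q) = zxy z (X q, Y q) := pd1_pd2_comm hz
  refine ⟨e1.eq_of_nhds, e2.eq_of_nhds, ?_, ?_, ?_⟩
  · refine (pd1_eventuallyEq e1).trans ((pd1_add (c1.fun_mul d1X) (c2.fun_mul d1Y)).trans ?_)
    rw [pd1_mul c1 d1X, pd1_mul c2 d1Y, pd1_comp dz1 dX dY, pd1_comp dz2 dX dY, hcomm]
    simp only [zxx, zyy, zxy]; ring
  · refine (pd2_eventuallyEq e1).trans ((pd2_add (c1.fun_mul d1X) (c2.fun_mul d1Y)).trans ?_)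
    rw [pd2_mul c1 d1X, pd2_mul c2 d1Y, pd2_comp dz1 dX dY, pd2_comp dz2 dX dY, hcomm]
    simp only [zxx, zyy, zxy]; ring
  · refine (pd2_eventuallyEq e2).trans ((pd2_add (c1.fun_mul d2X) (c2.fun_mul d2Y)).trans ?_)
    rw [pd2_mul c1 d2X, pd2_mul c2 d2Y, pd2_comp dz1 dX dY, pd2_comp dz2 dX dY, hcomm]
    simp only [zxx, zyy, zxy]; ring

end ChainRule

section Algebra
variable {P Q a b c d E J h r s t : ℝ}

/-- For a conformal map into a graph with gradient `(P, Q)`, the discriminant of the metric. -/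
lemma conformal_discrim (hJ : a * d - b * c = J) (h1 : a ^ 2 + c ^ 2 - (P * a + Q * c) ^ 2 = E)
    (h2 : b ^ 2 + d ^ 2 - (P * b + Q * d) ^ 2 = E)
    (h3 : a * b + c * d - (P * a + Q * c) * (P * b + Q * d) = 0) :
    J ^ 2 * (1 - P ^ 2 - Q ^ 2) = E ^ 2 := by
  have h4 : (a ^ 2 + c ^ 2 - (P * a + Q * c) ^ 2) * (b ^ 2 + d ^ 2 - (P * b + Q * d) ^ 2) -
      (a * b + c * d - (P * a + Q * c) * (P * b + Q * d)) ^ 2 = E ^ 2 := by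
    rw [h1, h2, h3]; ring
  rw [← h4, ← hJ]; ring

lemma conformal_mean_curvature (hJ : a * d - b * c = J) (hJ0 : 0 < J) (hE : 0 < E)
    (h1 : a ^ 2 + c ^ 2 - (P * a + Q * c) ^ 2 = E)
    (h2 : b ^ 2 + d ^ 2 - (P * b + Q * d) ^ 2 = E)
    (h3 : a * b + c * d - (P * a + Q * c) * (P * b + Q * d) = 0)
    (h4 : r * (a ^ 2 + b ^ 2) + 2 * s * (a * c + b * d) + t * (c ^ 2 + d ^ 2) =
      2 * h * J * (1 - P ^ 2 - Q ^ 2)) :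
    (1 - Q ^ 2) * r + 2 * P * Q * s + (1 - P ^ 2) * t =
      2 * h * (1 - P ^ 2 - Q ^ 2) ^ ((3 : ℝ) / 2) := by
  have hw := conformal_discrim hJ h1 h2 h3
  have hw2 : 1 - P ^ 2 - Q ^ 2 = (E / J) ^ 2 := by
    field_simp; linarith
  have hpow : (1 - P ^ 2 - Q ^ 2) ^ ((3 : ℝ) / 2) = (E / J) ^ 3 := by
    rw [hw2, ← Real.rpow_natCast (E / J) 2, ← Real.rpow_mul (by positivity),
      ← Real.rpow_natCast (E / J) 3]
    norm_num
  have k1 : J ^ 2 * (1 - Q ^ 2) = E * (a ^ 2 + b ^ 2) := by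
    rw [← hJ]; linear_combination b ^ 2 * h1 - 2 * a * b * h3 + a ^ 2 * h2
  have k2 : J ^ 2 * (1 - P ^ 2) = E * (c ^ 2 + d ^ 2) := by
    rw [← hJ]; linear_combination d ^ 2 * h1 - 2 * c * d * h3 + c ^ 2 * h2
  have k3 : J ^ 2 * (P * Q) = E * (a * c + b * d) := by
    rw [← hJ]; linear_combination b * d * h1 - (a * d + b * c) * h3 + a * c * h2
  rw [hpow]
  refine mul_left_cancel₀ (pow_pos hJ0 2).ne' ?_
  have k4 : J ^ 2 * (2 * h * (E / J) ^ 3) = 2 * h * E ^ 3 / J := by field_simp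
  rw [k4, eq_div_iff hJ0.ne']
  linear_combination r * J * k1 + t * J * k2 + 2 * s * J * k3 + E * J * h4 + 2 * h * E * hw

end Algebra

/-- The null curve `A(u) (cos u, -sin u, 1)`. -/
def coneCurve (A : ℝ → ℝ) : Fin 3 → ℝ → ℝ := ![fun u => A u * cos u, fun u => -(A u * sin u), A]

/-- A periodic solution `v F` of the conformal prescribed mean curvature system on a strip, with
`F` equal to the cone curve of `A` on the axis. -/
structure ConeSol (H : R3 → ℝ) (B : Set R3) (A : ℝ → ℝ) (F : Fin 3 → ℝ × ℝ → ℝ) (δ : ℝ) :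
    Prop where
  pos : 0 < δ
  memA : MemA2 A
  analytic_left : AnalyticOnNhd ℝ H B
  sol : IsSol H B (coneCurve A) F (Strip2 δ)
  per : ∀ i u v, F i (u + 2 * π, v) = F i (u, v)

/-- The cross product of the coordinate fields of `v F`, divided by `v`. -/
def coneNormal (F : Fin 3 → ℝ × ℝ → ℝ) (i : Fin 3) (q : ℝ × ℝ) : ℝ :=
  WSeries.lcr (fun j => pd1 (F j) q) (fun j => pd2 (vmul (F j)) q) i

/-- The conformal factor of `v F`, divided by `v ^ 2`. -/
def coneMetric (F : Fin 3 → ℝ × ℝ → ℝ) : ℝ × ℝ → ℝ := lf (fun i => pd1 (F i)) fun i => pd1 (F i)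

/-- The first diagonal coefficient of the second fundamental form of `v F`, rescaled. -/
def coneForm1 (F : Fin 3 → ℝ × ℝ → ℝ) : ℝ × ℝ → ℝ := lf (fun i => pd1 (pd1 (F i))) (coneNormal F)

/-- The off-diagonal coefficient of the second fundamental form of `v F`, rescaled. -/
def coneForm2 (F : Fin 3 → ℝ × ℝ → ℝ) : ℝ × ℝ → ℝ := lf (fun i => pd2 (pd1 (F i))) (coneNormal F)

/-- Minus the determinant of the second fundamental form of `v F`, rescaled. -/
def coneDet (H : R3 → ℝ) (F : Fin 3 → ℝ × ℝ → ℝ) (q : ℝ × ℝ) : ℝ :=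
  coneForm1 F q ^ 2 + 2 * H (toR3 fun j => vmul (F j) q) * q.2 ^ 2 * coneMetric F q ^ 2 *
    coneForm1 F q + coneForm2 F q ^ 2

namespace ConeSol
variable {H : R3 → ℝ} {B : Set R3} {A : ℝ → ℝ} {F : Fin 3 → ℝ × ℝ → ℝ} {δ : ℝ}

lemma polarField (h : ConeSol H B A F δ) : PolarField A (F 0) (F 1) δ where
  pos := h.pos
  memA := h.memA
  left_analytic := h.sol.analytic 0
  right_analytic := h.sol.analytic 1
  left_periodic := h.per 0
  right_periodic := h.per 1
  left_axis u := h.sol.init 0 u (mem_strip2.2 (by simpa using h.pos))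
  right_axis u := h.sol.init 1 u (mem_strip2.2 (by simpa using h.pos))

lemma axis_mem (h : ConeSol H B A F δ) (u : ℝ) : (u, (0 : ℝ)) ∈ Strip2 δ := h.polarField.axis_mem u

lemma third_axis (h : ConeSol H B A F δ) (u : ℝ) : F 2 (u, 0) = A u :=
  h.sol.init 2 u (h.axis_mem u)

lemma analyticAt_left (h : ConeSol H B A F δ) (u : ℝ) : AnalyticAt ℝ A u :=
  h.memA.1 u (mem_univ u)

lemma vmul_periodic (h : ConeSol H B A F δ) (i : Fin 3) (u v : ℝ) :
    vmul (F i) (u + 2 * π, v) = vmul (F i) (u, v) := by simp only [vmul, h.per]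

lemma pd1_third_axis (h : ConeSol H B A F δ) (u : ℝ) : pd1 (F 2) (u, 0) = deriv A u := by
  refine pd1_eq_of_hasDerivAt (h.sol.analytic 2 _ (h.axis_mem u)).differentiableAt ?_
  simp only [h.third_axis]
  exact h.polarField.hasDerivAt u

lemma hasDerivAt_deriv (h : ConeSol H B A F δ) (u : ℝ) :
    HasDerivAt (deriv A) (deriv (deriv A) u) u :=
  (h.analyticAt_left u).deriv.differentiableAt.hasDerivAt

lemma pd1_pd1_axis (h : ConeSol H B A F δ) (u : ℝ) :
    pd1 (pd1 (F 0)) (u, 0) =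
      deriv (deriv A) u * cos u - 2 * deriv A u * sin u - A u * cos u ∧
    pd1 (pd1 (F 1)) (u, 0) =
      -(deriv (deriv A) u * sin u + 2 * deriv A u * cos u - A u * sin u) ∧
    pd1 (pd1 (F 2)) (u, 0) = deriv (deriv A) u := by
  have hd := fun i => ((h.sol.analytic i).pd1 _ (h.axis_mem u)).differentiableAt
  have h1 := h.polarField.hasDerivAt u
  have h2 := h.hasDerivAt_deriv u
  refine ⟨pd1_eq_of_hasDerivAt (hd 0) ?_, pd1_eq_of_hasDerivAt (hd 1) ?_,
    pd1_eq_of_hasDerivAt (hd 2) ?_⟩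
  · simp only [h.polarField.pd1_left_axis]
    exact ((h2.mul (hasDerivAt_cos u)).sub (h1.mul (hasDerivAt_sin u))).congr_deriv (by ring)
  · simp only [h.polarField.pd1_right_axis]
    exact ((h2.mul (hasDerivAt_sin u)).add (h1.mul (hasDerivAt_cos u))).neg.congr_deriv (by ring)
  · simp only [h.pd1_third_axis]
    exact h2

lemma coneMetric_axis (h : ConeSol H B A F δ) (u : ℝ) : coneMetric F (u, 0) = A u ^ 2 := by
  simp only [coneMetric, lf, h.polarField.pd1_left_axis, h.polarField.pd1_right_axis,
    h.pd1_third_axis]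
  linear_combination (A u ^ 2 + deriv A u ^ 2) * sin_sq_add_cos_sq u

lemma coneForm1_axis (h : ConeSol H B A F δ) (u : ℝ) : coneForm1 F (u, 0) = -A u ^ 3 := by
  obtain ⟨e0, e1, e2⟩ := h.pd1_pd1_axis u
  have f0 := h.sol.pd2_vmul_axis 0 (h.axis_mem u)
  have f1 := h.sol.pd2_vmul_axis 1 (h.axis_mem u)
  have f2 := h.sol.pd2_vmul_axis 2 (h.axis_mem u)
  simp only [coneCurve, Matrix.cons_val] at f0 f1 f2
  simp only [coneForm1, lf, coneNormal, WSeries.lcr, Matrix.cons_val, e0, e1, e2, f0, f1, f2,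
    h.polarField.pd1_left_axis, h.polarField.pd1_right_axis, h.pd1_third_axis]
  linear_combination (-A u ^ 3) * sin_sq_add_cos_sq u

lemma coneNormal_analytic (h : ConeSol H B A F δ) (i : Fin 3) :
    AnalyticOnNhd ℝ (coneNormal F i) (Strip2 δ) := by
  have h1 := fun i => (h.sol.analytic i).pd1
  have h2 := fun i => (h.sol.analytic i).vmul.pd2
  fin_cases i
  · exact ((h1 2).mul (h2 1)).sub ((h1 1).mul (h2 2))
  · exact ((h1 0).mul (h2 2)).sub ((h1 2).mul (h2 0))
  · exact ((h1 0).mul (h2 1)).sub ((h1 1).mul (h2 0))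

lemma exists_coneMetric_pos (h : ConeSol H B A F δ) :
    ∃ R > 0, ∀ q : ℝ × ℝ, |q.2| < R → 0 < coneMetric F q := by
  refine exists_strip_pos (fun u v => ?_) (fun u => ?_) fun u => ?_
  · simp only [coneMetric, lf, pd1_periodic (h.per _)]
  · exact (AnalyticOnNhd.lf (fun i => (h.sol.analytic i).pd1) (fun i => (h.sol.analytic i).pd1) _
      (h.axis_mem u)).continuousAt
  · rw [h.coneMetric_axis]
    have := h.memA.2.2 u
    positivity

lemma exists_slope_pos (h : ConeSol H B A F δ) :
    ∃ R > 0, ∀ q : ℝ × ℝ, |q.2| < R → 0 < 4 * (F 0 q ^ 2 + F 1 q ^ 2) - F 2 q ^ 2 := by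
  have hc := fun i u => (h.sol.analytic i _ (h.axis_mem u)).continuousAt
  refine exists_strip_pos (fun u v => by simp only [h.per]) (fun u => ?_) fun u => ?_
  · exact (continuousAt_const.mul (((hc 0 u).pow 2).add ((hc 1 u).pow 2))).sub ((hc 2 u).pow 2)
  · have := h.memA.2.2 u
    have e : 4 * (F 0 (u, 0) ^ 2 + F 1 (u, 0) ^ 2) - F 2 (u, 0) ^ 2 = 3 * A u ^ 2 := by
      rw [h.polarField.left_axis, h.polarField.right_axis, h.third_axis]
      linear_combination 4 * A u ^ 2 * sin_sq_add_cos_sq u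
    rw [e]; positivity

lemma exists_coneDet_pos (h : ConeSol H B A F δ) :
    ∃ R > 0, ∀ q : ℝ × ℝ, |q.2| < R → 0 < coneDet H F q := by
  refine exists_strip_pos (fun u v => ?_) (fun u => ?_) fun u => ?_
  · simp only [coneDet, coneMetric, coneForm1, coneForm2, coneNormal, lf, WSeries.lcr,
      Matrix.cons_val, h.vmul_periodic, pd1_periodic (h.per _),
      pd1_periodic (pd1_periodic (h.per _)), pd2_periodic (pd1_periodic (h.per _)),
      pd2_periodic (h.vmul_periodic _)]
  · have hm := h.axis_mem u
    have c1 : ContinuousAt (coneForm1 F) (u, 0) :=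
      (AnalyticOnNhd.lf (fun i => (h.sol.analytic i).pd1.pd1) h.coneNormal_analytic _
        hm).continuousAt
    have c2 : ContinuousAt (coneForm2 F) (u, 0) :=
      (AnalyticOnNhd.lf (fun i => (h.sol.analytic i).pd1.pd2) h.coneNormal_analytic _
        hm).continuousAt
    have c3 : ContinuousAt (coneMetric F) (u, 0) :=
      (AnalyticOnNhd.lf (fun i => (h.sol.analytic i).pd1) (fun i => (h.sol.analytic i).pd1) _
        hm).continuousAt
    have hv := fun i => ((h.sol.analytic i).vmul _ hm).continuousAt
    have c4 : ContinuousAt (fun q => H (toR3 fun j => vmul (F j) q)) (u, 0) :=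
      ContinuousAt.comp (f := fun q => toR3 fun j => vmul (F j) q)
        (h.analytic_left _ (h.sol.mem _ hm)).continuousAt
        ((hv 0).prodMk ((hv 1).prodMk (hv 2)))
    exact ((c1.pow 2).add ((((continuousAt_const.mul c4).mul
      (continuous_snd.continuousAt.pow 2)).mul (c3.pow 2)).mul c1)).add (c2.pow 2)
  · have := h.memA.2.2 u
    have e : coneDet H F (u, 0) = (A u ^ 3) ^ 2 + coneForm2 F (u, 0) ^ 2 := by
      rw [coneDet, h.coneForm1_axis]; ring
    rw [e]; positivity

end ConeSol

lemma pd1_pd1_vmul {f : ℝ × ℝ → ℝ} {q : ℝ × ℝ} (hf : AnalyticAt ℝ f q) :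
    pd1 (pd1 (vmul f)) q = q.2 * pd1 (pd1 f) q := by
  have h : pd1 (vmul f) =ᶠ[nhds q] vmul (pd1 f) := by
    filter_upwards [hf.eventually_analyticAt] with x hx using pd1_vmul hx.differentiableAt
  rw [pd1_eventuallyEq h, pd1_vmul hf.pd1.differentiableAt]

lemma pd2_pd1_vmul {f : ℝ × ℝ → ℝ} {q : ℝ × ℝ} (hf : AnalyticAt ℝ f q) :
    pd2 (pd1 (vmul f)) q = pd1 f q + q.2 * pd2 (pd1 f) q := by
  have h : pd1 (vmul f) =ᶠ[nhds q] vmul (pd1 f) := by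
    filter_upwards [hf.eventually_analyticAt] with x hx using pd1_vmul hx.differentiableAt
  rw [pd2_eventuallyEq h, pd2_vmul hf.pd1.differentiableAt]

namespace ConeSol
variable {H : R3 → ℝ} {B : Set R3} {A : ℝ → ℝ} {F : Fin 3 → ℝ × ℝ → ℝ} {δ : ℝ}

lemma conformal (h : ConeSol H B A F δ) {q : ℝ × ℝ} (hq : q ∈ Strip2 δ) :
    lf (fun i => pd1 (vmul (F i))) (fun i => pd1 (vmul (F i))) q =
        lf (fun i => pd2 (vmul (F i))) (fun i => pd2 (vmul (F i))) q ∧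
      lf (fun i => pd1 (vmul (F i))) (fun i => pd2 (vmul (F i))) q = 0 := by
  refine h.sol.conformal (isOpen_strip2 δ) (fun q hq y hy => ?_) (fun u => ?_) q hq
  · rw [mem_strip2] at hq ⊢
    exact hy.trans_lt hq
  · simp only [coneCurve, Matrix.cons_val]
    linear_combination A u ^ 2 * sin_sq_add_cos_sq u

lemma lf_pd1_vmul (h : ConeSol H B A F δ) {q : ℝ × ℝ} (hq : q ∈ Strip2 δ) :
    lf (fun i => pd1 (vmul (F i))) (fun i => pd1 (vmul (F i))) q = q.2 ^ 2 * coneMetric F q := by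
  simp only [lf, coneMetric, fun i => pd1_vmul (h.sol.analytic i q hq).differentiableAt]
  ring

/-- Where a graph is parametrized by a conformal solution, it is elliptic, has the prescribed mean
curvature, and has nonvanishing Hessian determinant. -/
lemma graph_spec (h : ConeSol H B A F δ) {q : ℝ × ℝ} (hq : q ∈ Strip2 δ) (hv : 0 < q.2)
    (hJ : 0 < reducedJac (F 0) (F 1) q) (hE : 0 < coneMetric F q) (hD : 0 < coneDet H F q)
    {z : ℝ × ℝ → ℝ} (jet : GraphJet (vmul (F 0)) (vmul (F 1)) (vmul (F 2)) z q)
    {p : ℝ × ℝ} (hp : p = planeMap (F 0) (F 1) q) (hz : z p = vmul (F 2) q) :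
    (zx z p) ^ 2 + (zy z p) ^ 2 < 1 ∧
    (1 - (zy z p) ^ 2) * zxx z p + 2 * zx z p * zy z p * zxy z p + (1 - (zx z p) ^ 2) * zyy z p
      = 2 * H (p.1, p.2, z p) * (1 - (zx z p) ^ 2 - (zy z p) ^ 2) ^ ((3 : ℝ) / 2) ∧
    hessDet z p ≠ 0 := by
  have hpd : (p.1, p.2, z p) = toR3 fun j => vmul (F j) q := by rw [hz, hp]; rfl
  rw [hpd]
  have hd := fun i => (h.sol.analytic i q hq).differentiableAt
  obtain ⟨j1, j2, j11, j12, j22⟩ := jet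
  change pd1 _ q = zx z (planeMap (F 0) (F 1) q) * _ + _ at j1
  rw [show (vmul (F 0) q, vmul (F 1) q) = p from hp.symm] at j2 j11 j12 j22
  rw [← hp, show (vmul (F 0) q, vmul (F 1) q) = p from hp.symm] at j1
  obtain ⟨c1, c2⟩ := h.conformal hq
  have c3 := h.lf_pd1_vmul hq
  rw [c3] at c1
  simp only [lf, j1, j2] at c1 c2 c3
  have hpde := h.sol.pde q hq
  have p0 := hpde 0
  have p1 := hpde 1
  have p2 := hpde 2
  simp only [WSeries.lcr, Matrix.cons_val] at p0 p1 p2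
  rw [j11, j22] at p2
  rw [j1, j2] at p0 p1
  have hJ' := mul_pos hv hJ
  rw [← PolarField.jac_eq (hd 0) (hd 1)] at hJ'
  have hE' : 0 < q.2 ^ 2 * coneMetric F q := by positivity
  have n0 := fun i => pd1_vmul (hd i)
  have n1 := fun i => pd1_pd1_vmul (h.sol.analytic i q hq)
  have n2 := fun i => pd2_pd1_vmul (h.sol.analytic i q hq)
  have L1 : q.2 ^ 2 * coneForm1 F q =
      lf (fun i => pd1 (pd1 (vmul (F i))))
        (fun i q => WSeries.lcr (fun j => pd1 (vmul (F j)) q)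
          (fun j => pd2 (vmul (F j)) q) i) q := by
    simp only [coneForm1, lf, coneNormal, WSeries.lcr, Matrix.cons_val, n0, n1]; ring
  have L2 : q.2 ^ 2 * coneForm2 F q =
      lf (fun i => pd2 (pd1 (vmul (F i))))
        (fun i q => WSeries.lcr (fun j => pd1 (vmul (F j)) q)
          (fun j => pd2 (vmul (F j)) q) i) q := by
    simp only [coneForm2, lf, coneNormal, WSeries.lcr, Matrix.cons_val, n0, n2]; ring
  simp only [lf, WSeries.lcr, Matrix.cons_val, j1, j2, j11, j12] at L1 L2
  clear n0 n1 n2 hpde hJ hE hpd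
  set P := zx z p
  set Q := zy z p
  set a := pd1 (vmul (F 0)) q
  set b := pd2 (vmul (F 0)) q
  set c := pd1 (vmul (F 1)) q
  set d := pd2 (vmul (F 1)) q
  set E := q.2 ^ 2 * coneMetric F q with hEdef
  set η := H (toR3 fun j => vmul (F j) q) with hη
  have c1' : a ^ 2 + c ^ 2 - (P * a + Q * c) ^ 2 = E := by linear_combination c3
  have c2' : b ^ 2 + d ^ 2 - (P * b + Q * d) ^ 2 = E := by linear_combination -c1
  have c3' : a * b + c * d - (P * a + Q * c) * (P * b + Q * d) = 0 := by linear_combination c2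
  have hdisc := conformal_discrim rfl c1' c2' c3'
  have hM : zxx z p * (a ^ 2 + b ^ 2) + 2 * zxy z p * (a * c + b * d) +
      zyy z p * (c ^ 2 + d ^ 2) = 2 * η * (a * d - b * c) * (1 - P ^ 2 - Q ^ 2) := by
    linear_combination p2 - P * p0 - Q * p1
  refine ⟨?_, conformal_mean_curvature rfl hJ' hE' c1' c2' c3' hM, ?_⟩
  · have : 0 < (a * d - b * c) ^ 2 * (1 - P ^ 2 - Q ^ 2) := by rw [hdisc]; positivity
    have := pos_of_mul_pos_right this (sq_nonneg _)
    linarith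
  · intro h0
    rw [hessDet] at h0
    have k1 : (a * d - b * c) * (zxx z p * a ^ 2 + 2 * zxy z p * (a * c) + zyy z p * c ^ 2) =
        -(q.2 ^ 2 * coneForm1 F q) := by linear_combination L1
    have k2 : (a * d - b * c) * (zxx z p * (a * b) + zxy z p * (a * d + b * c) +
        zyy z p * (c * d)) = -(q.2 ^ 2 * coneForm2 F q) := by linear_combination L2
    have k3 : (a * d - b * c) * (zxx z p * b ^ 2 + 2 * zxy z p * (b * d) + zyy z p * d ^ 2) =
        2 * η * E ^ 2 + q.2 ^ 2 * coneForm1 F q := by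
      linear_combination (a * d - b * c) * hM - k1 + 2 * η * hdisc
    have k4 : (a * d - b * c) ^ 4 * (zxx z p * zyy z p - zxy z p ^ 2) =
        -(q.2 ^ 4 * coneDet H F q) := by
      have k5 : (a * d - b * c) ^ 4 * (zxx z p * zyy z p - zxy z p ^ 2) =
          (a * d - b * c) * (zxx z p * a ^ 2 + 2 * zxy z p * (a * c) + zyy z p * c ^ 2) *
            ((a * d - b * c) * (zxx z p * b ^ 2 + 2 * zxy z p * (b * d) + zyy z p * d ^ 2)) -
          ((a * d - b * c) * (zxx z p * (a * b) + zxy z p * (a * d + b * c) +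
            zyy z p * (c * d))) ^ 2 := by ring
      rw [k5, k1, k2, k3, hEdef, coneDet, ← hη]; ring
    rw [h0] at k4
    have : 0 < q.2 ^ 4 * coneDet H F q := by positivity
    linarith

end ConeSol

lemma hasDerivAt_slice {E : Type*} [NormedAddCommGroup E] [NormedSpace ℝ E] {f : ℝ × ℝ → E}
    {u v : ℝ} (hf : DifferentiableAt ℝ f (u, v)) :
    HasDerivAt (fun y => f (u, y)) (pd2 f (u, v)) v :=
  hf.hasFDerivAt.comp_hasDerivAt (x := v) (f := fun y => (u, y))
    ((hasDerivAt_const v u).prodMk (hasDerivAt_id v))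

/-- The map `v F` into `R3`. -/
def coneMap (F : Fin 3 → ℝ × ℝ → ℝ) (q : ℝ × ℝ) : R3 := toR3 fun i => vmul (F i) q

/-- The height of the surface `v F` over the plane, on the image of a strip. -/
def coneGraph (F : Fin 3 → ℝ × ℝ → ℝ) (R : ℝ) (p : ℝ × ℝ) : ℝ :=
  vmul (F 2) (Function.invFunOn (planeMap (F 0) (F 1)) (Strip R) p)

namespace ConeSol
variable {H : R3 → ℝ} {B : Set R3} {A : ℝ → ℝ} {F : Fin 3 → ℝ × ℝ → ℝ} {δ : ℝ}

lemma hasFDerivAt_coneMap (h : ConeSol H B A F δ) {q : ℝ × ℝ} (hq : q ∈ Strip2 δ) :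
    HasFDerivAt (coneMap F) ((fderiv ℝ (vmul (F 0)) q).prod
      ((fderiv ℝ (vmul (F 1)) q).prod (fderiv ℝ (vmul (F 2)) q))) q := by
  have hd := fun i => ((h.sol.analytic i).vmul q hq).differentiableAt.hasFDerivAt
  exact (hd 0).prodMk ((hd 1).prodMk (hd 2))

lemma pd1_coneMap (h : ConeSol H B A F δ) {q : ℝ × ℝ} (hq : q ∈ Strip2 δ) :
    pd1 (coneMap F) q = toR3 fun i => pd1 (vmul (F i)) q := by
  rw [pd1, (h.hasFDerivAt_coneMap hq).fderiv]; rfl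

lemma pd2_coneMap (h : ConeSol H B A F δ) {q : ℝ × ℝ} (hq : q ∈ Strip2 δ) :
    pd2 (coneMap F) q = toR3 fun i => pd2 (vmul (F i)) q := by
  rw [pd2, (h.hasFDerivAt_coneMap hq).fderiv]; rfl

lemma coneMap_analytic (h : ConeSol H B A F δ) : AnalyticOnNhd ℝ (coneMap F) (Strip2 δ) :=
  fun q hq => ((h.sol.analytic 0).vmul q hq).prod
    (((h.sol.analytic 1).vmul q hq).prod ((h.sol.analytic 2).vmul q hq))

lemma coneMap_axis (F : Fin 3 → ℝ × ℝ → ℝ) (u : ℝ) : coneMap F (u, 0) = (0, 0, 0) := by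
  simp [coneMap, toR3, vmul]

lemma pd2_coneMap_axis (h : ConeSol H B A F δ) (u : ℝ) :
    pd2 (coneMap F) (u, 0) = (A u * cos u, -(A u * sin u), A u) := by
  rw [h.pd2_coneMap (h.axis_mem u)]
  simp only [h.sol.pd2_vmul_axis _ (h.axis_mem u)]
  rfl

/-- A graph parametrized by `v F` has a non-removable singularity at the origin. -/
lemma not_removable (h : ConeSol H B A F δ) {R : ℝ} (hR : 0 < R) {z : ℝ × ℝ → ℝ}
    (hz : ∀ q ∈ Strip R, z (planeMap (F 0) (F 1) q) = vmul (F 2) q)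
    (hne : ∀ q ∈ Strip R, planeMap (F 0) (F 1) q ≠ 0) : ¬ RemovableSing 0 0 z := by
  rintro ⟨ε, hε, Z, hZ, hZz⟩
  have hZd : DifferentiableAt ℝ Z (0, 0) :=
    (hZ.contDiffAt (ball_mem_nhds _ hε)).differentiableAt (by norm_num)
  have key : ∀ u, fderiv ℝ Z (0, 0) (A u * cos u, -(A u * sin u)) = A u := by
    intro u
    have hd := fun i => ((h.sol.analytic i).vmul _ (h.axis_mem u)).differentiableAt
    have hs := fun i => (hasDerivAt_slice (hd i)).congr_deriv
      (h.sol.pd2_vmul_axis i (h.axis_mem u))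
    have hγ : HasDerivAt (fun v => planeMap (F 0) (F 1) (u, v)) (A u * cos u, -(A u * sin u)) 0 :=
      (hs 0).prodMk (hs 1)
    have hγ0 : planeMap (F 0) (F 1) (u, 0) = (0, 0) := by simp [planeMap, vmul]
    have hZγ : HasDerivAt (fun v => Z (planeMap (F 0) (F 1) (u, v)))
        (fderiv ℝ Z (0, 0) (A u * cos u, -(A u * sin u))) 0 := by
      refine HasFDerivAt.comp_hasDerivAt (x := (0 : ℝ)) ?_ hγ
      rw [hγ0]; exact hZd.hasFDerivAt
    have heq : (fun v => vmul (F 2) (u, v)) =ᶠ[nhdsWithin 0 (Ioi 0)]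
        fun v => Z (planeMap (F 0) (F 1) (u, v)) := by
      have h1 : ∀ᶠ v in nhdsWithin (0 : ℝ) (Ioi 0),
          planeMap (F 0) (F 1) (u, v) ∈ ball ((0, 0) : ℝ × ℝ) ε :=
        (hγ.continuousAt.eventually_mem (by
          rw [hγ0]; exact ball_mem_nhds _ hε)).filter_mono nhdsWithin_le_nhds
      filter_upwards [h1, Ioo_mem_nhdsGT hR] with v hv hvR
      rw [hZz _ hv (hne (u, v) hvR), hz (u, v) hvR]
    have h2 : HasDerivAt (fun v => vmul (F 2) (u, v)) (A u) 0 := hs 2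
    have h0 : vmul (F 2) (u, 0) = Z (planeMap (F 0) (F 1) (u, 0)) :=
      tendsto_nhds_unique_of_eventuallyEq (h2.continuousAt.mono_left nhdsWithin_le_nhds)
        (hZγ.continuousAt.mono_left nhdsWithin_le_nhds) heq
    have h3 := h2.hasDerivWithinAt (s := Ioi 0)
    exact (uniqueDiffWithinAt_Ioi (0 : ℝ)).eq_deriv _ hZγ.hasDerivWithinAt
      (h3.congr_of_eventuallyEq heq.symm h0.symm)
  have k0 := key 0
  have k1 := key π
  have s0 : ((A 0 * cos 0, -(A 0 * sin 0)) : ℝ × ℝ) = A 0 • (1, 0) := by simp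
  have s1 : ((A π * cos π, -(A π * sin π)) : ℝ × ℝ) = A π • -(1, 0) := by simp
  rw [s0, map_smul, smul_eq_mul] at k0
  rw [s1, map_smul, smul_eq_mul, map_neg] at k1
  have e0 := mul_left_cancel₀ (h.memA.2.2 0) (k0.trans (mul_one _).symm)
  have e1 := mul_left_cancel₀ (h.memA.2.2 π) (k1.trans (mul_one _).symm)
  linarith

/-- Strips on which the surface `v F` is a regular graph with nondegenerate second fundamental
form. -/
structure GoodWidth (H : R3 → ℝ) (F : Fin 3 → ℝ × ℝ → ℝ) (δ R : ℝ) : Prop where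
  pos : 0 < R
  le : R ≤ δ
  jac : ∀ q ∈ Strip R, 0 < reducedJac (F 0) (F 1) q
  sq : ∀ q ∈ Strip R, 0 < F 0 q ^ 2 + F 1 q ^ 2
  metric : ∀ q ∈ Strip R, 0 < coneMetric F q
  slope : ∀ q ∈ Strip R, 0 < 4 * (F 0 q ^ 2 + F 1 q ^ 2) - F 2 q ^ 2
  det : ∀ q ∈ Strip R, 0 < coneDet H F q
  inj : ∀ p ∈ Strip R, ∀ q ∈ Strip R, planeMap (F 0) (F 1) p = planeMap (F 0) (F 1) q →
    p.2 = q.2 ∧ ∃ n : ℤ, p.1 - q.1 = 2 * π * n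

lemma _root_.abs_lt_of_mem_strip {R S : ℝ} (h : R ≤ S) {q : ℝ × ℝ} (hq : q ∈ Strip R) :
    |q.2| < S := by
  rw [abs_of_pos hq.1]; exact hq.2.trans_le h

lemma _root_.strip_mono {R S : ℝ} (h : R ≤ S) : Strip R ⊆ Strip S := fun _ hq =>
  ⟨hq.1, hq.2.trans_le h⟩

lemma exists_goodWidth (h : ConeSol H B A F δ) : ∃ R, GoodWidth H F δ R := by
  obtain ⟨R₁, p₁, h₁⟩ := h.polarField.exists_reducedJac_pos
  obtain ⟨R₂, p₂, h₂⟩ := h.polarField.exists_sq_add_sq_pos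
  obtain ⟨R₃, p₃, h₃⟩ := h.exists_coneMetric_pos
  obtain ⟨R₄, p₄, h₄⟩ := h.exists_slope_pos
  obtain ⟨R₅, p₅, h₅⟩ := h.exists_coneDet_pos
  obtain ⟨R₆, p₆, h₆⟩ := h.polarField.exists_injective
  have p₀ := h.pos
  obtain ⟨R, hR, hRlt⟩ := exists_between
    (show 0 < min δ (min R₁ (min R₂ (min R₃ (min R₄ (min R₅ R₆))))) by positivity)
  simp only [lt_min_iff] at hRlt
  obtain ⟨l₀, l₁, l₂, l₃, l₄, l₅, l₆⟩ := hRlt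
  exact ⟨R, hR, l₀.le, fun q hq => h₁ q (abs_lt_of_mem_strip l₁.le hq),
    fun q hq => h₂ q (abs_lt_of_mem_strip l₂.le hq),
    fun q hq => h₃ q (abs_lt_of_mem_strip l₃.le hq),
    fun q hq => h₄ q (abs_lt_of_mem_strip l₄.le hq),
    fun q hq => h₅ q (abs_lt_of_mem_strip l₅.le hq),
    fun p hp q hq e => h₆ p (strip_mono l₆.le hp) q (strip_mono l₆.le hq) (congrArg Prod.fst e)
      (congrArg Prod.snd e)⟩

namespace GoodWidth
variable {R : ℝ}

lemma mono (g : GoodWidth H F δ R) {S : ℝ} (hS : 0 < S) (hSR : S ≤ R) : GoodWidth H F δ S where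
  pos := hS
  le := hSR.trans g.le
  jac q hq := g.jac q (strip_mono hSR hq)
  sq q hq := g.sq q (strip_mono hSR hq)
  metric q hq := g.metric q (strip_mono hSR hq)
  slope q hq := g.slope q (strip_mono hSR hq)
  det q hq := g.det q (strip_mono hSR hq)
  inj p hp q hq := g.inj p (strip_mono hSR hp) q (strip_mono hSR hq)

lemma planeMap_sq (F : Fin 3 → ℝ × ℝ → ℝ) (q : ℝ × ℝ) : (planeMap (F 0) (F 1) q).1 ^ 2 +
    (planeMap (F 0) (F 1) q).2 ^ 2 = q.2 ^ 2 * (F 0 q ^ 2 + F 1 q ^ 2) := by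
  simp only [planeMap, vmul]; ring

lemma planeMap_sq_pos (g : GoodWidth H F δ R) {q : ℝ × ℝ} (hq : q ∈ Strip R) :
    0 < (planeMap (F 0) (F 1) q).1 ^ 2 + (planeMap (F 0) (F 1) q).2 ^ 2 := by
  rw [planeMap_sq]
  exact mul_pos (pow_pos hq.1 2) (g.sq q hq)

lemma planeMap_ne (g : GoodWidth H F δ R) {q : ℝ × ℝ} (hq : q ∈ Strip R) :
    planeMap (F 0) (F 1) q ≠ 0 := fun h0 => by
  have := g.planeMap_sq_pos hq
  rw [h0] at this; simp at this

lemma coneGraph_planeMap (h : ConeSol H B A F δ) (g : GoodWidth H F δ R) {q : ℝ × ℝ}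
    (hq : q ∈ Strip R) : coneGraph F R (planeMap (F 0) (F 1) q) = vmul (F 2) q := by
  have hex : ∃ a ∈ Strip R, planeMap (F 0) (F 1) a = planeMap (F 0) (F 1) q := ⟨q, hq, rfl⟩
  obtain ⟨h2, n, h1⟩ := g.inj _ (Function.invFunOn_mem hex) _ hq (Function.invFunOn_eq hex)
  rw [coneGraph]
  set x := Function.invFunOn (planeMap (F 0) (F 1)) (Strip R) (planeMap (F 0) (F 1) q)
  have hx : x = (q.1 + n * (2 * π), q.2) := by ext <;> simp <;> linarith
  have hper : Function.Periodic (fun u => F 2 (u, q.2)) (2 * π) := fun u => h.per 2 u _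
  have h3 := (hper.int_mul n) q.1
  simp only [vmul, hx]
  rw [h3]

lemma coneGraph_analyticAt (h : ConeSol H B A F δ) (g : GoodWidth H F δ R) {q : ℝ × ℝ}
    (hq : q ∈ Strip R) : AnalyticAt ℝ (coneGraph F R) (planeMap (F 0) (F 1) q) := by
  obtain ⟨e, he, heq, hea⟩ := h.polarField.exists_planeMap_inverse g.le hq (g.jac q hq)
  have hsymm : e.symm (planeMap (F 0) (F 1) q) = q := by rw [← heq, e.left_inv he]
  have h1 : AnalyticAt ℝ (fun x => vmul (F 2) (e.symm x)) (planeMap (F 0) (F 1) q) := by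
    refine AnalyticAt.fun_comp ?_ hea
    rw [hsymm]
    exact (h.sol.analytic 2).vmul q (PolarField.strip_subset g.le hq)
  refine h1.congr ?_
  have h2 : ∀ᶠ x in nhds (planeMap (F 0) (F 1) q), e.symm x ∈ Strip R :=
    hea.continuousAt.eventually_mem (by
      rw [hsymm]; exact (PolarField.isOpen_strip R).mem_nhds hq)
  have h3 : e.target ∈ nhds (planeMap (F 0) (F 1) q) := by
    rw [← heq]; exact e.open_target.mem_nhds (e.map_source he)
  filter_upwards [h2, h3] with x hx hxt
  have : planeMap (F 0) (F 1) (e.symm x) = x := by rw [← heq, e.right_inv hxt]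
  rw [← coneGraph_planeMap h g hx, this]

lemma graphJet (h : ConeSol H B A F δ) (g : GoodWidth H F δ R) {q : ℝ × ℝ} (hq : q ∈ Strip R) :
    GraphJet (vmul (F 0)) (vmul (F 1)) (vmul (F 2)) (coneGraph F R) q := by
  have hm := PolarField.strip_subset g.le hq
  refine graphJet_of_eventually ((h.sol.analytic 0).vmul q hm) ((h.sol.analytic 1).vmul q hm)
    (coneGraph_analyticAt h g hq) ?_
  filter_upwards [(PolarField.isOpen_strip R).mem_nhds hq] with x hx
  exact (coneGraph_planeMap h g hx).symm

lemma coneGraph_sq_le (h : ConeSol H B A F δ) (g : GoodWidth H F δ R) {p : ℝ × ℝ}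
    (hp : p ∈ planeMap (F 0) (F 1) '' Strip R) : coneGraph F R p ^ 2 ≤ 4 * (p.1 ^ 2 + p.2 ^ 2) := by
  obtain ⟨q, hq, rfl⟩ := hp
  rw [coneGraph_planeMap h g hq, planeMap_sq]
  have := mul_pos (pow_pos hq.1 2) (g.slope q hq)
  simp only [vmul]
  linarith

lemma graph_spec (h : ConeSol H B A F δ) (g : GoodWidth H F δ R) {p : ℝ × ℝ}
    (hp : p ∈ planeMap (F 0) (F 1) '' Strip R) :
    (zx (coneGraph F R) p) ^ 2 + (zy (coneGraph F R) p) ^ 2 < 1 ∧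
    (1 - (zy (coneGraph F R) p) ^ 2) * zxx (coneGraph F R) p +
        2 * zx (coneGraph F R) p * zy (coneGraph F R) p * zxy (coneGraph F R) p +
        (1 - (zx (coneGraph F R) p) ^ 2) * zyy (coneGraph F R) p
      = 2 * H (p.1, p.2, coneGraph F R p) *
        (1 - (zx (coneGraph F R) p) ^ 2 - (zy (coneGraph F R) p) ^ 2) ^ ((3 : ℝ) / 2) ∧
    hessDet (coneGraph F R) p ≠ 0 := by
  obtain ⟨q, hq, rfl⟩ := hp
  exact h.graph_spec (PolarField.strip_subset g.le hq) hq.1 (g.jac q hq) (g.metric q hq)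
    (g.det q hq) (graphJet h g hq) rfl (coneGraph_planeMap h g hq)

lemma isEllSol (h : ConeSol H B A F δ) (g : GoodWidth H F δ R) {ρ : ℝ}
    (hρ : PDisk 0 0 ρ ⊆ planeMap (F 0) (F 1) '' Strip R) :
    IsEllSol H B (PDisk 0 0 ρ) (coneGraph F R) := by
  refine ⟨fun p hp => ?_, fun p hp => ?_, fun p hp => (graph_spec h g (hρ hp)).1,
    fun p hp => (graph_spec h g (hρ hp)).2.1⟩
  · obtain ⟨q, hq, rfl⟩ := hρ hp
    exact (coneGraph_analyticAt h g hq).contDiffAt.contDiffWithinAt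
  · obtain ⟨q, hq, rfl⟩ := hρ hp
    rw [coneGraph_planeMap h g hq]
    exact h.sol.mem q (PolarField.strip_subset g.le hq)

lemma tendsto_coneGraph (h : ConeSol H B A F δ) (g : GoodWidth H F δ R) {ρ : ℝ}
    (hρ : PDisk 0 0 ρ ⊆ planeMap (F 0) (F 1) '' Strip R) :
    Tendsto (coneGraph F R) (nhdsWithin ((0, 0) : ℝ × ℝ) (PDisk 0 0 ρ)) (nhds 0) := by
  have h1 : Tendsto (fun p : ℝ × ℝ => √(4 * (p.1 ^ 2 + p.2 ^ 2))) (nhds (0, 0)) (nhds 0) := by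
    have : Continuous fun p : ℝ × ℝ => √(4 * (p.1 ^ 2 + p.2 ^ 2)) := by fun_prop
    simpa using this.tendsto (0, 0)
  refine squeeze_zero_norm' ?_ (h1.mono_left nhdsWithin_le_nhds)
  filter_upwards [self_mem_nhdsWithin] with p hp
  exact Real.abs_le_sqrt (coneGraph_sq_le h g (hρ hp))

lemma exists_image_subset_pdisk (h : ConeSol H B A F δ) (g : GoodWidth H F δ R) {ρ : ℝ}
    (hρ : 0 < ρ) : ∃ S, 0 < S ∧ S ≤ R ∧ planeMap (F 0) (F 1) '' Strip S ⊆ PDisk 0 0 ρ := by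
  have hc := fun i u => ((h.sol.analytic i _ (h.axis_mem u)).continuousAt).pow 2
  obtain ⟨S, hS, h1⟩ := exists_strip_pos
    (f := fun q => ρ ^ 2 - q.2 ^ 2 * (F 0 q ^ 2 + F 1 q ^ 2))
    (fun u v => by simp only [h.per])
    (fun u => continuousAt_const.sub ((continuous_snd.continuousAt.pow 2).mul
      ((hc 0 u).add (hc 1 u))))
    (fun u => by simp; positivity)
  refine ⟨min R S, lt_min g.pos hS, min_le_left _ _, ?_⟩
  rintro _ ⟨q, hq, rfl⟩
  rw [mem_pdisk]
  refine ⟨g.planeMap_sq_pos (strip_mono (min_le_left _ _) hq), ?_⟩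
  rw [planeMap_sq]
  linarith [h1 q (abs_lt_of_mem_strip (min_le_right _ _) hq)]

lemma isConfParam (h : ConeSol H B A F δ) (g : GoodWidth H F δ R) {ρ S : ℝ} (hS : 0 < S)
    (hSR : S ≤ R) (hSρ : planeMap (F 0) (F 1) '' Strip S ⊆ PDisk 0 0 ρ) :
    IsConfParam (coneGraph F R) (PDisk 0 0 ρ) 0 0 S (coneMap F) := by
  have g' := g.mono hS hSR
  have hm : ∀ {q}, q ∈ Strip S → q ∈ Strip2 δ := fun hq => PolarField.strip_subset g'.le hq
  refine ⟨hS, fun q hq => (h.coneMap_analytic q (hm hq)).contDiffAt.contDiffWithinAt,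
    fun u v => by simp only [coneMap, h.vmul_periodic],
    ⟨planeMap (F 0) (F 1) '' Strip S, hSρ, ?_, ?_, rfl⟩, g'.inj, fun q hq => ?_,
    fun q hq => (coneGraph_planeMap h g (strip_mono hSR hq)).symm, fun q hq => ?_⟩
  · rintro ⟨q, hq, hq0⟩
    exact g'.planeMap_ne hq hq0
  · obtain ⟨r, hr, hsub⟩ := h.polarField.exists_pdisk_subset hS g'.le g'.jac g'.sq
    have hc : Continuous fun p : ℝ × ℝ => p.1 ^ 2 + p.2 ^ 2 := by fun_prop
    refine Filter.mem_of_superset ((isOpen_lt hc (continuous_const (y := r ^ 2))).mem_nhds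
      (by simp; positivity)) fun p hp => ?_
    rcases (add_nonneg (sq_nonneg p.1) (sq_nonneg p.2)).eq_or_lt with h0 | h0
    · left
      have h1 : p.1 = 0 := by nlinarith [sq_nonneg p.1, sq_nonneg p.2]
      have h2 : p.2 = 0 := by nlinarith [sq_nonneg p.1, sq_nonneg p.2]
      exact Prod.ext h1 h2
    · exact Or.inr (hsub (mem_pdisk.2 ⟨h0, hp⟩))
  · have hd := fun i => (h.sol.analytic i q (hm hq)).differentiableAt
    have := PolarField.jac_eq (hd 0) (hd 1)
    have h2 := mul_pos hq.1 (g'.jac q hq)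
    rw [← this] at h2
    exact h2
  · rw [h.pd1_coneMap (hm hq), h.pd2_coneMap (hm hq)]
    have hc := h.conformal (hm hq)
    have h2 := mul_pos (pow_pos hq.1 2) (g'.metric q hq)
    rw [← h.lf_pd1_vmul (hm hq)] at h2
    exact ⟨hc.1, h2, hc.2⟩

lemma extAnal (h : ConeSol H B A F δ) (g : GoodWidth H F δ R) :
    ExtAnal (coneMap F) R (0, 0, 0) A :=
  ⟨R, g.pos, coneMap F, fun q hq => h.coneMap_analytic q
    ⟨by linarith [hq.1, g.le], hq.2.trans_le g.le⟩, fun _ _ => rfl, coneMap_axis F,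
    h.pd2_coneMap_axis⟩

end GoodWidth
end ConeSol

/-- Every admissible `A` is the initial direction of a conformal solution. -/
lemma exists_coneSol {H : R3 → ℝ} {O : Set R3} {A : ℝ → ℝ} (hO : IsOpen O)
    (h0 : ((0, 0, 0) : R3) ∈ O) (hH : AnalyticOnNhd ℝ H O) (hA : MemA2 A) :
    ∃ F δ, ConeSol H O A F δ := by
  have ha : ∀ u, AnalyticAt ℝ A u := fun u => hA.1 u (mem_univ u)
  obtain ⟨δ, hδ, F, hF, hper⟩ := exists_isSol_strip (a := coneCurve A) (hO.mem_nhds h0) hH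
    (fun i u => by
      fin_cases i
      · exact (ha u).mul analyticAt_cos
      · exact ((ha u).mul analyticAt_sin).neg
      · exact ha u)
    (fun i u => by fin_cases i <;> simp [coneCurve, hA.2.1])
  exact ⟨F, δ, hδ, hA, hH, hF, hper⟩

/-- Theorem `existence`: for any positive real-analytic `ℋ` near the
origin and any 2π-periodic real-analytic nowhere-vanishing `A`, there is a real-analytic
elliptic solution `z` of the prescribed mean curvature equation on a punctured disk
around the origin, continuous up to the origin with `z(0,0) = 0`, with a non-removable
singularity, whose graph admits a conformal parametrization extending real-analytically
across `v = 0` with `∂_vψ(u,0) = A(u)(cos u, −sin u, 1)`, and with nonvanishing Hessian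
determinant near the origin. -/
theorem stmt6 (O : Set R3) (H : R3 → ℝ) (A : ℝ → ℝ)
    (hO : IsOpen O) (h0 : ((0, 0, 0) : R3) ∈ O)
    (hHa : AnalyticOnNhd ℝ H O) (hHpos : ∀ p ∈ O, 0 < H p)
    (hA : MemA2 A) :
    ∃ (ρ : ℝ) (z : ℝ × ℝ → ℝ), 0 < ρ ∧
      AnalyticOnNhd ℝ z (PDisk 0 0 ρ) ∧
      Tendsto z (nhdsWithin ((0, 0) : ℝ × ℝ) (PDisk 0 0 ρ)) (nhds (0 : ℝ)) ∧
      IsEllSol H O (PDisk 0 0 ρ) z ∧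
      ¬ RemovableSing 0 0 z ∧
      (∃ (R : ℝ) (ψ : ℝ × ℝ → R3),
        IsConfParam z (PDisk 0 0 ρ) 0 0 R ψ ∧ ExtAnal ψ R ((0, 0, 0) : R3) A) ∧
      ∃ ε : ℝ, 0 < ε ∧ ε ≤ ρ ∧ ∀ p ∈ PDisk 0 0 ε, hessDet z p ≠ 0 := by
  obtain ⟨F, δ, h⟩ := exists_coneSol hO h0 hHa hA
  obtain ⟨R, g⟩ := h.exists_goodWidth
  obtain ⟨ρ, hρ, hsub⟩ := h.polarField.exists_pdisk_subset g.pos g.le g.jac g.sq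
  obtain ⟨S, hS, hSR, hSρ⟩ := ConeSol.GoodWidth.exists_image_subset_pdisk h g hρ
  refine ⟨ρ, coneGraph F R, hρ, fun p hp => ?_, ConeSol.GoodWidth.tendsto_coneGraph h g hsub,
    ConeSol.GoodWidth.isEllSol h g hsub,
    h.not_removable g.pos (fun q hq => ConeSol.GoodWidth.coneGraph_planeMap h g hq)
      (fun q hq => g.planeMap_ne hq),
    ⟨S, coneMap F, ConeSol.GoodWidth.isConfParam h g hS hSR hSρ,
      ConeSol.GoodWidth.extAnal h (g.mono hS hSR)⟩,
    ρ, hρ, le_rfl, fun p hp => (ConeSol.GoodWidth.graph_spec h g (hsub hp)).2.2⟩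
  obtain ⟨q, hq, rfl⟩ := hsub hp
  exact ConeSol.GoodWidth.coneGraph_analyticAt h g hq
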